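/- Let φ : ℝ³ → ℝ be a smooth convex entire solution of the translator equation Θ[φ] = 0 (i.e. graph(φ) ⊂ ℝ⁴ is a noncollapsed translator). Then there exists a constant ε > 0 such that at every point of ℝ³ one has L_φ(φ + log H_φ) ≥ ε · H_φ. -/

import Mathlib

open Real

noncomputable section

/-- Euclidean 3-space. -/
abbrev E3 : Type := EuclideanSpace ℝ (Fin 3)

/-- The point (a,b,c) ∈ ℝ³. -/
def mk3 (a b c : ℝ) : E3 := (WithLp.equiv 2 (Fin 3 → ℝ)).symm ![a, b, c]

/-- Partial derivative in the i-th coordinate direction. -/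
def pd (i : Fin 3) (f : E3 → ℝ) (x : E3) : ℝ := fderiv ℝ f x (EuclideanSpace.single i 1)

/-- Squared norm of the gradient, |Dφ|². -/
def gradSq (φ : E3 → ℝ) (x : E3) : ℝ := ∑ i, (pd i φ x) ^ 2

/-- Divergence of a vector field on ℝ³, given componentwise. -/
def divg (F : Fin 3 → E3 → ℝ) (x : E3) : ℝ := ∑ i, pd i (F i) x

/-- Mean curvature of graph(φ): H_φ = 1/√(1+|Dφ|²). -/
def Hmc (φ : E3 → ℝ) (x : E3) : ℝ := 1 / sqrt (1 + gradSq φ x)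

/-- The translator operator Θ[φ] = div(Dφ/√(1+|Dφ|²)) − 1/√(1+|Dφ|²). -/
def Θop (φ : E3 → ℝ) (x : E3) : ℝ :=
  divg (fun i y => pd i φ y / sqrt (1 + gradSq φ y)) x - 1 / sqrt (1 + gradSq φ x)

/-- The linearized translator operator L_φ u = div(a_φ Du) + b_φ · Du. -/
def Lop (φ u : E3 → ℝ) (x : E3) : ℝ :=
  divg (fun i y => ∑ j, ((if i = j then (1:ℝ) else 0) / sqrt (1 + gradSq φ y)
        - pd i φ y * pd j φ y / (1 + gradSq φ y) ^ ((3:ℝ)/2)) * pd j u y) x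
  + ∑ i, pd i φ x * pd i u x / (1 + gradSq φ x) ^ ((3:ℝ)/2)

/-- Entries of the Hessian of φ. -/
def hess (φ : E3 → ℝ) (x : E3) (i j : Fin 3) : ℝ := pd i (pd j φ) x

section

/-! ### Directional derivatives and second order jets -/

/-- Directional derivative. -/
def dd (e : E3) (u : E3 → ℝ) (x : E3) : ℝ := fderiv ℝ u x e

/-- Smooth real functions on 3-space. -/
abbrev Sm (u : E3 → ℝ) : Prop := ContDiff ℝ (⊤ : ℕ∞) u

theorem Sm.dd {u : E3 → ℝ} (hu : Sm u) (e : E3) : Sm (dd e u) := by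
  have h : Sm (fun x => fderiv ℝ u x e) :=
    (hu.fderiv_right (m := (⊤ : ℕ∞)) (by simp)).clm_apply contDiff_const
  exact h

theorem Sm.diff {u : E3 → ℝ} (hu : Sm u) (x : E3) : DifferentiableAt ℝ u x :=
  hu.contDiffAt.differentiableAt (by simp)

theorem dd_comm {u : E3 → ℝ} (hu : Sm u) (e e' : E3) : dd e (dd e' u) = dd e' (dd e u) := by
  funext x
  have hd : DifferentiableAt ℝ (fderiv ℝ u) x :=
    (hu.fderiv_right (m := (⊤ : ℕ∞)) (by simp)).contDiffAt.differentiableAt (by simp)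
  have key : ∀ a c : E3, dd a (dd c u) x = fderiv ℝ (fderiv ℝ u) x a c := by
    intro a c
    have : HasFDerivAt (fun y => fderiv ℝ u y c) ((fderiv ℝ (fderiv ℝ u) x).flip c) x :=
      hd.hasFDerivAt.clm_apply (hasFDerivAt_const c x) |>.congr_fderiv (by ext; simp)
    have h2 := this.fderiv
    unfold dd
    rw [h2]; rfl
  rw [key, key]
  have hs : IsSymmSndFDerivAt ℝ u x :=
    hu.contDiffAt.isSymmSndFDerivAt (by simp [minSmoothness_of_isRCLikeNormedField]; exact WithTop.coe_le_coe.2 le_top)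
  exact hs e e'

theorem dd_add_dir (e e' : E3) (u : E3 → ℝ) (x : E3) :
    dd (e + e') u x = dd e u x + dd e' u x := by simp [dd]

theorem dd_smul_dir (c : ℝ) (e : E3) (u : E3 → ℝ) (x : E3) :
    dd (c • e) u x = c * dd e u x := by simp [dd]

theorem dd_sum_dir {ι : Type*} (s : Finset ι) (c : ι → ℝ) (e : ι → E3) (u : E3 → ℝ) (x : E3) :
    dd (∑ i ∈ s, c i • e i) u x = ∑ i ∈ s, c i * dd (e i) u x := by simp [dd, map_sum]

/-- Second order jet of a smooth function at `x` along two directions. -/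
structure J (x e e' : E3) (u : E3 → ℝ) (a d d' h : ℝ) : Prop where
  sm : Sm u
  val : u x = a
  fst : dd e u x = d
  snd : dd e' u x = d'
  hes : dd e (dd e' u) x = h

theorem J.of {u : E3 → ℝ} (hu : Sm u) (x e e' : E3) :
    J x e e' u (u x) (dd e u x) (dd e' u x) (dd e (dd e' u) x) := ⟨hu, rfl, rfl, rfl, rfl⟩

variable {x e e' : E3} {u w : E3 → ℝ} {a d d' h a₁ d₁ d₁' h₁ : ℝ}

theorem dd_add (hu : Sm u) (hw : Sm w) (e : E3) :
    dd e (fun y => u y + w y) = fun y => dd e u y + dd e w y := by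
  funext y
  unfold dd
  rw [HasFDerivAt.fderiv (f := fun y => u y + w y)
    ((hu.diff y).hasFDerivAt.add (hw.diff y).hasFDerivAt)]; rfl

theorem dd_mul (hu : Sm u) (hw : Sm w) (e : E3) :
    dd e (fun y => u y * w y) = fun y => u y * dd e w y + w y * dd e u y := by
  funext y
  unfold dd
  rw [HasFDerivAt.fderiv (f := fun y => u y * w y)
    ((hu.diff y).hasFDerivAt.mul (hw.diff y).hasFDerivAt)]; simp

theorem dd_const (c : ℝ) (e : E3) : dd e (fun _ => c) = fun _ => 0 := by
  funext y; simp [dd]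

theorem dd_comp {g g' : ℝ → ℝ} {y : E3} (hu : Sm u) (hg : HasDerivAt g (g' (u y)) (u y)) (e : E3) :
    dd e (fun y => g (u y)) y = g' (u y) * dd e u y := by
  unfold dd
  rw [HasFDerivAt.fderiv (f := fun y => g (u y))
    (hg.comp_hasFDerivAt y (hu.diff y).hasFDerivAt)]; simp

theorem dd_inner (c e : E3) : dd e (fun y => inner ℝ c y) = fun _ => inner ℝ c e := by
  funext y
  have : HasFDerivAt (fun y : E3 => inner ℝ c y) (innerSL ℝ c) y := (innerSL ℝ c).hasFDerivAt
  simp [dd, this.fderiv]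

theorem sm_inner (c : E3) : Sm (fun y => inner ℝ c y) := (innerSL ℝ c).contDiff

theorem J.const (x e e' : E3) (c : ℝ) : J x e e' (fun _ => c) c 0 0 0 :=
  ⟨contDiff_const, rfl, by simp [dd_const], by simp [dd_const], by simp [dd_const]⟩

theorem J.inner (x e e' c : E3) :
    J x e e' (fun y => inner ℝ c y) (inner ℝ c x) (inner ℝ c e) (inner ℝ c e') 0 :=
  ⟨sm_inner c, rfl, by simp [dd_inner], by simp [dd_inner], by simp [dd_inner, dd_const]⟩

theorem J.add (hu : J x e e' u a d d' h) (hw : J x e e' w a₁ d₁ d₁' h₁) :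
    J x e e' (fun y => u y + w y) (a + a₁) (d + d₁) (d' + d₁') (h + h₁) := by
  refine ⟨hu.sm.add hw.sm, by rw [hu.val, hw.val], ?_, ?_, ?_⟩
  · rw [dd_add hu.sm hw.sm, ← hu.fst, ← hw.fst]
  · rw [dd_add hu.sm hw.sm, ← hu.snd, ← hw.snd]
  · rw [dd_add hu.sm hw.sm, dd_add (hu.sm.dd _) (hw.sm.dd _), ← hu.hes, ← hw.hes]

theorem J.mul (hu : J x e e' u a d d' h) (hw : J x e e' w a₁ d₁ d₁' h₁) :
    J x e e' (fun y => u y * w y) (a * a₁) (a * d₁ + a₁ * d) (a * d₁' + a₁ * d')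
      (a * h₁ + a₁ * h + d * d₁' + d' * d₁) := by
  refine ⟨hu.sm.mul hw.sm, by rw [hu.val, hw.val], ?_, ?_, ?_⟩
  · rw [dd_mul hu.sm hw.sm, ← hu.fst, ← hw.fst, ← hu.val, ← hw.val]
  · rw [dd_mul hu.sm hw.sm, ← hu.snd, ← hw.snd, ← hu.val, ← hw.val]
  · rw [dd_mul hu.sm hw.sm, dd_add (hu.sm.mul (hw.sm.dd _)) (hw.sm.mul (hu.sm.dd _)),
      dd_mul hu.sm (hw.sm.dd _), dd_mul hw.sm (hu.sm.dd _)]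
    simp only [← hu.hes, ← hw.hes, ← hu.fst, ← hu.snd, ← hw.fst, ← hw.snd, ← hu.val, ← hw.val]
    ring

theorem J.smul (c : ℝ) (hu : J x e e' u a d d' h) :
    J x e e' (fun y => c * u y) (c * a) (c * d) (c * d') (c * h) := by
  have := (J.const x e e' c).mul hu
  simpa using this

theorem J.sub (hu : J x e e' u a d d' h) (hw : J x e e' w a₁ d₁ d₁' h₁) :
    J x e e' (fun y => u y - w y) (a - a₁) (d - d₁) (d' - d₁') (h - h₁) := by
  have := hu.add (hw.smul (-1))
  simpa [sub_eq_add_neg] using this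

theorem J.comp {g g' g'' : ℝ → ℝ} (hu : J x e e' u a d d' h) (hs : Sm (fun y => g (u y)))
    (hg : ∀ y, HasDerivAt g (g' (u y)) (u y)) (hs' : Sm (fun y => g' (u y)))
    (hg' : ∀ y, HasDerivAt g' (g'' (u y)) (u y)) :
    J x e e' (fun y => g (u y)) (g a) (g' a * d) (g' a * d') (g' a * h + g'' a * d * d') := by
  have h1 : ∀ e, dd e (fun y => g (u y)) = fun y => g' (u y) * dd e u y := by
    intro e; funext y; exact dd_comp hu.sm (hg y) e
  refine ⟨hs, by rw [hu.val], ?_, ?_, ?_⟩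
  · rw [h1, ← hu.val, ← hu.fst]
  · rw [h1, ← hu.val, ← hu.snd]
  · rw [h1, dd_mul hs' (hu.sm.dd _)]
    simp only
    rw [dd_comp hu.sm (hg' x)]
    simp only [← hu.hes, ← hu.fst, ← hu.snd, ← hu.val]
    ring

theorem J.inv (hu : J x e e' u a d d' h) (h0 : ∀ y, u y ≠ 0) :
    J x e e' (fun y => (u y)⁻¹) a⁻¹ (-(a ^ 2)⁻¹ * d) (-(a ^ 2)⁻¹ * d')
      (-(a ^ 2)⁻¹ * h + 2 * (a ^ 3)⁻¹ * d * d') := by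
  refine hu.comp (g := fun t => t⁻¹) (g' := fun t => -(t ^ 2)⁻¹) (g'' := fun t => 2 * (t ^ 3)⁻¹)
    (hu.sm.inv h0) (fun y => hasDerivAt_inv (h0 y))
    ((hu.sm.pow 2).inv (fun y => pow_ne_zero _ (h0 y))).neg (fun y => ?_)
  have := ((hasDerivAt_pow 2 (u y)).inv (pow_ne_zero _ (h0 y))).neg
  refine this.congr_deriv ?_
  field_simp [h0 y]
  ring

theorem J.log (hu : J x e e' u a d d' h) (h0 : ∀ y, 0 < u y) :
    J x e e' (fun y => Real.log (u y)) (Real.log a) (a⁻¹ * d) (a⁻¹ * d')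
      (a⁻¹ * h + -(a ^ 2)⁻¹ * d * d') := 
  hu.comp (g := fun t => Real.log t) (g' := fun t => t⁻¹) (g'' := fun t => -(t ^ 2)⁻¹)
    (hu.sm.log fun y => (h0 y).ne') (fun y => Real.hasDerivAt_log (h0 y).ne')
    (hu.sm.inv fun y => (h0 y).ne') (fun y => hasDerivAt_inv (h0 y).ne')

theorem J.sqrt (hu : J x e e' u a d d' h) (h0 : ∀ y, 0 < u y) :
    J x e e' (fun y => Real.sqrt (u y)) (Real.sqrt a) (1 / (2 * Real.sqrt a) * d)
      (1 / (2 * Real.sqrt a) * d')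
      (1 / (2 * Real.sqrt a) * h + -(1 / (4 * a * Real.sqrt a)) * d * d') := by
  refine hu.comp (g := fun t => Real.sqrt t) (g' := fun t => 1 / (2 * Real.sqrt t))
    (g'' := fun t => -(1 / (4 * t * Real.sqrt t)))
    (hu.sm.sqrt fun y => (h0 y).ne') (fun y => Real.hasDerivAt_sqrt (h0 y).ne')
    ?_ (fun y => ?_)
  · exact contDiff_const.div (contDiff_const.mul (hu.sm.sqrt fun y => (h0 y).ne'))
      (fun y => by have := Real.sqrt_pos.2 (h0 y); positivity)
  · have hp := Real.sqrt_pos.2 (h0 y)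
    have := ((Real.hasDerivAt_sqrt (h0 y).ne').const_mul 2).inv (by positivity)
    simp only [one_div]
    refine this.congr_deriv ?_
    have h2 := Real.sq_sqrt (h0 y).le
    have h4 : u y = (√(u y)) ^ 2 := h2.symm
    generalize √(u y) = r at *
    rw [h4]
    field_simp
    ring

theorem J.arctan (hu : J x e e' u a d d' h) :
    J x e e' (fun y => Real.arctan (u y)) (Real.arctan a) ((1 + a ^ 2)⁻¹ * d)
      ((1 + a ^ 2)⁻¹ * d')
      ((1 + a ^ 2)⁻¹ * h + -(2 * a) / (1 + a ^ 2) ^ 2 * d * d') := by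
  have hne : ∀ t : ℝ, 1 + t ^ 2 ≠ 0 := fun t => by positivity
  refine hu.comp (g := fun t => Real.arctan t) (g' := fun t => (1 + t ^ 2)⁻¹)
    (g'' := fun t => -(2 * t) / (1 + t ^ 2) ^ 2)
    hu.sm.arctan (fun y => by simpa using Real.hasDerivAt_arctan (u y))
    ((contDiff_const.add (hu.sm.pow 2)).inv fun y => hne _) (fun y => ?_)
  have := ((hasDerivAt_pow 2 (u y)).const_add 1).inv (hne (u y))
  refine this.congr_deriv ?_
  simp

theorem J.exp (hu : J x e e' u a d d' h) :
    J x e e' (fun y => Real.exp (u y)) (Real.exp a) (Real.exp a * d) (Real.exp a * d')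
      (Real.exp a * h + Real.exp a * d * d') :=
  hu.comp (g := fun t => Real.exp t) (g' := fun t => Real.exp t) (g'' := fun t => Real.exp t)
    hu.sm.exp (fun _ => Real.hasDerivAt_exp _) hu.sm.exp (fun _ => Real.hasDerivAt_exp _)

theorem pd_eq (i : Fin 3) (u : E3 → ℝ) : pd i u = dd (EuclideanSpace.single i 1) u := rfl

end

section

/-! ### Geometric quantities in an orthonormal basis -/

open Matrix

/-- Orthonormal bases of 3-space. -/
abbrev OB : Type := OrthonormalBasis (Fin 3) ℝ E3

/-- Gradient in the basis `b`. -/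
def gv (b : OB) (u : E3 → ℝ) (x : E3) : Fin 3 → ℝ := fun i => dd (b i) u x

/-- Hessian in the basis `b`. -/
def hm (b : OB) (u : E3 → ℝ) (x : E3) : Matrix (Fin 3) (Fin 3) ℝ :=
  fun i j => dd (b i) (dd (b j) u) x

/-- The change of basis matrix. -/
def om' (b c : OB) : Matrix (Fin 3) (Fin 3) ℝ := fun i j => inner ℝ (b i) (c j)

theorem om'_mul (b c : OB) : om' b c * (om' b c)ᵀ = 1 := by
  ext i j
  simp only [Matrix.mul_apply, om', Matrix.transpose_apply]
  have := c.sum_inner_mul_inner (b i) (b j)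
  simp only [real_inner_comm (b j)] at this ⊢
  rw [this]
  rw [Matrix.one_apply, real_inner_comm]
  exact (orthonormal_iff_ite.1 b.orthonormal i j)

theorem dd_basis (b : OB) (e : E3) (u : E3 → ℝ) (x : E3) :
    dd e u x = ∑ i, inner ℝ (b i) e * dd (b i) u x := by
  conv_lhs => rw [← b.sum_repr' e]
  exact dd_sum_dir _ _ _ _ _

theorem dd_fun_sum {ι : Type*} (s : Finset ι) (c : ι → ℝ) {f : ι → E3 → ℝ} (hf : ∀ i, Sm (f i))
    (e x : E3) : dd e (fun y => ∑ i ∈ s, c i * f i y) x = ∑ i ∈ s, c i * dd e (f i) x := by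
  unfold dd
  rw [fderiv_fun_sum (fun i _ => ((hf i).diff x).const_mul _)]
  simp only [ContinuousLinearMap.sum_apply]
  refine Finset.sum_congr rfl fun i _ => ?_
  rw [fderiv_const_mul ((hf i).diff x)]; rfl

theorem dd_dd_basis (b : OB) (e e' : E3) {u : E3 → ℝ} (hu : Sm u) (x : E3) :
    dd e (dd e' u) x = ∑ i, ∑ j, inner ℝ (b i) e * inner ℝ (b j) e' * dd (b i) (dd (b j) u) x := by
  have h1 : dd e' u = fun y => ∑ i, inner ℝ (b i) e' * dd (b i) u y := by
    funext y; exact dd_basis b e' u y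
  rw [dd_basis b]
  refine Finset.sum_congr rfl fun i _ => ?_
  rw [h1, dd_fun_sum _ _ (fun j => hu.dd _), Finset.mul_sum]
  refine Finset.sum_congr rfl fun j _ => ?_
  ring

theorem gv_change (b c : OB) (u : E3 → ℝ) (x : E3) : gv c u x = (om' b c)ᵀ *ᵥ gv b u x := by
  funext j
  simp only [gv, Matrix.mulVec, dotProduct, Matrix.transpose_apply, om']
  exact dd_basis b _ u x

theorem hm_change (b c : OB) {u : E3 → ℝ} (hu : Sm u) (x : E3) :
    hm c u x = (om' b c)ᵀ * hm b u x * om' b c := by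
  ext i j
  simp only [hm, Matrix.mul_apply, Matrix.transpose_apply, om']
  rw [dd_dd_basis b _ _ hu, Finset.sum_comm]
  refine Finset.sum_congr rfl fun i _ => ?_
  rw [Finset.sum_mul]
  refine Finset.sum_congr rfl fun i _ => by ring

/-- A graphical translator with convex profile. -/
structure Tr (φ : E3 → ℝ) : Prop where
  sm : Sm φ
  conv : ConvexOn ℝ Set.univ φ
  pde : ∀ (b : OB) (x : E3), (1 + gv b φ x ⬝ᵥ gv b φ x) * ((hm b φ x).trace - 1) =
    gv b φ x ⬝ᵥ hm b φ x *ᵥ gv b φ x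

section inv
variable {O : Matrix (Fin 3) (Fin 3) ℝ}

theorem dot_inv (hO : O * Oᵀ = 1) (p q : Fin 3 → ℝ) : (Oᵀ *ᵥ p) ⬝ᵥ (Oᵀ *ᵥ q) = p ⬝ᵥ q := by
  rw [Matrix.dotProduct_mulVec, Matrix.vecMul_transpose, Matrix.mulVec_mulVec, hO,
    Matrix.one_mulVec]

theorem trace_inv (hO : O * Oᵀ = 1) (S : Matrix (Fin 3) (Fin 3) ℝ) :
    (Oᵀ * S * O).trace = S.trace := by
  rw [Matrix.trace_mul_cycle, hO, Matrix.one_mul]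

theorem mulVec_inv (hO : O * Oᵀ = 1) (S : Matrix (Fin 3) (Fin 3) ℝ) (p : Fin 3 → ℝ) :
    (Oᵀ * S * O) *ᵥ (Oᵀ *ᵥ p) = Oᵀ *ᵥ (S *ᵥ p) := by
  rw [Matrix.mulVec_mulVec, Matrix.mul_assoc _ O, hO, Matrix.mul_one, Matrix.mulVec_mulVec]

theorem mul_inv' (hO : O * Oᵀ = 1) (S T : Matrix (Fin 3) (Fin 3) ℝ) :
    (Oᵀ * S * O) * (Oᵀ * T * O) = Oᵀ * (S * T) * O := by
  calc _ = Oᵀ * S * (O * Oᵀ) * T * O := by simp only [Matrix.mul_assoc]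
    _ = _ := by rw [hO]; simp only [Matrix.mul_assoc, Matrix.one_mul]

end inv

/-- The squared mean curvature of the graph. -/
def om (b : OB) (φ : E3 → ℝ) (x : E3) : ℝ := (1 + gv b φ x ⬝ᵥ gv b φ x)⁻¹

/-- The linearised operator divided by the mean curvature. -/
def LL (b : OB) (φ u : E3 → ℝ) (x : E3) : ℝ :=
  (hm b u x).trace - om b φ x * (gv b φ x ⬝ᵥ hm b u x *ᵥ gv b φ x)
  - 2 * om b φ x * (gv b φ x ⬝ᵥ hm b φ x *ᵥ gv b u x
      - om b φ x * (gv b φ x ⬝ᵥ hm b φ x *ᵥ gv b φ x) * (gv b φ x ⬝ᵥ gv b u x))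

/-- The gradient form of the induced metric. -/
def GG (b : OB) (φ u w : E3 → ℝ) (x : E3) : ℝ :=
  gv b u x ⬝ᵥ gv b w x - om b φ x * (gv b φ x ⬝ᵥ gv b u x) * (gv b φ x ⬝ᵥ gv b w x)

/-- One minus the squared norm of the rescaled second fundamental form. -/
def vv (b : OB) (φ : E3 → ℝ) (x : E3) : ℝ :=
  1 - ((hm b φ x * hm b φ x).trace
    - 2 * om b φ x * (gv b φ x ⬝ᵥ hm b φ x *ᵥ (hm b φ x *ᵥ gv b φ x))
    + om b φ x ^ 2 * (gv b φ x ⬝ᵥ hm b φ x *ᵥ gv b φ x) ^ 2)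

/-- The defect of the gradient direction. -/
def YY (b : OB) (φ : E3 → ℝ) (x : E3) : ℝ :=
  om b φ x * (gv b φ x ⬝ᵥ gv b φ x)
    - om b φ x ^ 2 * (gv b φ x ⬝ᵥ hm b φ x *ᵥ gv b φ x)

theorem dot_indep (b c : OB) (u w : E3 → ℝ) (x : E3) :
    gv c u x ⬝ᵥ gv c w x = gv b u x ⬝ᵥ gv b w x := by
  rw [gv_change b c, gv_change b c, dot_inv (om'_mul b c)]

theorem om_indep (b c : OB) (φ : E3 → ℝ) (x : E3) : om c φ x = om b φ x := by
  rw [om, om, dot_indep b c]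

theorem LL_indep (b c : OB) {φ u : E3 → ℝ} (hφ : Sm φ) (hu : Sm u) (x : E3) :
    LL c φ u x = LL b φ u x := by
  simp only [LL, om_indep b c, gv_change b c, hm_change b c hφ, hm_change b c hu,
    dot_inv (om'_mul b c), trace_inv (om'_mul b c), mulVec_inv (om'_mul b c)]

theorem GG_indep (b c : OB) (φ u w : E3 → ℝ) (x : E3) :
    GG c φ u w x = GG b φ u w x := by
  simp only [GG, om_indep b c, gv_change b c, dot_inv (om'_mul b c)]

theorem vv_indep (b c : OB) {φ : E3 → ℝ} (hφ : Sm φ) (x : E3) :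
    vv c φ x = vv b φ x := by
  simp only [vv, om_indep b c, gv_change b c, hm_change b c hφ, mul_inv' (om'_mul b c),
    dot_inv (om'_mul b c), trace_inv (om'_mul b c), mulVec_inv (om'_mul b c)]

theorem YY_indep (b c : OB) {φ : E3 → ℝ} (hφ : Sm φ) (x : E3) :
    YY c φ x = YY b φ x := by
  simp only [YY, om_indep b c, gv_change b c, hm_change b c hφ,
    dot_inv (om'_mul b c), mulVec_inv (om'_mul b c)]

/-- Extending a unit vector to an orthonormal basis. -/
theorem exists_OB (e : E3) (he : ‖e‖ = 1) : ∃ b : OB, b 0 = e := by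
  have hv : Orthonormal ℝ (({0} : Set (Fin 3)).restrict (fun _ : Fin 3 => e)) := by
    refine ⟨fun i => he, ?_⟩
    intro i j hij
    exact absurd (Subsingleton.elim i j) hij
  obtain ⟨b, hb⟩ := hv.exists_orthonormalBasis_extension_of_card_eq (by simp)
  exact ⟨b, hb 0 rfl⟩

/-- A basis adapted to the gradient. -/
theorem exists_adapted (u : E3 → ℝ) (x : E3) :
    ∃ b : OB, gv b u x 1 = 0 ∧ gv b u x 2 = 0 := by
  set g : E3 := (InnerProductSpace.toDual ℝ E3).symm (fderiv ℝ u x) with hg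
  have hdd : ∀ e, dd e u x = inner ℝ g e := by
    intro e
    rw [hg, InnerProductSpace.toDual_symm_apply]; rfl
  by_cases h0 : g = 0
  · exact ⟨EuclideanSpace.basisFun _ _, by simp [gv, hdd, h0], by simp [gv, hdd, h0]⟩
  · have hn : ‖g‖ ≠ 0 := by simpa using h0
    obtain ⟨b, hb⟩ := exists_OB (‖g‖⁻¹ • g) (by rw [norm_smul]; simp [hn])
    have hb' : g = ‖g‖ • b 0 := by rw [hb, smul_smul, mul_inv_cancel₀ hn, one_smul]
    refine ⟨b, ?_, ?_⟩ <;>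
    · simp only [gv, hdd]
      rw [hb', inner_smul_left, b.orthonormal.2 (by decide)]; simp

theorem OB_inner (b : OB) (i j : Fin 3) : inner ℝ (b i) (b j) = if i = j then (1:ℝ) else 0 :=
  orthonormal_iff_ite.1 b.orthonormal i j

end

section

/-! ### The translator equation in an orthonormal basis -/

open Matrix

/-- The standard basis. -/
def b0 : OB := EuclideanSpace.basisFun (Fin 3) ℝ

theorem pd_b0 (i : Fin 3) (u : E3 → ℝ) : pd i u = dd (b0 i) u := by
  rw [pd_eq]; simp [b0]

theorem gradSq_eq (φ : E3 → ℝ) (x : E3) : gradSq φ x = gv b0 φ x ⬝ᵥ gv b0 φ x := by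
  simp only [gradSq, pd_b0, gv, dotProduct]
  exact Finset.sum_congr rfl fun i _ => sq _

theorem gv_sq_nonneg (b : OB) (φ : E3 → ℝ) (x : E3) : 0 ≤ gv b φ x ⬝ᵥ gv b φ x := by
  simp only [dotProduct]
  exact Finset.sum_nonneg fun i _ => mul_self_nonneg _

theorem om_pos (b : OB) (φ : E3 → ℝ) (x : E3) : 0 < om b φ x := by
  have := gv_sq_nonneg b φ x
  unfold om; positivity

/-- First and second order data of `1 + |Dφ|²`. -/
theorem J.W2 {φ : E3 → ℝ} (hφ : Sm φ) (b : OB) (x e e' : E3) :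
    J x e e' (fun y => 1 + gv b φ y ⬝ᵥ gv b φ y) (1 + gv b φ x ⬝ᵥ gv b φ x)
      (2 * ∑ i, dd (b i) φ x * dd e (dd (b i) φ) x)
      (2 * ∑ i, dd (b i) φ x * dd e' (dd (b i) φ) x)
      (2 * ∑ i, (dd (b i) φ x * dd e (dd e' (dd (b i) φ)) x
        + dd e (dd (b i) φ) x * dd e' (dd (b i) φ) x)) := by
  have h := fun i => (J.of (hφ.dd (b i)) x e e').mul (J.of (hφ.dd (b i)) x e e')
  have := (J.const x e e' 1).add (((h 0).add (h 1)).add (h 2))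
  convert this using 1
  · funext y; simp [gv, dotProduct, Fin.sum_univ_three]
  · simp [gv, dotProduct, Fin.sum_univ_three]
  · simp [Fin.sum_univ_three]; ring
  · simp [Fin.sum_univ_three]; ring
  · simp [Fin.sum_univ_three]; ring

theorem W2_pos (b : OB) (φ : E3 → ℝ) (x : E3) : 0 < 1 + gv b φ x ⬝ᵥ gv b φ x := by
  have := gv_sq_nonneg b φ x
  positivity

theorem Hmc_eq (φ : E3 → ℝ) : Hmc φ = fun y => (√(1 + gv b0 φ y ⬝ᵥ gv b0 φ y))⁻¹ := by
  funext y; rw [Hmc, gradSq_eq, one_div]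

theorem J.Hmc {φ : E3 → ℝ} (hφ : Sm φ) (x e : E3) :
    Sm (Hmc φ) ∧ dd e (Hmc φ) x = - Hmc φ x ^ 3 * ∑ i, dd (b0 i) φ x * dd e (dd (b0 i) φ) x := by
  rw [Hmc_eq]
  have h := ((J.W2 hφ b0 x e e).sqrt (W2_pos b0 φ)).inv
    (fun y => (Real.sqrt_pos.2 (W2_pos b0 φ y)).ne')
  refine ⟨h.sm, ?_⟩
  rw [h.fst]
  have := Real.sqrt_pos.2 (W2_pos b0 φ x)
  field_simp

theorem Hmc_pos (φ : E3 → ℝ) (x : E3) : 0 < Hmc φ x := by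
  rw [Hmc_eq]
  exact inv_pos.2 (Real.sqrt_pos.2 (W2_pos b0 φ x))

theorem Hmc_sq (φ : E3 → ℝ) (x : E3) : Hmc φ x ^ 2 = om b0 φ x := by
  rw [Hmc_eq, om, inv_pow, Real.sq_sqrt (W2_pos b0 φ x).le]

theorem rpow_eq (φ : E3 → ℝ) (x : E3) :
    ((1 + gradSq φ x) ^ ((3:ℝ)/2))⁻¹ = Hmc φ x ^ 3 := by
  rw [Hmc, gradSq_eq]
  have := W2_pos b0 φ x
  rw [Real.sqrt_eq_rpow, one_div, inv_pow, ← Real.rpow_natCast, ← Real.rpow_mul this.le]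
  norm_num

theorem Tr.of {φ : E3 → ℝ} (hφ : Sm φ) (hc : ConvexOn ℝ Set.univ φ) (hs : ∀ x, Θop φ x = 0) :
    Tr φ := by
  have key : ∀ x : E3, (1 + gv b0 φ x ⬝ᵥ gv b0 φ x) * ((hm b0 φ x).trace - 1) =
    gv b0 φ x ⬝ᵥ hm b0 φ x *ᵥ gv b0 φ x := by
    intro x
    have h := hs x
    have hH : ∀ i, (fun y => pd i φ y / sqrt (1 + gradSq φ y)) = fun y => dd (b0 i) φ y * Hmc φ y := by
      intro i; funext y; rw [pd_b0, Hmc, one_div, div_eq_mul_inv]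
    have hp := Hmc_pos φ x
    have hsq := Hmc_sq φ x
    have hw := W2_pos b0 φ x
    rw [om] at hsq
    simp only [Θop, divg] at h
    simp only [hH] at h
    change _ - Hmc φ x = 0 at h
    simp only [pd_b0, dd_mul (hφ.dd _) (J.Hmc hφ x 0).1, (J.Hmc hφ x _).2] at h
    simp only [Fin.sum_univ_three, dotProduct, gv, hm, mulVec, Matrix.trace, Matrix.diag] at h ⊢ hsq hw
    set H := Hmc φ x
    have h1 : H * H ^ 2 * ((1 + (dd (b0 0) φ x * dd (b0 0) φ x + dd (b0 1) φ x * dd (b0 1) φ x +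
      dd (b0 2) φ x * dd (b0 2) φ x))) = H := by
      rw [hsq]; field_simp
    refine sub_eq_zero.1 ((mul_eq_zero.1 ?_).resolve_left (pow_pos hp 3).ne')
    rw [← h]
    linear_combination (dd (b0 0) (dd (b0 0) φ) x + dd (b0 1) (dd (b0 1) φ) x +
      dd (b0 2) (dd (b0 2) φ) x - 1) * h1
  refine ⟨hφ, hc, fun b x => ?_⟩
  rw [dot_indep b0 b]
  simpa only [gv_change b0 b, hm_change b0 b hφ, dot_inv (om'_mul b0 b), trace_inv (om'_mul b0 b),
    mulVec_inv (om'_mul b0 b)] using key x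

theorem Lop_eq {φ u : E3 → ℝ} (hφ : Tr φ) (hu : Sm u) (x : E3) :
    Lop φ u x = Hmc φ x * LL b0 φ u x := by
  have hS := hφ.sm
  have hHs := (J.Hmc hS x 0).1
  have hf : ∀ i j : Fin 3, (fun y => ((if i = j then (1:ℝ) else 0) / sqrt (1 + gradSq φ y)
        - pd i φ y * pd j φ y / (1 + gradSq φ y) ^ ((3:ℝ)/2)) * pd j u y) =
      fun y => ((if i = j then (1:ℝ) else 0) * Hmc φ y +
        (-1) * ((dd (b0 i) φ y * dd (b0 j) φ y) * (Hmc φ y * (Hmc φ y * Hmc φ y)))) * dd (b0 j) u y := by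
    intro i j; funext y
    rw [pd_b0, pd_b0, pd_b0, div_eq_mul_inv _ ((1 + gradSq φ y) ^ ((3:ℝ)/2)), rpow_eq, Hmc,
      div_eq_mul_inv, one_div]
    ring
  have jt := fun i j : Fin 3 =>
    ((((J.of hHs x (b0 i) (b0 i)).smul (if i = j then (1:ℝ) else 0)).add
      ((((J.of (hS.dd (b0 i)) x (b0 i) (b0 i)).mul (J.of (hS.dd (b0 j)) x (b0 i) (b0 i))).mul
        ((J.of hHs x (b0 i) (b0 i)).mul ((J.of hHs x (b0 i) (b0 i)).mul
        (J.of hHs x (b0 i) (b0 i))))).smul (-1))).mul (J.of (hu.dd (b0 j)) x (b0 i) (b0 i))).fst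
  have hd : ∀ i j : Fin 3, pd i (fun y => ((if i = j then (1:ℝ) else 0) / sqrt (1 + gradSq φ y)
        - pd i φ y * pd j φ y / (1 + gradSq φ y) ^ ((3:ℝ)/2)) * pd j u y) x =
      (((if i = j then (1:ℝ) else 0) * Hmc φ x + (-1) * ((dd (b0 i) φ x * dd (b0 j) φ x) *
        (Hmc φ x * (Hmc φ x * Hmc φ x)))) * dd (b0 i) (dd (b0 j) u) x + dd (b0 j) u x *
        ((if i = j then (1:ℝ) else 0) * dd (b0 i) (Hmc φ) x - (dd (b0 i) φ x * dd (b0 j) φ x) *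
        (3 * Hmc φ x ^ 2 * dd (b0 i) (Hmc φ) x) -
        Hmc φ x ^ 3 * (dd (b0 i) φ x * dd (b0 i) (dd (b0 j) φ) x +
          dd (b0 j) φ x * dd (b0 i) (dd (b0 i) φ) x))) := by
    intro i j
    rw [hf, pd_b0, jt]
    ring
  have hsum : ∀ i : Fin 3, pd i (fun y => ∑ j, ((if i = j then (1:ℝ) else 0) / sqrt (1 + gradSq φ y)
        - pd i φ y * pd j φ y / (1 + gradSq φ y) ^ ((3:ℝ)/2)) * pd j u y) x =
      ∑ j, pd i (fun y => ((if i = j then (1:ℝ) else 0) / sqrt (1 + gradSq φ y)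
        - pd i φ y * pd j φ y / (1 + gradSq φ y) ^ ((3:ℝ)/2)) * pd j u y) x := by
    intro i
    have hsm : ∀ j, Sm (fun y => ((if i = j then (1:ℝ) else 0) / sqrt (1 + gradSq φ y)
        - pd i φ y * pd j φ y / (1 + gradSq φ y) ^ ((3:ℝ)/2)) * pd j u y) := by
      intro j; rw [hf]
      exact ((contDiff_const.mul hHs).add (contDiff_const.mul (((hS.dd _).mul (hS.dd _)).mul
        (hHs.mul (hHs.mul hHs))))).mul (hu.dd _)
    have := dd_fun_sum Finset.univ (fun _ => 1) hsm (b0 i) x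
    simp only [one_mul] at this
    rw [pd_b0, this]
    simp only [pd_b0]
  have hp := hφ.pde b0 x
  have hsq := Hmc_sq φ x
  have hw := W2_pos b0 φ x
  have hr := rpow_eq φ x
  simp only [Lop, divg, hsum, hd, (J.Hmc hS x _).2]
  simp only [div_eq_mul_inv (_ * _) ((1 + gradSq φ x) ^ ((3:ℝ)/2)), hr]
  have s01 := dd_comm hS (b0 0) (b0 1)
  have s02 := dd_comm hS (b0 0) (b0 2)
  have s12 := dd_comm hS (b0 1) (b0 2)
  have u01 := dd_comm hu (b0 0) (b0 1)
  have u02 := dd_comm hu (b0 0) (b0 2)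
  have u12 := dd_comm hu (b0 1) (b0 2)
  simp only [LL, ← hsq]
  have homW : Hmc φ x ^ 2 * (1 + gv b0 φ x ⬝ᵥ gv b0 φ x) = 1 := by
    rw [hsq, om, inv_mul_cancel₀ hw.ne']
  clear hd hf hsum hr hw jt
  simp only [Fin.sum_univ_three, dotProduct, gv, hm, mulVec, Matrix.trace, Matrix.diag, pd_b0] at homW hp ⊢
  simp only [s01, s02, s12, u01, u02, u12] at hp ⊢
  simp only [Fin.isValue, reduceIte, Fin.reduceEq]
  generalize Hmc φ x = H at *
  generalize dd (b0 0) φ x = p0 at *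
  generalize dd (b0 1) φ x = p1 at *
  generalize dd (b0 2) φ x = p2 at *
  generalize dd (b0 0) u x = u0 at *
  generalize dd (b0 1) u x = u1 at *
  generalize dd (b0 2) u x = u2 at *
  generalize dd (b0 0) (dd (b0 0) φ) x = S00 at *
  generalize dd (b0 1) (dd (b0 1) φ) x = S11 at *
  generalize dd (b0 2) (dd (b0 2) φ) x = S22 at *
  generalize dd (b0 1) (dd (b0 0) φ) x = S01 at *
  generalize dd (b0 2) (dd (b0 0) φ) x = S02 at *
  generalize dd (b0 2) (dd (b0 1) φ) x = S12 at *
  linear_combination (-H^5 * (p0*u0+p1*u1+p2*u2)) * hp + H^3*(S00+S11+S22-1)*(p0*u0+p1*u1+p2*u2)*homW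

end

section

/-! ### Evolution of the basic quantities -/

open Matrix

variable {φ : E3 → ℝ}

theorem Tr.pde' (hφ : Tr φ) (b : OB) (y : E3) :
    (1 + gv b φ y ⬝ᵥ gv b φ y) *
      (-1 + (dd (b 0) (dd (b 0) φ) y + dd (b 1) (dd (b 1) φ) y + dd (b 2) (dd (b 2) φ) y)) -
    (dd (b 0) φ y * (dd (b 0) φ y * dd (b 0) (dd (b 0) φ) y)
    + dd (b 1) φ y * (dd (b 1) φ y * dd (b 1) (dd (b 1) φ) y)
    + dd (b 2) φ y * (dd (b 2) φ y * dd (b 2) (dd (b 2) φ) y)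
    + 2 * (dd (b 0) φ y * (dd (b 1) φ y * dd (b 0) (dd (b 1) φ) y))
    + 2 * (dd (b 0) φ y * (dd (b 2) φ y * dd (b 0) (dd (b 2) φ) y))
    + 2 * (dd (b 1) φ y * (dd (b 2) φ y * dd (b 1) (dd (b 2) φ) y))) = 0 := by
  have h := hφ.pde b y
  simp only [Matrix.trace, Matrix.diag, hm, Fin.sum_univ_three, mulVec, dotProduct, gv] at h ⊢
  simp only [dd_comm hφ.sm (b 1) (b 0), dd_comm hφ.sm (b 2) (b 0), dd_comm hφ.sm (b 2) (b 1)] at h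
  linear_combination h

theorem Tr.pde_val (hφ : Tr φ) (b : OB) (x : E3) (h1 : dd (b 1) φ x = 0)
    (h2 : dd (b 2) φ x = 0) :
    (1 + dd (b 0) φ x ^ 2) * (dd (b 0) (dd (b 0) φ) x + dd (b 1) (dd (b 1) φ) x
      + dd (b 2) (dd (b 2) φ) x - 1) = dd (b 0) φ x ^ 2 * dd (b 0) (dd (b 0) φ) x := by
  have h := hφ.pde' b x
  simp only [h1, h2, Fin.sum_univ_three, gv, dotProduct] at h
  linear_combination h

theorem Tr.pde_jet (hφ : Tr φ) (b : OB) (x e e' : E3) (h1 : dd (b 1) φ x = 0)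
    (h2 : dd (b 2) φ x = 0) :
    (2 * dd (b 0) φ x * dd e (dd (b 0) φ) x * (dd (b 0) (dd (b 0) φ) x + dd (b 1) (dd (b 1) φ) x
      + dd (b 2) (dd (b 2) φ) x - 1) + (1 + dd (b 0) φ x ^ 2) * (dd e (dd (b 0) (dd (b 0) φ)) x
      + dd e (dd (b 1) (dd (b 1) φ)) x + dd e (dd (b 2) (dd (b 2) φ)) x) =
     2 * dd (b 0) φ x * (dd e (dd (b 0) φ) x * dd (b 0) (dd (b 0) φ) x
      + dd e (dd (b 1) φ) x * dd (b 0) (dd (b 1) φ) x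
      + dd e (dd (b 2) φ) x * dd (b 0) (dd (b 2) φ) x)
      + dd (b 0) φ x ^ 2 * dd e (dd (b 0) (dd (b 0) φ)) x) ∧
    (2 * (dd (b 0) φ x * dd e (dd e' (dd (b 0) φ)) x + dd e (dd (b 0) φ) x * dd e' (dd (b 0) φ) x
        + dd e (dd (b 1) φ) x * dd e' (dd (b 1) φ) x + dd e (dd (b 2) φ) x * dd e' (dd (b 2) φ) x)
      * (dd (b 0) (dd (b 0) φ) x + dd (b 1) (dd (b 1) φ) x + dd (b 2) (dd (b 2) φ) x - 1)
      + 2 * dd (b 0) φ x * dd e (dd (b 0) φ) x * (dd e' (dd (b 0) (dd (b 0) φ)) x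
      + dd e' (dd (b 1) (dd (b 1) φ)) x + dd e' (dd (b 2) (dd (b 2) φ)) x)
      + 2 * dd (b 0) φ x * dd e' (dd (b 0) φ) x * (dd e (dd (b 0) (dd (b 0) φ)) x
      + dd e (dd (b 1) (dd (b 1) φ)) x + dd e (dd (b 2) (dd (b 2) φ)) x)
      + (1 + dd (b 0) φ x ^ 2) * (dd e (dd e' (dd (b 0) (dd (b 0) φ))) x
        + dd e (dd e' (dd (b 1) (dd (b 1) φ))) x + dd e (dd e' (dd (b 2) (dd (b 2) φ))) x) =
      dd (b 0) φ x ^ 2 * dd e (dd e' (dd (b 0) (dd (b 0) φ))) x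
      + 2 * dd (b 0) φ x * (dd e (dd e' (dd (b 0) φ)) x * dd (b 0) (dd (b 0) φ) x
        + dd e (dd e' (dd (b 1) φ)) x * dd (b 0) (dd (b 1) φ) x
        + dd e (dd e' (dd (b 2) φ)) x * dd (b 0) (dd (b 2) φ) x)
      + 2 * (dd e (dd (b 0) φ) x * dd e' (dd (b 0) φ) x * dd (b 0) (dd (b 0) φ) x
        + dd e (dd (b 1) φ) x * dd e' (dd (b 1) φ) x * dd (b 1) (dd (b 1) φ) x
        + dd e (dd (b 2) φ) x * dd e' (dd (b 2) φ) x * dd (b 2) (dd (b 2) φ) x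
        + (dd e (dd (b 0) φ) x * dd e' (dd (b 1) φ) x + dd e (dd (b 1) φ) x * dd e' (dd (b 0) φ) x)
          * dd (b 0) (dd (b 1) φ) x
        + (dd e (dd (b 0) φ) x * dd e' (dd (b 2) φ) x + dd e (dd (b 2) φ) x * dd e' (dd (b 0) φ) x)
          * dd (b 0) (dd (b 2) φ) x
        + (dd e (dd (b 1) φ) x * dd e' (dd (b 2) φ) x + dd e (dd (b 2) φ) x * dd e' (dd (b 1) φ) x)
          * dd (b 1) (dd (b 2) φ) x)
      + 2 * dd (b 0) φ x * (dd e (dd (b 0) φ) x * dd e' (dd (b 0) (dd (b 0) φ)) x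
        + dd e (dd (b 1) φ) x * dd e' (dd (b 0) (dd (b 1) φ)) x
        + dd e (dd (b 2) φ) x * dd e' (dd (b 0) (dd (b 2) φ)) x
        + dd e' (dd (b 0) φ) x * dd e (dd (b 0) (dd (b 0) φ)) x
        + dd e' (dd (b 1) φ) x * dd e (dd (b 0) (dd (b 1) φ)) x
        + dd e' (dd (b 2) φ) x * dd e (dd (b 0) (dd (b 2) φ)) x)) := by
  have jp := fun i => J.of (hφ.sm.dd (b i)) x e e'
  have jS := fun i j => J.of ((hφ.sm.dd (b j)).dd (b i)) x e e'
  have j := ((J.W2 hφ.sm b x e e').mul ((J.const x e e' (-1)).add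
      (((jS 0 0).add (jS 1 1)).add (jS 2 2)))).sub
      ((((((jp 0).mul ((jp 0).mul (jS 0 0))).add ((jp 1).mul ((jp 1).mul (jS 1 1)))).add
        ((jp 2).mul ((jp 2).mul (jS 2 2)))).add (((jp 0).mul ((jp 1).mul (jS 0 1))).smul 2)).add
        (((jp 0).mul ((jp 2).mul (jS 0 2))).smul 2) |>.add (((jp 1).mul ((jp 2).mul (jS 1 2))).smul 2))
  rw [funext (hφ.pde' b)] at j
  simp only [h1, h2, Fin.sum_univ_three, gv, dotProduct] at j
  have j1 := j.fst
  have j2 := j.hes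
  simp only [dd_const] at j1 j2
  constructor
  · linear_combination -j1
  · linear_combination -j2

theorem LL_adapted {b : OB} {x : E3} (h1 : dd (b 1) φ x = 0)
    (h2 : dd (b 2) φ x = 0) (u : E3 → ℝ) :
    LL b φ u x = (1 + dd (b 0) φ x ^ 2)⁻¹ * dd (b 0) (dd (b 0) u) x + dd (b 1) (dd (b 1) u) x
      + dd (b 2) (dd (b 2) u) x - 2 * (1 + dd (b 0) φ x ^ 2)⁻¹ * dd (b 0) φ x *
      ((1 + dd (b 0) φ x ^ 2)⁻¹ * dd (b 0) (dd (b 0) φ) x * dd (b 0) u x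
        + dd (b 0) (dd (b 1) φ) x * dd (b 1) u x + dd (b 0) (dd (b 2) φ) x * dd (b 2) u x) := by
  have hpos : (0:ℝ) < 1 + dd (b 0) φ x ^ 2 := by positivity
  simp only [LL, om, Matrix.trace, Matrix.diag, hm, Fin.sum_univ_three, mulVec, dotProduct, gv,
    h1, h2]
  simp only [zero_mul, add_zero, ← sq]
  field_simp
  ring

theorem GG_adapted {b : OB} {x : E3} (h1 : dd (b 1) φ x = 0)
    (h2 : dd (b 2) φ x = 0) (u w : E3 → ℝ) :
    GG b φ u w x = (1 + dd (b 0) φ x ^ 2)⁻¹ * (dd (b 0) u x * dd (b 0) w x)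
      + dd (b 1) u x * dd (b 1) w x + dd (b 2) u x * dd (b 2) w x := by
  have hpos : (0:ℝ) < 1 + dd (b 0) φ x ^ 2 := by positivity
  simp only [GG, om, Fin.sum_univ_three, dotProduct, gv, h1, h2]
  simp only [zero_mul, add_zero, ← sq]
  field_simp
  ring

theorem dd3 {u : E3 → ℝ} (hu : Sm u) (a c : E3) :
    dd a (dd a (dd c u)) = dd c (dd a (dd a u)) := by
  rw [dd_comm hu a c, dd_comm (hu.dd a) a c]

theorem LL_dd (hφ : Tr φ) (b : OB) (c x : E3) : LL b φ (dd c φ) x = 0 := by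
  obtain ⟨b', h1, h2⟩ := exists_adapted φ x
  rw [LL_indep b' b hφ.sm (hφ.sm.dd c), LL_adapted h1 h2]
  have h := (hφ.pde_jet b' x c c h1 h2).1
  have hv := hφ.pde_val b' x h1 h2
  simp only [dd3 hφ.sm _ c]
  simp only [dd_comm hφ.sm _ c]
  have hpos : (0:ℝ) < 1 + dd (b' 0) φ x ^ 2 := by positivity
  field_simp
  linear_combination (1 + dd (b' 0) φ x ^ 2) * h - 2 * dd (b' 0) φ x * dd c (dd (b' 0) φ) x * hv

/-- Explicit form of `vv`. -/
theorem vv_fun (hφ : Tr φ) (b : OB) : vv b φ = fun y =>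
    1 - ((dd (b 0) (dd (b 0) φ) y * dd (b 0) (dd (b 0) φ) y
      + dd (b 1) (dd (b 1) φ) y * dd (b 1) (dd (b 1) φ) y
      + dd (b 2) (dd (b 2) φ) y * dd (b 2) (dd (b 2) φ) y
      + 2 * (dd (b 0) (dd (b 1) φ) y * dd (b 0) (dd (b 1) φ) y
      + dd (b 0) (dd (b 2) φ) y * dd (b 0) (dd (b 2) φ) y
      + dd (b 1) (dd (b 2) φ) y * dd (b 1) (dd (b 2) φ) y))
    - 2 * (om b φ y * (
        (dd (b 0) (dd (b 0) φ) y * dd (b 0) φ y + dd (b 0) (dd (b 1) φ) y * dd (b 1) φ y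
          + dd (b 0) (dd (b 2) φ) y * dd (b 2) φ y)
        * (dd (b 0) (dd (b 0) φ) y * dd (b 0) φ y + dd (b 0) (dd (b 1) φ) y * dd (b 1) φ y
          + dd (b 0) (dd (b 2) φ) y * dd (b 2) φ y)
        + (dd (b 0) (dd (b 1) φ) y * dd (b 0) φ y + dd (b 1) (dd (b 1) φ) y * dd (b 1) φ y
          + dd (b 1) (dd (b 2) φ) y * dd (b 2) φ y)
        * (dd (b 0) (dd (b 1) φ) y * dd (b 0) φ y + dd (b 1) (dd (b 1) φ) y * dd (b 1) φ y
          + dd (b 1) (dd (b 2) φ) y * dd (b 2) φ y)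
        + (dd (b 0) (dd (b 2) φ) y * dd (b 0) φ y + dd (b 1) (dd (b 2) φ) y * dd (b 1) φ y
          + dd (b 2) (dd (b 2) φ) y * dd (b 2) φ y)
        * (dd (b 0) (dd (b 2) φ) y * dd (b 0) φ y + dd (b 1) (dd (b 2) φ) y * dd (b 1) φ y
          + dd (b 2) (dd (b 2) φ) y * dd (b 2) φ y)))
    + om b φ y * (dd (b 0) φ y *
        (dd (b 0) (dd (b 0) φ) y * dd (b 0) φ y + dd (b 0) (dd (b 1) φ) y * dd (b 1) φ y
          + dd (b 0) (dd (b 2) φ) y * dd (b 2) φ y)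
        + dd (b 1) φ y *
        (dd (b 0) (dd (b 1) φ) y * dd (b 0) φ y + dd (b 1) (dd (b 1) φ) y * dd (b 1) φ y
          + dd (b 1) (dd (b 2) φ) y * dd (b 2) φ y)
        + dd (b 2) φ y *
        (dd (b 0) (dd (b 2) φ) y * dd (b 0) φ y + dd (b 1) (dd (b 2) φ) y * dd (b 1) φ y
          + dd (b 2) (dd (b 2) φ) y * dd (b 2) φ y))
      * (om b φ y * (dd (b 0) φ y *
        (dd (b 0) (dd (b 0) φ) y * dd (b 0) φ y + dd (b 0) (dd (b 1) φ) y * dd (b 1) φ y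
          + dd (b 0) (dd (b 2) φ) y * dd (b 2) φ y)
        + dd (b 1) φ y *
        (dd (b 0) (dd (b 1) φ) y * dd (b 0) φ y + dd (b 1) (dd (b 1) φ) y * dd (b 1) φ y
          + dd (b 1) (dd (b 2) φ) y * dd (b 2) φ y)
        + dd (b 2) φ y *
        (dd (b 0) (dd (b 2) φ) y * dd (b 0) φ y + dd (b 1) (dd (b 2) φ) y * dd (b 1) φ y
          + dd (b 2) (dd (b 2) φ) y * dd (b 2) φ y)))) := by
  funext y
  simp only [vv, Matrix.trace, Matrix.diag, hm, Fin.sum_univ_three, mulVec, dotProduct, gv,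
    Matrix.mul_apply, dd_comm hφ.sm (b 1) (b 0), dd_comm hφ.sm (b 2) (b 0),
    dd_comm hφ.sm (b 2) (b 1)]
  ring

theorem sort2 (hφ : Sm φ) (b : OB) :
    dd (b 1) (dd (b 0) φ) = dd (b 0) (dd (b 1) φ) ∧ dd (b 2) (dd (b 0) φ) = dd (b 0) (dd (b 2) φ) ∧
    dd (b 2) (dd (b 1) φ) = dd (b 1) (dd (b 2) φ) :=
  ⟨dd_comm hφ _ _, dd_comm hφ _ _, dd_comm hφ _ _⟩

/-- The weights of the inverse metric in an adapted basis. -/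
def wt (b : OB) (φ : E3 → ℝ) (x : E3) (i : Fin 3) : ℝ :=
  if i = 0 then (1 + dd (b 0) φ x ^ 2)⁻¹ else 1

/-- The corrected third derivatives in an adapted basis. -/
def CC (b : OB) (φ : E3 → ℝ) (x : E3) (k i j : Fin 3) : ℝ :=
  dd (b k) (dd (b i) (dd (b j) φ)) x - (1 + dd (b 0) φ x ^ 2)⁻¹ * dd (b 0) φ x *
    (dd (b 0) (dd (b j) φ) x * dd (b k) (dd (b i) φ) x
      + dd (b 0) (dd (b i) φ) x * dd (b k) (dd (b j) φ) x)

/-- The squared norm of the covariant derivative of the rescaled second fundamental form. -/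
def nb2 (b : OB) (φ : E3 → ℝ) (x : E3) : ℝ :=
  ∑ k, ∑ i, ∑ j, wt b φ x k * wt b φ x i * wt b φ x j * CC b φ x k i j ^ 2

theorem sm_om (hφ : Sm φ) (b : OB) : Sm (om b φ) :=
  ((J.W2 hφ b 0 0 0).inv (fun y => (W2_pos b φ y).ne')).sm

theorem J_om (hφ : Sm φ) (b : OB) (x e : E3) (h1 : dd (b 1) φ x = 0)
    (h2 : dd (b 2) φ x = 0) :
    J x e e (om b φ) (1 + dd (b 0) φ x ^ 2)⁻¹
      (-2 * ((1 + dd (b 0) φ x ^ 2)⁻¹) ^ 2 * dd (b 0) φ x * dd e (dd (b 0) φ) x)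
      (-2 * ((1 + dd (b 0) φ x ^ 2)⁻¹) ^ 2 * dd (b 0) φ x * dd e (dd (b 0) φ) x)
      (-2 * ((1 + dd (b 0) φ x ^ 2)⁻¹) ^ 2 * (dd (b 0) φ x * dd e (dd e (dd (b 0) φ)) x
        + dd e (dd (b 0) φ) x ^ 2 + dd e (dd (b 1) φ) x ^ 2 + dd e (dd (b 2) φ) x ^ 2)
        + 8 * ((1 + dd (b 0) φ x ^ 2)⁻¹) ^ 3 * dd (b 0) φ x ^ 2 * dd e (dd (b 0) φ) x ^ 2) := by
  have hpos : (0:ℝ) < 1 + dd (b 0) φ x ^ 2 := by positivity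
  have j := (J.W2 hφ b x e e).inv (fun y => (W2_pos b φ y).ne')
  have hf : om b φ = fun y => (1 + gv b φ y ⬝ᵥ gv b φ y)⁻¹ := rfl
  rw [hf]
  convert j using 1
  all_goals simp only [dotProduct, Fin.sum_univ_three, gv, h1, h2, zero_mul, add_zero, ← sq]
  all_goals try field_simp
  all_goals try ring

set_option maxHeartbeats 4000000 in
theorem LL_vv (hφ : Tr φ) (b : OB) (x : E3) (h1 : dd (b 1) φ x = 0)
    (h2 : dd (b 2) φ x = 0) : LL b φ (vv b φ) x = - 2 * nb2 b φ x := by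
  have j0 := fun k i => J.of (hφ.sm.dd (b i)) x (b k) (b k)
  have jS := fun k i j => J.of ((hφ.sm.dd (b j)).dd (b i)) x (b k) (b k)
  have jo := fun k => J_om hφ.sm b x (b k) h1 h2
  have q0 := fun k => (((jS k 0 0).mul (j0 k 0)).add ((jS k 0 1).mul (j0 k 1))).add
    ((jS k 0 2).mul (j0 k 2))
  have q1 := fun k => (((jS k 0 1).mul (j0 k 0)).add ((jS k 1 1).mul (j0 k 1))).add
    ((jS k 1 2).mul (j0 k 2))
  have q2 := fun k => (((jS k 0 2).mul (j0 k 0)).add ((jS k 1 2).mul (j0 k 1))).add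
    ((jS k 2 2).mul (j0 k 2))
  simp only [h1, h2, zero_mul, mul_zero, add_zero] at q0 q1 q2 j0
  have R := fun k => (J.const x (b k) (b k) 1).sub
    ((((((jS k 0 0).mul (jS k 0 0)).add ((jS k 1 1).mul (jS k 1 1))).add
      ((jS k 2 2).mul (jS k 2 2))).add
    (((((jS k 0 1).mul (jS k 0 1)).add ((jS k 0 2).mul (jS k 0 2))).add
      ((jS k 1 2).mul (jS k 1 2))).smul 2)).sub
      (((jo k).mul ((((q0 k).mul (q0 k)).add ((q1 k).mul (q1 k))).add ((q2 k).mul (q2 k)))).smul 2)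
    |>.add (((jo k).mul ((((j0 k 0).mul (q0 k)).add ((j0 k 1).mul (q1 k))).add
      ((j0 k 2).mul (q2 k)))).mul ((jo k).mul ((((j0 k 0).mul (q0 k)).add
        ((j0 k 1).mul (q1 k))).add ((j0 k 2).mul (q2 k))))))
  simp only [← vv_fun hφ b] at R
  rw [LL_adapted h1 h2, (R 0).hes, (R 1).hes, (R 2).hes, (R 0).fst, (R 1).fst, (R 2).fst]
  clear R q0 q1 q2 j0 jS jo
  have hv := hφ.pde_val b x h1 h2
  have d0 := (hφ.pde_jet b x (b 0) (b 0) h1 h2).1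
  have d1 := (hφ.pde_jet b x (b 1) (b 0) h1 h2).1
  have d2 := (hφ.pde_jet b x (b 2) (b 0) h1 h2).1
  have d00 := (hφ.pde_jet b x (b 0) (b 0) h1 h2).2
  have d01 := (hφ.pde_jet b x (b 0) (b 1) h1 h2).2
  have d02 := (hφ.pde_jet b x (b 0) (b 2) h1 h2).2
  have d11 := (hφ.pde_jet b x (b 1) (b 1) h1 h2).2
  have d12 := (hφ.pde_jet b x (b 1) (b 2) h1 h2).2
  have d22 := (hφ.pde_jet b x (b 2) (b 2) h1 h2).2
  have c1 := fun k => dd_comm (hφ.sm.dd (b k)) (b 1) (b 0)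
  have c2 := fun k => dd_comm (hφ.sm.dd (b k)) (b 2) (b 0)
  have c3 := fun k => dd_comm (hφ.sm.dd (b k)) (b 2) (b 1)
  have e1 := fun k l => dd_comm ((hφ.sm.dd (b k)).dd (b l)) (b 1) (b 0)
  have e2 := fun k l => dd_comm ((hφ.sm.dd (b k)).dd (b l)) (b 2) (b 0)
  have e3 := fun k l => dd_comm ((hφ.sm.dd (b k)).dd (b l)) (b 2) (b 1)
  simp only [nb2, wt, CC, Fin.sum_univ_three, Fin.isValue, reduceIte, Fin.reduceEq]
  simp only [(sort2 hφ.sm b).1, (sort2 hφ.sm b).2.1, (sort2 hφ.sm b).2.2, c1, c2, c3, e1, e2, e3]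
    at d0 d1 d2 d00 d01 d02 d11 d12 d22 ⊢
  simp only [h1, h2, zero_mul, mul_zero, add_zero, zero_add]
  clear c1 c2 c3 e1 e2 e3 h1 h2
  generalize dd (b 0) φ x = P at *
  generalize dd (b 0) (dd (b 0) (dd (b 0) (dd (b 0) φ))) x = u0000 at *
  generalize dd (b 0) (dd (b 0) (dd (b 0) (dd (b 1) φ))) x = u0001 at *
  generalize dd (b 0) (dd (b 0) (dd (b 0) (dd (b 2) φ))) x = u0002 at *
  generalize dd (b 0) (dd (b 0) (dd (b 1) (dd (b 1) φ))) x = u0011 at *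
  generalize dd (b 0) (dd (b 0) (dd (b 1) (dd (b 2) φ))) x = u0012 at *
  generalize dd (b 0) (dd (b 0) (dd (b 2) (dd (b 2) φ))) x = u0022 at *
  generalize dd (b 0) (dd (b 1) (dd (b 1) (dd (b 1) φ))) x = u0111 at *
  generalize dd (b 0) (dd (b 1) (dd (b 1) (dd (b 2) φ))) x = u0112 at *
  generalize dd (b 0) (dd (b 1) (dd (b 2) (dd (b 2) φ))) x = u0122 at *
  generalize dd (b 0) (dd (b 2) (dd (b 2) (dd (b 2) φ))) x = u0222 at *
  generalize dd (b 1) (dd (b 1) (dd (b 1) (dd (b 1) φ))) x = u1111 at *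
  generalize dd (b 1) (dd (b 1) (dd (b 1) (dd (b 2) φ))) x = u1112 at *
  generalize dd (b 1) (dd (b 1) (dd (b 2) (dd (b 2) φ))) x = u1122 at *
  generalize dd (b 1) (dd (b 2) (dd (b 2) (dd (b 2) φ))) x = u1222 at *
  generalize dd (b 2) (dd (b 2) (dd (b 2) (dd (b 2) φ))) x = u2222 at *
  generalize dd (b 0) (dd (b 0) (dd (b 0) φ)) x = t000 at *
  generalize dd (b 0) (dd (b 0) (dd (b 1) φ)) x = t001 at *
  generalize dd (b 0) (dd (b 0) (dd (b 2) φ)) x = t002 at *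
  generalize dd (b 0) (dd (b 1) (dd (b 1) φ)) x = t011 at *
  generalize dd (b 0) (dd (b 1) (dd (b 2) φ)) x = t012 at *
  generalize dd (b 0) (dd (b 2) (dd (b 2) φ)) x = t022 at *
  generalize dd (b 1) (dd (b 1) (dd (b 1) φ)) x = t111 at *
  generalize dd (b 1) (dd (b 1) (dd (b 2) φ)) x = t112 at *
  generalize dd (b 1) (dd (b 2) (dd (b 2) φ)) x = t122 at *
  generalize dd (b 2) (dd (b 2) (dd (b 2) φ)) x = t222 at *
  generalize dd (b 0) (dd (b 0) φ) x = s00 at *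
  generalize dd (b 0) (dd (b 1) φ) x = s01 at *
  generalize dd (b 0) (dd (b 2) φ) x = s02 at *
  generalize dd (b 1) (dd (b 1) φ) x = s11 at *
  generalize dd (b 1) (dd (b 2) φ) x = s12 at *
  generalize dd (b 2) (dd (b 2) φ) x = s22 at *
  clear hφ
  have hw : (1 + P ^ 2)⁻¹ * (1 + P ^ 2) = 1 := inv_mul_cancel₀ (by positivity)
  generalize (1 + P ^ 2)⁻¹ = w at *
  have s22e : s22 = 1 - s11 - w * s00 := by
    linear_combination w * hv + (-s11 - s22 - s00 + 1 + s00) * hw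
  have t0 : t022 = - w * t000 - t011 + 2 * P * w * (s00 * s00 + s01 * s01 + s02 * s02)
      - 2 * P ^ 3 * w ^ 2 * s00 * s00 := by
    linear_combination w * d0 + (-(t011 + t022) + 2 * P * w * s00 * s00) * hw
      - 2 * P * w * s00 * s22e
  have t1 : t122 = - w * t001 - t111 + 2 * P * w * (s01 * s00 + s11 * s01 + s12 * s02)
      - 2 * P ^ 3 * w ^ 2 * s01 * s00 := by
    linear_combination w * d1 + (-(t111 + t122) + 2 * P * w * s00 * s01) * hw
      - 2 * P * w * s01 * s22e
  have t2 : t222 = - w * t002 - t112 + 2 * P * w * (s02 * s00 + s12 * s01 + s22 * s02)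
      - 2 * P ^ 3 * w ^ 2 * s02 * s00 := by
    linear_combination w * d2 + (-(t112 + t222) + 2 * P * w * s00 * s02) * hw
      - 2 * P * w * s02 * s22e
  clear d0 d1 d2 hv
  subst t0 t1 t2 s22e
  linear_combination -2 * w ^ 3 * s00 * d00 - 4 * w ^ 2 * s01 * d01 - 4 * w ^ 2 * s02 * d02
    - 2 * w * s11 * d11 - 4 * w * s12 * d12 - 2 * w * (1 - s11 - w * s00) * d22 + (
      -20 * P * s00 * s01 * t001 * w - 52 * P * s00 * s01 * t001 * w ^ 2 - 20 * P * s00 * s02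
      * t002 * w - 44 * P * s00 * s02 * t002 * w ^ 2 - 8 * P * s00 * s11 * t000 * w ^ 2 - 16 *
      P * s00 * s11 * t011 * w - 16 * P * s00 * s12 * t012 * w + 8 * P * s00 * t000 * w ^ 2 +
      8 * P * s00 * t011 * w - 36 * P * s00 ^ 2 * t000 * w ^ 2 - 28 * P * s00 ^ 2 * t000 * w ^
      3 - 16 * P * s00 ^ 2 * t011 * w - 8 * P * s00 ^ 2 * t011 * w ^ 2 - 48 * P * s01 * s02 *
      t012 * w - 8 * P * s01 * s11 * t001 * w - 8 * P * s01 * s12 * t002 * w - 24 * P * s01 ^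
      2 * t000 * w ^ 2 - 40 * P * s01 ^ 2 * t011 * w + 8 * P * s02 * s11 * t002 * w - 8 * P *
      s02 * s12 * t001 * w - 8 * P * s02 * t002 * w + 8 * P * s02 ^ 2 * t011 * w + 16 * P ^ 2
      * s00 * s01 * s02 * s12 * w ^ 2 + 24 * P ^ 2 * s00 * s01 ^ 2 * s11 * w ^ 2 - 16 * P ^ 2
      * s00 * s01 ^ 2 * w ^ 2 + 8 * P ^ 2 * s00 * s02 ^ 2 * s11 * w ^ 2 - 8 * P ^ 2 * s00 *
      s02 ^ 2 * w ^ 2 - 2 * P ^ 2 * s00 * u0000 * w ^ 2 - 2 * P ^ 2 * s00 * u0011 * w - 2 * P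
      ^ 2 * s00 * u0022 * w + 44 * P ^ 2 * s00 ^ 2 * s01 ^ 2 * w ^ 2 + 60 * P ^ 2 * s00 ^ 2 *
      s01 ^ 2 * w ^ 3 - 4 * P ^ 2 * s00 ^ 2 * s02 ^ 2 * w ^ 2 + 52 * P ^ 2 * s00 ^ 2 * s02 ^ 2
      * w ^ 3 - 8 * P ^ 2 * s00 ^ 2 * s11 * w ^ 2 + 8 * P ^ 2 * s00 ^ 2 * s11 ^ 2 * w ^ 2 + 8
      * P ^ 2 * s00 ^ 2 * s12 ^ 2 * w ^ 2 + 4 * P ^ 2 * s00 ^ 2 * w ^ 2 + 16 * P ^ 2 * s00 ^ 3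
      * s11 * w ^ 2 + 8 * P ^ 2 * s00 ^ 3 * s11 * w ^ 3 - 16 * P ^ 2 * s00 ^ 3 * w ^ 2 - 8 * P
      ^ 2 * s00 ^ 3 * w ^ 3 + 8 * P ^ 2 * s00 ^ 4 * w ^ 2 + 44 * P ^ 2 * s00 ^ 4 * w ^ 3 + 12
      * P ^ 2 * s00 ^ 4 * w ^ 4 + 16 * P ^ 2 * s01 ^ 2 * s02 ^ 2 * w ^ 2 + 32 * P ^ 2 * s01 ^
      4 * w ^ 2 - 16 * P ^ 2 * s02 ^ 4 * w ^ 2 - 2 * P ^ 2 * t000 ^ 2 * w ^ 2 - 2 * P ^ 2 *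
      t001 ^ 2 * w - 2 * P ^ 2 * t002 ^ 2 * w + 20 * P ^ 3 * s00 * s01 * t001 * w ^ 2 + 20 * P
      ^ 3 * s00 * s02 * t002 * w ^ 2 + 36 * P ^ 3 * s00 ^ 2 * t000 * w ^ 3 + 16 * P ^ 3 * s00
      ^ 2 * t011 * w ^ 2 - 40 * P ^ 4 * s00 ^ 2 * s01 ^ 2 * w ^ 3 + 8 * P ^ 4 * s00 ^ 2 * s02
      ^ 2 * w ^ 3 - 16 * P ^ 4 * s00 ^ 3 * s11 * w ^ 3 + 16 * P ^ 4 * s00 ^ 3 * w ^ 3 - 16 * P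
      ^ 4 * s00 ^ 4 * w ^ 3 - 40 * P ^ 4 * s00 ^ 4 * w ^ 4 + 8 * P ^ 6 * s00 ^ 4 * w ^ 4 - 16
      * s00 * s01 * s02 * s12 * w - 16 * s00 * s01 * s02 * s12 * w ^ 2 - 8 * s00 * s01 ^ 2 *
      s11 * w - 12 * s00 * s01 ^ 2 * s11 * w ^ 2 + 8 * s00 * s02 ^ 2 * s11 * w + 4 * s00 * s02
      ^ 2 * s11 * w ^ 2 - 8 * s00 * s02 ^ 2 * w - 4 * s00 * s02 ^ 2 * w ^ 2 + 12 * s00 * s11 *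
      w - 12 * s00 * s11 ^ 2 * w - 12 * s00 * s12 ^ 2 * w + 2 * s00 * u0000 * w + 2 * s00 *
      u0000 * w ^ 2 + 2 * s00 * u0011 + 2 * s00 * u0011 * w + 2 * s00 * u0011 * w ^ 2 + 2 *
      s00 * u0022 + 2 * s00 * u0022 * w + 2 * s00 * u0022 * w ^ 2 - 2 * s00 * u1122 * w - 2 *
      s00 * u2222 * w - 4 * s00 * w - 4 * s00 ^ 2 * s01 ^ 2 * w - 16 * s00 ^ 2 * s01 ^ 2 * w ^
      2 - 4 * s00 ^ 2 * s01 ^ 2 * w ^ 3 - 4 * s00 ^ 2 * s02 ^ 2 * w - 8 * s00 ^ 2 * s02 ^ 2 *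
      w ^ 2 + 4 * s00 ^ 2 * s02 ^ 2 * w ^ 3 - 24 * s00 ^ 2 * s11 * w ^ 2 + 12 * s00 ^ 2 * s11
      ^ 2 * w ^ 2 + 12 * s00 ^ 2 * s12 ^ 2 * w ^ 2 + 12 * s00 ^ 2 * w ^ 2 + 12 * s00 ^ 3 * s11
      * w ^ 3 - 12 * s00 ^ 3 * w ^ 3 - 4 * s00 ^ 4 * w ^ 2 - 4 * s00 ^ 4 * w ^ 3 + 4 * s00 ^ 4
      * w ^ 4 - 8 * s01 * s02 * s12 * w + 4 * s01 * u0001 * w + 4 * s01 * u0111 + 4 * s01 *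
      u0111 * w + 4 * s01 * u0122 + 4 * s01 * u0122 * w - 8 * s01 ^ 2 * s02 ^ 2 * w - 4 * s01
      ^ 2 * s11 ^ 2 * w - 4 * s01 ^ 2 * s12 ^ 2 * w - 4 * s01 ^ 4 * w + 4 * s02 * u0002 * w +
      4 * s02 * u0112 + 4 * s02 * u0112 * w + 4 * s02 * u0222 + 4 * s02 * u0222 * w + 8 * s02
      ^ 2 * s11 * w - 4 * s02 ^ 2 * s11 ^ 2 * w - 4 * s02 ^ 2 * s12 ^ 2 * w - 4 * s02 ^ 2 * w
      - 4 * s02 ^ 4 * w + 2 * s11 * u1111 - 2 * s11 * u2222 + 4 * s12 * u1112 + 4 * s12 *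
      u1222 + 8 * t000 * t011 * w + 2 * t000 ^ 2 * w + 6 * t000 ^ 2 * w ^ 2 + 2 * t001 ^ 2 + 6
      * t001 ^ 2 * w + 2 * t002 ^ 2 + 6 * t002 ^ 2 * w + 8 * t011 ^ 2 + 8 * t012 ^ 2 + 2 *
      u1122 + 2 * u2222) * hw

theorem YY_fun (hφ : Tr φ) (b : OB) : YY b φ = fun y =>
    om b φ y * (dd (b 0) φ y * dd (b 0) φ y + dd (b 1) φ y * dd (b 1) φ y
      + dd (b 2) φ y * dd (b 2) φ y) -
    om b φ y * om b φ y * (dd (b 0) φ y *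
        (dd (b 0) (dd (b 0) φ) y * dd (b 0) φ y + dd (b 0) (dd (b 1) φ) y * dd (b 1) φ y
          + dd (b 0) (dd (b 2) φ) y * dd (b 2) φ y)
        + dd (b 1) φ y *
        (dd (b 0) (dd (b 1) φ) y * dd (b 0) φ y + dd (b 1) (dd (b 1) φ) y * dd (b 1) φ y
          + dd (b 1) (dd (b 2) φ) y * dd (b 2) φ y)
        + dd (b 2) φ y *
        (dd (b 0) (dd (b 2) φ) y * dd (b 0) φ y + dd (b 1) (dd (b 2) φ) y * dd (b 1) φ y
          + dd (b 2) (dd (b 2) φ) y * dd (b 2) φ y)) := by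
  funext y
  simp only [YY, hm, Fin.sum_univ_three, mulVec, dotProduct, gv,
    dd_comm hφ.sm (b 1) (b 0), dd_comm hφ.sm (b 2) (b 0), dd_comm hφ.sm (b 2) (b 1)]
  ring

set_option maxHeartbeats 4000000 in
theorem LL_YY (hφ : Tr φ) (b : OB) (x : E3) (h1 : dd (b 1) φ x = 0)
    (h2 : dd (b 2) φ x = 0) {P w s00 s01 s02 s11 s12 s22 : ℝ} (hP : dd (b 0) φ x = P)
    (hw' : (1 + P ^ 2)⁻¹ = w)
    (h00 : dd (b 0) (dd (b 0) φ) x = s00) (h01 : dd (b 0) (dd (b 1) φ) x = s01)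
    (h02 : dd (b 0) (dd (b 2) φ) x = s02) (h11 : dd (b 1) (dd (b 1) φ) x = s11)
    (h12 : dd (b 1) (dd (b 2) φ) x = s12) (h22 : dd (b 2) (dd (b 2) φ) x = s22) :
    LL b φ (YY b φ) x = -6 * w * (w ^ 2 * P ^ 2 * (w * s00 ^ 2 + s01 ^ 2 + s02 ^ 2
      - (w ^ 2 * s00 ^ 3 + 2 * w * s00 * s01 ^ 2 + 2 * w * s00 * s02 ^ 2 + s11 * s01 ^ 2
        + 2 * s12 * s01 * s02 + s22 * s02 ^ 2)))
      + 2 * w ^ 2 * (w ^ 2 * s00 ^ 2 + s11 ^ 2 + s22 ^ 2 + 2 * w * s01 ^ 2 + 2 * w * s02 ^ 2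
        + 2 * s12 ^ 2 - (w ^ 3 * s00 ^ 3 + s11 ^ 3 + s22 ^ 3 + 3 * w ^ 2 * s00 * s01 ^ 2
        + 3 * w ^ 2 * s00 * s02 ^ 2 + 3 * w * s11 * s01 ^ 2 + 3 * w * s22 * s02 ^ 2
        + 3 * s11 * s12 ^ 2 + 3 * s22 * s12 ^ 2 + 6 * w * s01 * s02 * s12))
      - 4 * w * (w * P * (w ^ 2 * CC b φ x 0 0 0 * s00 + w * CC b φ x 0 1 0 * s01
        + w * CC b φ x 0 2 0 * s02 + w * CC b φ x 1 0 0 * s01 + CC b φ x 1 1 0 * s11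
        + CC b φ x 1 2 0 * s12 + w * CC b φ x 2 0 0 * s02 + CC b φ x 2 1 0 * s12
        + CC b φ x 2 2 0 * s22)) := by
  subst hP hw' h00 h01 h02 h11 h12 h22
  have j0 := fun k => J.of (hφ.sm.dd (b 0)) x (b k) (b k)
  have j1 := fun k => J.of (hφ.sm.dd (b 1)) x (b k) (b k)
  have j2 := fun k => J.of (hφ.sm.dd (b 2)) x (b k) (b k)
  have jS := fun k i j => J.of ((hφ.sm.dd (b j)).dd (b i)) x (b k) (b k)
  have jo := fun k => J_om hφ.sm b x (b k) h1 h2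
  have q0 := fun k => (((jS k 0 0).mul (j0 k)).add ((jS k 0 1).mul (j1 k))).add
    ((jS k 0 2).mul (j2 k))
  have q1 := fun k => (((jS k 0 1).mul (j0 k)).add ((jS k 1 1).mul (j1 k))).add
    ((jS k 1 2).mul (j2 k))
  have q2 := fun k => (((jS k 0 2).mul (j0 k)).add ((jS k 1 2).mul (j1 k))).add
    ((jS k 2 2).mul (j2 k))
  simp only [h1, h2, zero_mul, mul_zero, add_zero] at q0 q1 q2 j0 j1 j2
  have R := fun k => ((jo k).mul ((((j0 k).mul (j0 k)).add ((j1 k).mul (j1 k))).add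
    ((j2 k).mul (j2 k)))).sub (((jo k).mul (jo k)).mul ((((j0 k).mul (q0 k)).add
        ((j1 k).mul (q1 k))).add ((j2 k).mul (q2 k))))
  simp only [← YY_fun hφ b] at R
  rw [LL_adapted h1 h2, (R 0).hes, (R 1).hes, (R 2).hes, (R 0).fst, (R 1).fst, (R 2).fst]
  clear R q0 q1 q2 j0 j1 j2 jS jo
  have hv := hφ.pde_val b x h1 h2
  have d0 := (hφ.pde_jet b x (b 0) (b 0) h1 h2).1
  have d1 := (hφ.pde_jet b x (b 1) (b 0) h1 h2).1
  have d2 := (hφ.pde_jet b x (b 2) (b 0) h1 h2).1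
  have d00 := (hφ.pde_jet b x (b 0) (b 0) h1 h2).2
  have c1 := fun k => dd_comm (hφ.sm.dd (b k)) (b 1) (b 0)
  have c2 := fun k => dd_comm (hφ.sm.dd (b k)) (b 2) (b 0)
  have c3 := fun k => dd_comm (hφ.sm.dd (b k)) (b 2) (b 1)
  have e1 := fun k l => dd_comm ((hφ.sm.dd (b k)).dd (b l)) (b 1) (b 0)
  have e2 := fun k l => dd_comm ((hφ.sm.dd (b k)).dd (b l)) (b 2) (b 0)
  have e3 := fun k l => dd_comm ((hφ.sm.dd (b k)).dd (b l)) (b 2) (b 1)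
  simp only [CC, Fin.sum_univ_three, Fin.isValue, reduceIte, Fin.reduceEq]
  simp only [(sort2 hφ.sm b).1, (sort2 hφ.sm b).2.1, (sort2 hφ.sm b).2.2, c1, c2, c3, e1, e2, e3]
    at d0 d1 d2 d00 ⊢
  simp only [h1, h2, zero_mul, mul_zero, add_zero, zero_add]
  clear c1 c2 c3 e1 e2 e3 h1 h2
  generalize dd (b 0) φ x = P at *
  generalize dd (b 0) (dd (b 0) (dd (b 0) (dd (b 0) φ))) x = u0000 at *
  generalize dd (b 0) (dd (b 0) (dd (b 0) (dd (b 1) φ))) x = u0001 at *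
  generalize dd (b 0) (dd (b 0) (dd (b 0) (dd (b 2) φ))) x = u0002 at *
  generalize dd (b 0) (dd (b 0) (dd (b 1) (dd (b 1) φ))) x = u0011 at *
  generalize dd (b 0) (dd (b 0) (dd (b 1) (dd (b 2) φ))) x = u0012 at *
  generalize dd (b 0) (dd (b 0) (dd (b 2) (dd (b 2) φ))) x = u0022 at *
  generalize dd (b 0) (dd (b 1) (dd (b 1) (dd (b 1) φ))) x = u0111 at *
  generalize dd (b 0) (dd (b 1) (dd (b 1) (dd (b 2) φ))) x = u0112 at *
  generalize dd (b 0) (dd (b 1) (dd (b 2) (dd (b 2) φ))) x = u0122 at *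
  generalize dd (b 0) (dd (b 2) (dd (b 2) (dd (b 2) φ))) x = u0222 at *
  generalize dd (b 1) (dd (b 1) (dd (b 1) (dd (b 1) φ))) x = u1111 at *
  generalize dd (b 1) (dd (b 1) (dd (b 1) (dd (b 2) φ))) x = u1112 at *
  generalize dd (b 1) (dd (b 1) (dd (b 2) (dd (b 2) φ))) x = u1122 at *
  generalize dd (b 1) (dd (b 2) (dd (b 2) (dd (b 2) φ))) x = u1222 at *
  generalize dd (b 2) (dd (b 2) (dd (b 2) (dd (b 2) φ))) x = u2222 at *
  generalize dd (b 0) (dd (b 0) (dd (b 0) φ)) x = t000 at *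
  generalize dd (b 0) (dd (b 0) (dd (b 1) φ)) x = t001 at *
  generalize dd (b 0) (dd (b 0) (dd (b 2) φ)) x = t002 at *
  generalize dd (b 0) (dd (b 1) (dd (b 1) φ)) x = t011 at *
  generalize dd (b 0) (dd (b 1) (dd (b 2) φ)) x = t012 at *
  generalize dd (b 0) (dd (b 2) (dd (b 2) φ)) x = t022 at *
  generalize dd (b 1) (dd (b 1) (dd (b 1) φ)) x = t111 at *
  generalize dd (b 1) (dd (b 1) (dd (b 2) φ)) x = t112 at *
  generalize dd (b 1) (dd (b 2) (dd (b 2) φ)) x = t122 at *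
  generalize dd (b 2) (dd (b 2) (dd (b 2) φ)) x = t222 at *
  generalize dd (b 0) (dd (b 0) φ) x = s00 at *
  generalize dd (b 0) (dd (b 1) φ) x = s01 at *
  generalize dd (b 0) (dd (b 2) φ) x = s02 at *
  generalize dd (b 1) (dd (b 1) φ) x = s11 at *
  generalize dd (b 1) (dd (b 2) φ) x = s12 at *
  generalize dd (b 2) (dd (b 2) φ) x = s22 at *
  clear hφ
  have hw : (1 + P ^ 2)⁻¹ * (1 + P ^ 2) = 1 := inv_mul_cancel₀ (by positivity)
  generalize (1 + P ^ 2)⁻¹ = w at *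
  have s22e : s22 = 1 - s11 - w * s00 := by
    linear_combination w * hv + (-s11 - s22 - s00 + 1 + s00) * hw
  have t0 : t022 = - w * t000 - t011 + 2 * P * w * (s00 * s00 + s01 * s01 + s02 * s02)
      - 2 * P ^ 3 * w ^ 2 * s00 * s00 := by
    linear_combination w * d0 + (-(t011 + t022) + 2 * P * w * s00 * s00) * hw
      - 2 * P * w * s00 * s22e
  have t1 : t122 = - w * t001 - t111 + 2 * P * w * (s01 * s00 + s11 * s01 + s12 * s02)
      - 2 * P ^ 3 * w ^ 2 * s01 * s00 := by
    linear_combination w * d1 + (-(t111 + t122) + 2 * P * w * s00 * s01) * hw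
      - 2 * P * w * s01 * s22e
  have t2 : t222 = - w * t002 - t112 + 2 * P * w * (s02 * s00 + s12 * s01 + s22 * s02)
      - 2 * P ^ 3 * w ^ 2 * s02 * s00 := by
    linear_combination w * d2 + (-(t112 + t222) + 2 * P * w * s00 * s02) * hw
      - 2 * P * w * s02 * s22e
  clear d0 d1 d2 hv
  subst t0 t1 t2 s22e
  linear_combination -w ^ 3 * P ^ 2 * d00 + (
      4 * P * s00 * t000 * w ^ 3 + 4 * P * s01 * t001 * w ^ 2 + 4 * P * s02 * t002 * w ^ 2 -
      12 * P ^ 2 * s00 * s01 ^ 2 * w ^ 3 - 12 * P ^ 2 * s00 * s02 ^ 2 * w ^ 3 - 4 * P ^ 2 *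
      s00 ^ 2 * w ^ 2 + 8 * P ^ 2 * s00 ^ 2 * w ^ 3 + 4 * P ^ 2 * s00 ^ 3 * w ^ 3 - 16 * P ^ 2
      * s00 ^ 3 * w ^ 4 + 8 * P ^ 2 * s01 ^ 2 * w ^ 2 + 8 * P ^ 2 * s02 ^ 2 * w ^ 2 + P ^ 2 *
      u0011 * w ^ 2 + P ^ 2 * u0022 * w ^ 2 + 4 * P ^ 4 * s00 ^ 2 * w ^ 3 - 16 * P ^ 4 * s00 ^
      3 * w ^ 4 + 2 * s00 * s01 ^ 2 * w ^ 2 + 6 * s00 * s01 ^ 2 * w ^ 3 + 2 * s00 * s02 ^ 2 *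
      w ^ 2 + 2 * s00 * s02 ^ 2 * w ^ 3 - 4 * s00 * s11 * w ^ 2 + 4 * s00 * w ^ 2 - 2 * s00 ^
      2 * w ^ 2 - 4 * s00 ^ 2 * w ^ 3 + 2 * s00 ^ 3 * w ^ 3 + 2 * s00 ^ 3 * w ^ 4 + 8 * s01 *
      s02 * s12 * w ^ 2 + 4 * s01 ^ 2 * s11 * w ^ 2 - 2 * s01 ^ 2 * w - 4 * s01 ^ 2 * w ^ 2 -
      4 * s02 ^ 2 * s11 * w ^ 2 - 2 * s02 ^ 2 * w + 4 * s11 * w - 4 * s11 ^ 2 * w - 4 * s12 ^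
      2 * w - 2 * w) * hw

set_option maxHeartbeats 4000000 in
theorem LL_TT (hφ : Tr φ) (b : OB) (x : E3) (h1 : dd (b 1) φ x = 0)
    (h2 : dd (b 2) φ x = 0) {P w s00 s01 s02 s11 s12 s22 : ℝ} (hP : dd (b 0) φ x = P)
    (hw' : (1 + P ^ 2)⁻¹ = w)
    (h00 : dd (b 0) (dd (b 0) φ) x = s00) (h01 : dd (b 0) (dd (b 1) φ) x = s01)
    (h02 : dd (b 0) (dd (b 2) φ) x = s02) (h11 : dd (b 1) (dd (b 1) φ) x = s11)
    (h12 : dd (b 1) (dd (b 2) φ) x = s12) (h22 : dd (b 2) (dd (b 2) φ) x = s22)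
    {k0 k1 k2 m0 m1 m2 : ℝ} (hm0 : s00 * k0 + s01 * k1 + s02 * k2 = m0)
    (hm1 : s01 * k0 + s11 * k1 + s12 * k2 = m1) (hm2 : s02 * k0 + s12 * k1 + s22 * k2 = m2) :
    LL b φ (fun y => om b φ y * (k0 ^ 2 * dd (b 0) (dd (b 0) φ) y
      + k1 ^ 2 * dd (b 1) (dd (b 1) φ) y + k2 ^ 2 * dd (b 2) (dd (b 2) φ) y
      + 2 * k0 * k1 * dd (b 0) (dd (b 1) φ) y + 2 * k0 * k2 * dd (b 0) (dd (b 2) φ) y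
      + 2 * k1 * k2 * dd (b 1) (dd (b 2) φ) y)) x =
      2 * w * (w ^ 3 * s00 * m0 ^ 2 + 2 * w ^ 2 * s01 * m0 * m1 + 2 * w ^ 2 * s02 * m0 * m2
        + w * (s11 * m1 ^ 2 + 2 * s12 * m1 * m2 + s22 * m2 ^ 2))
      + 2 * (w * (w * m0 ^ 2 + m1 ^ 2 + m2 ^ 2)) * (w ^ 2 * P ^ 2 * s00)
      + w * (k0 * m0 + k1 * m1 + k2 * m2) * (6 * (w ^ 2 * P ^ 2 * (w * s00 ^ 2 + s01 ^ 2 + s02 ^ 2))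
        - 2 * w * (w ^ 2 * s00 ^ 2 + s11 ^ 2 + s22 ^ 2 + 2 * w * s01 ^ 2 + 2 * w * s02 ^ 2
          + 2 * s12 ^ 2))
      - 8 * (w ^ 3 * P ^ 2 * m0 * (w * s00 * m0 + s01 * m1 + s02 * m2))
      + 4 * (w ^ 2 * P * (w * m0 * (CC b φ x 0 0 0 * k0 + CC b φ x 0 0 1 * k1 + CC b φ x 0 0 2 * k2)
        + m1 * (CC b φ x 1 0 0 * k0 + CC b φ x 1 0 1 * k1 + CC b φ x 1 0 2 * k2)
        + m2 * (CC b φ x 2 0 0 * k0 + CC b φ x 2 0 1 * k1 + CC b φ x 2 0 2 * k2))) - 4 * (w ^ 2 * P * (w * s00 * (CC b φ x 0 0 0 * k0 ^ 2 + CC b φ x 0 1 1 * k1 ^ 2 + CC b φ x 0 2 2 * k2 ^ 2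
          + 2 * CC b φ x 0 0 1 * k0 * k1 + 2 * CC b φ x 0 0 2 * k0 * k2 + 2 * CC b φ x 0 1 2 * k1 * k2)
        + s01 * (CC b φ x 1 0 0 * k0 ^ 2 + CC b φ x 1 1 1 * k1 ^ 2 + CC b φ x 1 2 2 * k2 ^ 2
          + 2 * CC b φ x 1 0 1 * k0 * k1 + 2 * CC b φ x 1 0 2 * k0 * k2 + 2 * CC b φ x 1 1 2 * k1 * k2)
        + s02 * (CC b φ x 2 0 0 * k0 ^ 2 + CC b φ x 2 1 1 * k1 ^ 2 + CC b φ x 2 2 2 * k2 ^ 2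
          + 2 * CC b φ x 2 0 1 * k0 * k1 + 2 * CC b φ x 2 0 2 * k0 * k2 + 2 * CC b φ x 2 1 2 * k1 * k2))) := by
  subst hP hw' h00 h01 h02 h11 h12 h22 hm0 hm1 hm2
  have jS := fun k i j => J.of ((hφ.sm.dd (b j)).dd (b i)) x (b k) (b k)
  have jo := fun k => J_om hφ.sm b x (b k) h1 h2
  have R := fun k => (jo k).mul (((((((jS k 0 0).smul (k0 ^ 2)).add ((jS k 1 1).smul (k1 ^ 2))).add
    ((jS k 2 2).smul (k2 ^ 2))).add ((jS k 0 1).smul (2 * k0 * k1))).add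
    ((jS k 0 2).smul (2 * k0 * k2))).add ((jS k 1 2).smul (2 * k1 * k2)))
  rw [LL_adapted h1 h2, (R 0).hes, (R 1).hes, (R 2).hes, (R 0).fst, (R 1).fst, (R 2).fst]
  clear R jS jo
  have hv := hφ.pde_val b x h1 h2
  have d0 := (hφ.pde_jet b x (b 0) (b 0) h1 h2).1
  have d1 := (hφ.pde_jet b x (b 1) (b 0) h1 h2).1
  have d2 := (hφ.pde_jet b x (b 2) (b 0) h1 h2).1
  have d00 := (hφ.pde_jet b x (b 0) (b 0) h1 h2).2
  have d01 := (hφ.pde_jet b x (b 0) (b 1) h1 h2).2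
  have d02 := (hφ.pde_jet b x (b 0) (b 2) h1 h2).2
  have d11 := (hφ.pde_jet b x (b 1) (b 1) h1 h2).2
  have d12 := (hφ.pde_jet b x (b 1) (b 2) h1 h2).2
  have d22 := (hφ.pde_jet b x (b 2) (b 2) h1 h2).2
  have c1 := fun k => dd_comm (hφ.sm.dd (b k)) (b 1) (b 0)
  have c2 := fun k => dd_comm (hφ.sm.dd (b k)) (b 2) (b 0)
  have c3 := fun k => dd_comm (hφ.sm.dd (b k)) (b 2) (b 1)
  have e1 := fun k l => dd_comm ((hφ.sm.dd (b k)).dd (b l)) (b 1) (b 0)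
  have e2 := fun k l => dd_comm ((hφ.sm.dd (b k)).dd (b l)) (b 2) (b 0)
  have e3 := fun k l => dd_comm ((hφ.sm.dd (b k)).dd (b l)) (b 2) (b 1)
  simp only [CC]
  simp only [(sort2 hφ.sm b).1, (sort2 hφ.sm b).2.1, (sort2 hφ.sm b).2.2, c1, c2, c3, e1, e2, e3]
    at d0 d1 d2 d00 d01 d02 d11 d12 d22 ⊢
  clear c1 c2 c3 e1 e2 e3 h1 h2
  generalize dd (b 0) φ x = P at *
  generalize dd (b 0) (dd (b 0) (dd (b 0) (dd (b 0) φ))) x = u0000 at *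
  generalize dd (b 0) (dd (b 0) (dd (b 0) (dd (b 1) φ))) x = u0001 at *
  generalize dd (b 0) (dd (b 0) (dd (b 0) (dd (b 2) φ))) x = u0002 at *
  generalize dd (b 0) (dd (b 0) (dd (b 1) (dd (b 1) φ))) x = u0011 at *
  generalize dd (b 0) (dd (b 0) (dd (b 1) (dd (b 2) φ))) x = u0012 at *
  generalize dd (b 0) (dd (b 0) (dd (b 2) (dd (b 2) φ))) x = u0022 at *
  generalize dd (b 0) (dd (b 1) (dd (b 1) (dd (b 1) φ))) x = u0111 at *
  generalize dd (b 0) (dd (b 1) (dd (b 1) (dd (b 2) φ))) x = u0112 at *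
  generalize dd (b 0) (dd (b 1) (dd (b 2) (dd (b 2) φ))) x = u0122 at *
  generalize dd (b 0) (dd (b 2) (dd (b 2) (dd (b 2) φ))) x = u0222 at *
  generalize dd (b 1) (dd (b 1) (dd (b 1) (dd (b 1) φ))) x = u1111 at *
  generalize dd (b 1) (dd (b 1) (dd (b 1) (dd (b 2) φ))) x = u1112 at *
  generalize dd (b 1) (dd (b 1) (dd (b 2) (dd (b 2) φ))) x = u1122 at *
  generalize dd (b 1) (dd (b 2) (dd (b 2) (dd (b 2) φ))) x = u1222 at *
  generalize dd (b 2) (dd (b 2) (dd (b 2) (dd (b 2) φ))) x = u2222 at *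
  generalize dd (b 0) (dd (b 0) (dd (b 0) φ)) x = t000 at *
  generalize dd (b 0) (dd (b 0) (dd (b 1) φ)) x = t001 at *
  generalize dd (b 0) (dd (b 0) (dd (b 2) φ)) x = t002 at *
  generalize dd (b 0) (dd (b 1) (dd (b 1) φ)) x = t011 at *
  generalize dd (b 0) (dd (b 1) (dd (b 2) φ)) x = t012 at *
  generalize dd (b 0) (dd (b 2) (dd (b 2) φ)) x = t022 at *
  generalize dd (b 1) (dd (b 1) (dd (b 1) φ)) x = t111 at *
  generalize dd (b 1) (dd (b 1) (dd (b 2) φ)) x = t112 at *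
  generalize dd (b 1) (dd (b 2) (dd (b 2) φ)) x = t122 at *
  generalize dd (b 2) (dd (b 2) (dd (b 2) φ)) x = t222 at *
  generalize dd (b 0) (dd (b 0) φ) x = s00 at *
  generalize dd (b 0) (dd (b 1) φ) x = s01 at *
  generalize dd (b 0) (dd (b 2) φ) x = s02 at *
  generalize dd (b 1) (dd (b 1) φ) x = s11 at *
  generalize dd (b 1) (dd (b 2) φ) x = s12 at *
  generalize dd (b 2) (dd (b 2) φ) x = s22 at *
  clear hφ
  have hw : (1 + P ^ 2)⁻¹ * (1 + P ^ 2) = 1 := inv_mul_cancel₀ (by positivity)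
  generalize (1 + P ^ 2)⁻¹ = w at *
  have s22e : s22 = 1 - s11 - w * s00 := by
    linear_combination w * hv + (-s11 - s22 - s00 + 1 + s00) * hw
  have t0 : t022 = - w * t000 - t011 + 2 * P * w * (s00 * s00 + s01 * s01 + s02 * s02)
      - 2 * P ^ 3 * w ^ 2 * s00 * s00 := by
    linear_combination w * d0 + (-(t011 + t022) + 2 * P * w * s00 * s00) * hw
      - 2 * P * w * s00 * s22e
  have t1 : t122 = - w * t001 - t111 + 2 * P * w * (s01 * s00 + s11 * s01 + s12 * s02)
      - 2 * P ^ 3 * w ^ 2 * s01 * s00 := by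
    linear_combination w * d1 + (-(t111 + t122) + 2 * P * w * s00 * s01) * hw
      - 2 * P * w * s01 * s22e
  have t2 : t222 = - w * t002 - t112 + 2 * P * w * (s02 * s00 + s12 * s01 + s22 * s02)
      - 2 * P ^ 3 * w ^ 2 * s02 * s00 := by
    linear_combination w * d2 + (-(t112 + t222) + 2 * P * w * s00 * s02) * hw
      - 2 * P * w * s02 * s22e
  clear d0 d1 d2 hv
  subst t0 t1 t2 s22e
  linear_combination w ^ 2 * k0 ^ 2 * d00 + w ^ 2 * k1 ^ 2 * d11 + w ^ 2 * k2 ^ 2 * d22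
    + 2 * w ^ 2 * k0 * k1 * d01 + 2 * w ^ 2 * k0 * k2 * d02 + 2 * w ^ 2 * k1 * k2 * d12 + (
      24 * P ^ 2 * k0 * k1 * s00 ^ 2 * s01 * w ^ 3 + 24 * P ^ 2 * k0 * k2 * s00 ^ 2 * s02 * w
      ^ 3 + 12 * P ^ 2 * k0 ^ 2 * s00 ^ 3 * w ^ 3 + 16 * P ^ 2 * k1 * k2 * s00 * s01 * s02 * w
      ^ 3 + 8 * P ^ 2 * k1 * k2 * s00 ^ 2 * s12 * w ^ 3 + 8 * P ^ 2 * k1 ^ 2 * s00 * s01 ^ 2 *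
      w ^ 3 + 4 * P ^ 2 * k1 ^ 2 * s00 ^ 2 * s11 * w ^ 3 + 8 * P ^ 2 * k2 ^ 2 * s00 * s02 ^ 2
      * w ^ 3 - 4 * P ^ 2 * k2 ^ 2 * s00 ^ 2 * s11 * w ^ 3 + 4 * P ^ 2 * k2 ^ 2 * s00 ^ 2 * w
      ^ 3 - 4 * P ^ 2 * k2 ^ 2 * s00 ^ 3 * w ^ 4 - 2 * k0 * k1 * u0111 * w - 2 * k0 * k1 *
      u0122 * w - 2 * k0 * k2 * u0112 * w - 2 * k0 * k2 * u0222 * w - k0 ^ 2 * u0011 * w - k0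
      ^ 2 * u0022 * w + 4 * k1 * k2 * s00 * s12 * w ^ 2 - 4 * k1 * k2 * s01 * s02 * w ^ 2 - 2
      * k1 * k2 * u1112 * w - 2 * k1 * k2 * u1222 * w - 2 * k1 ^ 2 * s00 * s01 ^ 2 * w ^ 3 + 2
      * k1 ^ 2 * s00 * s11 ^ 2 * w ^ 2 + 2 * k1 ^ 2 * s00 * s12 ^ 2 * w ^ 2 + 2 * k1 ^ 2 * s00
      ^ 2 * s11 * w ^ 3 - 4 * k1 ^ 2 * s01 * s02 * s12 * w ^ 2 - 2 * k1 ^ 2 * s01 ^ 2 * s11 *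
      w ^ 2 + 2 * k1 ^ 2 * s02 ^ 2 * s11 * w ^ 2 - k1 ^ 2 * u1111 * w - k1 ^ 2 * u1122 * w - 2
      * k2 ^ 2 * s00 * s01 ^ 2 * w ^ 3 - 4 * k2 ^ 2 * s00 * s11 * w ^ 2 + 2 * k2 ^ 2 * s00 *
      s11 ^ 2 * w ^ 2 + 2 * k2 ^ 2 * s00 * s12 ^ 2 * w ^ 2 + 2 * k2 ^ 2 * s00 * w ^ 2 + 2 * k2
      ^ 2 * s00 ^ 2 * s11 * w ^ 3 - 2 * k2 ^ 2 * s00 ^ 2 * w ^ 3 - 4 * k2 ^ 2 * s01 * s02 *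
      s12 * w ^ 2 - 2 * k2 ^ 2 * s01 ^ 2 * s11 * w ^ 2 + 2 * k2 ^ 2 * s01 ^ 2 * w ^ 2 + 2 * k2
      ^ 2 * s02 ^ 2 * s11 * w ^ 2 - 2 * k2 ^ 2 * s02 ^ 2 * w ^ 2 - k2 ^ 2 * u1122 * w - k2 ^ 2
      * u2222 * w) * hw

end

section

/-! ### Calculus of the linearised operator -/

open Matrix

variable {φ u w : E3 → ℝ}

/-- Chain rule for the linearised operator, from second order jets. -/
theorem LL_of_jet {b : OB} {x : E3} {F : E3 → ℝ} {A g g₂ c₁ c₂ c₃ : ℝ}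
    (h : ∀ i j, J x (b i) (b j) F A (g * gv b u x i + g₂ * gv b w x i)
      (g * gv b u x j + g₂ * gv b w x j)
      (g * hm b u x i j + g₂ * hm b w x i j + c₁ * (gv b u x i * gv b u x j)
        + c₂ * (gv b u x i * gv b w x j + gv b w x i * gv b u x j)
        + c₃ * (gv b w x i * gv b w x j))) :
    LL b φ F x = g * LL b φ u x + g₂ * LL b φ w x + c₁ * GG b φ u u x + 2 * c₂ * GG b φ u w x
      + c₃ * GG b φ w w x := by
  have hh : hm b F x = fun i j => g * hm b u x i j + g₂ * hm b w x i j
      + c₁ * (gv b u x i * gv b u x j)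
      + c₂ * (gv b u x i * gv b w x j + gv b w x i * gv b u x j)
      + c₃ * (gv b w x i * gv b w x j) := by
    ext i j; exact (h i j).hes
  have hg : gv b F x = fun i => g * gv b u x i + g₂ * gv b w x i := by
    ext i; exact (h i i).fst
  simp only [LL, hh, hg, GG, Matrix.trace, Matrix.diag, Fin.sum_univ_three, mulVec, dotProduct]
  ring

theorem LL_add (hu : Sm u) (hw : Sm w) (b : OB) (x : E3) :
    LL b φ (fun y => u y + w y) x = LL b φ u x + LL b φ w x := by
  have := LL_of_jet (φ := φ) (u := u) (w := w) (g := 1) (g₂ := 1) (c₁ := 0) (c₂ := 0) (c₃ := 0)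
    (fun i j => by
      have j := (J.of hu x (b i) (b j)).add (J.of hw x (b i) (b j))
      convert j using 1 <;> simp [gv, hm])
  rw [this]; ring

theorem LL_mul (hu : Sm u) (hw : Sm w) (b : OB) (x : E3) :
    LL b φ (fun y => u y * w y) x = u x * LL b φ w x + w x * LL b φ u x
      + 2 * GG b φ u w x := by
  have := LL_of_jet (φ := φ) (u := u) (w := w) (g := w x) (g₂ := u x) (c₁ := 0) (c₂ := 1)
    (c₃ := 0) (fun i j => by
      have j := (J.of hu x (b i) (b j)).mul (J.of hw x (b i) (b j))
      convert j using 1 <;> simp [gv, hm] <;> ring)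
  rw [this]; ring

theorem LL_const (b : OB) (x : E3) (c : ℝ) : LL b φ (fun _ => c) x = 0 := by
  have := LL_of_jet (φ := φ) (u := fun _ => c) (w := fun _ => c) (g := 0) (g₂ := 0) (c₁ := 0)
    (c₂ := 0) (c₃ := 0) (b := b) (x := x) (F := fun _ => c)
    (fun i j => by
      have j := J.const x (b i) (b j) c
      convert j using 1 <;> simp)
  rw [this]; ring

theorem LL_smul (c : ℝ) (hu : Sm u) (b : OB) (x : E3) :
    LL b φ (fun y => c * u y) x = c * LL b φ u x := by
  have := LL_of_jet (φ := φ) (u := u) (w := u) (g := c) (g₂ := 0) (c₁ := 0) (c₂ := 0) (c₃ := 0)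
    (fun i j => by
      have j := (J.of hu x (b i) (b j)).smul c
      convert j using 1 <;> simp [gv, hm])
  rw [this]; ring

theorem LL_sq (hu : Sm u) (b : OB) (x : E3) :
    LL b φ (fun y => u y ^ 2) x = 2 * u x * LL b φ u x + 2 * GG b φ u u x := by
  have := LL_mul (φ := φ) hu hu b x
  simp only [← sq] at this
  rw [this]; ring

theorem LL_arctan (hu : Sm u) (b : OB) (x : E3) :
    LL b φ (fun y => arctan (u y)) x = (1 + u x ^ 2)⁻¹ * LL b φ u x
      - 2 * u x / (1 + u x ^ 2) ^ 2 * GG b φ u u x := by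
  have := LL_of_jet (φ := φ) (u := u) (w := u) (g := (1 + u x ^ 2)⁻¹) (g₂ := 0)
    (c₁ := -(2 * u x / (1 + u x ^ 2) ^ 2)) (c₂ := 0) (c₃ := 0) (fun i j => by
      have j := (J.of hu x (b i) (b j)).arctan
      convert j using 1 <;> simp [gv, hm]; ring)
  rw [this]; ring

theorem LL_exp (hu : Sm u) (b : OB) (x : E3) :
    LL b φ (fun y => exp (u y)) x = exp (u x) * (LL b φ u x + GG b φ u u x) := by
  have := LL_of_jet (φ := φ) (u := u) (w := u) (g := exp (u x)) (g₂ := 0)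
    (c₁ := exp (u x)) (c₂ := 0) (c₃ := 0) (fun i j => by
      have j := (J.of hu x (b i) (b j)).exp
      convert j using 1 <;> simp [gv, hm]; ring)
  rw [this]; ring

theorem LL_sub (hu : Sm u) (hw : Sm w) (b : OB) (x : E3) :
    LL b φ (fun y => u y - w y) x = LL b φ u x - LL b φ w x := by
  have := LL_of_jet (φ := φ) (u := u) (w := w) (g := 1) (g₂ := -1) (c₁ := 0) (c₂ := 0) (c₃ := 0)
    (fun i j => by
      have j := (J.of hu x (b i) (b j)).sub (J.of hw x (b i) (b j))
      convert j using 1 <;> simp [gv, hm] <;> ring)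
  rw [this]; ring

/-- The logarithm of the area element. -/
def lw (φ : E3 → ℝ) (y : E3) : ℝ := 1 / 2 * log (1 + gv b0 φ y ⬝ᵥ gv b0 φ y)

theorem lw_eq (φ : E3 → ℝ) (b : OB) (y : E3) :
    lw φ y = 1 / 2 * log (1 + gv b φ y ⬝ᵥ gv b φ y) := by
  rw [lw, dot_indep b b0]

theorem J_lw (hφ : Sm φ) (b : OB) (x e e' : E3) (h1 : dd (b 1) φ x = 0) (h2 : dd (b 2) φ x = 0) :
    J x e e' (lw φ) (lw φ x)
      ((1 + dd (b 0) φ x ^ 2)⁻¹ * dd (b 0) φ x * dd e (dd (b 0) φ) x)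
      ((1 + dd (b 0) φ x ^ 2)⁻¹ * dd (b 0) φ x * dd e' (dd (b 0) φ) x)
      ((1 + dd (b 0) φ x ^ 2)⁻¹ * (dd (b 0) φ x * dd e (dd e' (dd (b 0) φ)) x
        + dd e (dd (b 0) φ) x * dd e' (dd (b 0) φ) x
        + dd e (dd (b 1) φ) x * dd e' (dd (b 1) φ) x
        + dd e (dd (b 2) φ) x * dd e' (dd (b 2) φ) x)
        - 2 * ((1 + dd (b 0) φ x ^ 2)⁻¹ * dd (b 0) φ x) ^ 2
          * dd e (dd (b 0) φ) x * dd e' (dd (b 0) φ) x) := by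
  have hpos : (0:ℝ) < 1 + dd (b 0) φ x ^ 2 := by positivity
  have j := ((J.W2 hφ b x e e').log (fun y => W2_pos b φ y)).smul (1 / 2)
  have hf : lw φ = fun y => 1 / 2 * log (1 + gv b φ y ⬝ᵥ gv b φ y) := funext (lw_eq φ b)
  rw [hf]
  convert j using 1
  all_goals simp only [dotProduct, Fin.sum_univ_three, gv, h1, h2, zero_mul, add_zero, ← sq]
  all_goals try field_simp
  all_goals try ring

theorem sm_lw (hφ : Sm φ) : Sm (lw φ) :=
  (((J.W2 hφ b0 0 0 0).log (fun y => W2_pos b0 φ y)).smul (1 / 2)).sm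

theorem LL_lw (hφ : Tr φ) (b : OB) (x : E3) (h1 : dd (b 1) φ x = 0) (h2 : dd (b 2) φ x = 0) :
    LL b φ (lw φ) x = om b φ x * (1 - vv b φ x) - GG b φ (lw φ) (lw φ) x := by
  have hL := LL_dd hφ b (b 0) x
  rw [LL_adapted h1 h2] at hL
  have j := fun i => J_lw hφ.sm b x (b i) (b i) h1 h2
  rw [LL_adapted h1 h2, GG_adapted h1 h2, (j 0).hes, (j 1).hes, (j 2).hes, (j 0).fst, (j 1).fst,
    (j 2).fst, vv_fun hφ]
  simp only [(J_om hφ.sm b x 0 h1 h2).val, h1, h2, (sort2 hφ.sm b).1, (sort2 hφ.sm b).2.1, (sort2 hφ.sm b).2.2, mul_zero,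
    add_zero, zero_mul] at hL ⊢
  have hw : (1 + dd (b 0) φ x ^ 2)⁻¹ * (1 + dd (b 0) φ x ^ 2) = 1 :=
    inv_mul_cancel₀ (by positivity)
  generalize (1 + dd (b 0) φ x ^ 2)⁻¹ = w at *
  generalize dd (b 0) φ x = P at *
  generalize dd (b 0) (dd (b 0) φ) x = s00 at *
  generalize dd (b 0) (dd (b 1) φ) x = s01 at *
  generalize dd (b 0) (dd (b 2) φ) x = s02 at *
  generalize dd (b 1) (dd (b 1) φ) x = s11 at *
  generalize dd (b 1) (dd (b 2) φ) x = s12 at *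
  generalize dd (b 2) (dd (b 2) φ) x = s22 at *
  linear_combination w * P * hL + (-P ^ 2 * s00 ^ 2 * w ^ 2 + s00 ^ 2 * w + s01 ^ 2 * w
    + s02 ^ 2 * w) * hw

theorem LL_self (hφ : Tr φ) (b : OB) (x : E3) (h1 : dd (b 1) φ x = 0) (h2 : dd (b 2) φ x = 0) :
    LL b φ φ x = 2 * om b φ x - 1 + 2 * YY b φ x := by
  have hv := hφ.pde_val b x h1 h2
  have ho : om b φ x = _ := (J_om hφ.sm b x 0 h1 h2).val
  rw [LL_adapted h1 h2, YY_fun hφ]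
  simp only [ho, h1, h2, mul_zero, add_zero, zero_mul]
  field_simp
  linear_combination (1 + dd (b 0) φ x ^ 2) * hv

theorem LL_inner (b : OB) (x : E3) (h1 : dd (b 1) φ x = 0) (h2 : dd (b 2) φ x = 0) (c : E3) :
    LL b φ (fun y => inner ℝ c y) x = - 2 * (1 + dd (b 0) φ x ^ 2)⁻¹ * dd (b 0) φ x *
      ((1 + dd (b 0) φ x ^ 2)⁻¹ * dd (b 0) (dd (b 0) φ) x * inner ℝ c (b 0)
        + dd (b 0) (dd (b 1) φ) x * inner ℝ c (b 1)
        + dd (b 0) (dd (b 2) φ) x * inner ℝ c (b 2)) := by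
  rw [LL_adapted h1 h2]
  simp only [dd_inner, dd_const]
  ring

end

section

/-! ### Convexity and minima -/

open Matrix

variable {φ u w : E3 → ℝ}

theorem hasDerivAt_line (hu : Sm u) (x e : E3) (t : ℝ) :
    HasDerivAt (fun s : ℝ => u (x + s • e)) (dd e u (x + t • e)) t := by
  have h1 : HasDerivAt (fun s : ℝ => x + s • e) e t := by
    simpa using ((hasDerivAt_id t).smul_const e).const_add x
  exact (hu.diff _).hasFDerivAt.comp_hasDerivAt t h1

theorem Tr.grad_le (hφ : Tr φ) (x y : E3) : φ x + dd (y - x) φ x ≤ φ y := by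
  have hc : ConvexOn ℝ Set.univ (fun s : ℝ => φ (x + s • (y - x))) := by
    refine ⟨convex_univ, fun s _ t _ a c ha hc hac => ?_⟩
    have := hφ.conv.2 (Set.mem_univ (x + s • (y - x))) (Set.mem_univ (x + t • (y - x))) ha hc hac
    refine le_trans (le_of_eq ?_) this
    obtain rfl : a = 1 - c := by linarith
    change φ (x + ((1 - c) * s + c * t) • (y - x)) = _
    congr 1
    module
  have hd := hasDerivAt_line hφ.sm x (y - x) 0
  have := hc.le_slope_of_hasDerivAt (Set.mem_univ _) (Set.mem_univ 1) one_pos hd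
  simp [slope_def_field] at this
  linarith

theorem deriv2_nonneg_of_min {f f' : ℝ → ℝ} {f'' a : ℝ} (hf : ∀ t, HasDerivAt f (f' t) t)
    (hf' : HasDerivAt f' f'' a) (hm : IsLocalMin f a) : f' a = 0 ∧ 0 ≤ f'' := by
  have h0 : f' a = 0 := hm.hasDerivAt_eq_zero (hf a)
  refine ⟨h0, ?_⟩
  by_contra! hneg
  have hdf : deriv f = f' := funext fun t => (hf t).deriv
  have hmax := isLocalMax_of_deriv_deriv_neg (f := f) (x₀ := a) (by rw [hdf, hf'.deriv]; exact hneg)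
    (by rw [hdf]; exact h0) (hf a).continuousAt
  have heq : f =ᶠ[nhds a] fun _ => f a := by
    filter_upwards [hm, hmax] with t h1 h2
    exact le_antisymm h2 h1
  have h1 : deriv f =ᶠ[nhds a] deriv (fun _ => f a) := heq.deriv
  have h2 := h1.deriv_eq
  rw [hdf, hf'.deriv] at h2
  simp at h2
  linarith

theorem dd_of_min (hu : Sm u) {x : E3} (hm : IsLocalMin u x) (e : E3) :
    dd e u x = 0 ∧ 0 ≤ dd e (dd e u) x := by
  have h := deriv2_nonneg_of_min (f := fun s : ℝ => u (x + s • e)) (a := 0)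
    (hasDerivAt_line hu x e) (hasDerivAt_line (hu.dd e) x e 0) ?_
  · simpa using h
  · have hc : ContinuousAt (fun s : ℝ => x + s • e) 0 := by fun_prop
    have : Filter.Tendsto (fun s : ℝ => x + s • e) (nhds 0) (nhds x) := by
      have := hc.tendsto; simpa using this
    have h2 := this.eventually hm
    simpa [IsLocalMin, IsMinFilter] using h2

theorem LL_nonneg_of_min (hφ : Sm φ) (hu : Sm u) {x : E3} (hm : IsLocalMin u x) (b : OB) :
    0 ≤ LL b φ u x := by
  obtain ⟨b', h1, h2⟩ := exists_adapted φ x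
  rw [LL_indep b' b hφ hu, LL_adapted h1 h2]
  have h := dd_of_min hu hm
  rw [(h (b' 0)).1, (h (b' 1)).1, (h (b' 2)).1]
  have a0 := (h (b' 0)).2
  have a1 := (h (b' 1)).2
  have a2 := (h (b' 2)).2
  have : 0 < (1 + dd (b' 0) φ x ^ 2)⁻¹ := by positivity
  have := mul_nonneg this.le a0
  linarith

theorem Tr.hess_nonneg (hφ : Tr φ) (e x : E3) : 0 ≤ dd e (dd e φ) x := by
  set g : E3 := (InnerProductSpace.toDual ℝ E3).symm (fderiv ℝ φ x) with hg
  have hdd : ∀ e, dd e φ x = inner ℝ g e := by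
    intro e
    rw [hg, InnerProductSpace.toDual_symm_apply]; rfl
  have j := (J.of hφ.sm x e e).sub (J.inner x e e g)
  have hm : IsLocalMin (fun y => φ y - inner ℝ g y) x := by
    refine Filter.Eventually.of_forall fun y => ?_
    have := hφ.grad_le x y
    rw [hdd, inner_sub_right] at this
    linarith
  have h2 := (dd_of_min j.sm hm e).2
  rw [j.hes] at h2
  linarith

theorem Tr.hess_cs (hφ : Tr φ) (e e' x : E3) :
    dd e (dd e' φ) x ^ 2 ≤ dd e (dd e φ) x * dd e' (dd e' φ) x := by
  have h : ∀ t : ℝ, 0 ≤ dd e (dd e φ) x * (t * t) + 2 * dd e (dd e' φ) x * t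
      + dd e' (dd e' φ) x := by
    intro t
    have h := hφ.hess_nonneg (t • e + e') x
    have h1 : dd (t • e + e') φ = fun y => t * dd e φ y + dd e' φ y := by
      funext y; rw [dd_add_dir, dd_smul_dir]
    have h2 : ∀ v, dd v (fun y => t * dd e φ y + dd e' φ y) x =
        t * dd v (dd e φ) x + dd v (dd e' φ) x := fun v =>
      (((J.of (hφ.sm.dd e) x v v).smul t).add (J.of (hφ.sm.dd e') x v v)).fst
    rw [h1, h2, dd_add_dir, dd_add_dir, dd_smul_dir, dd_smul_dir, dd_comm hφ.sm e' e] at h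
    linarith
  have := discrim_le_zero h
  unfold discrim at this
  nlinarith

end

section

/-! ### Algebra of trace one matrices -/

open Matrix

theorem psd_two {p q r s t : ℝ} (hp : 0 ≤ p) (hq : 0 ≤ q) (hr : r ^ 2 ≤ p * q) :
    0 ≤ p * s ^ 2 + q * t ^ 2 - 2 * r * s * t := by
  have h1 : (2 * r * s * t) ^ 2 ≤ (p * s ^ 2 + q * t ^ 2) ^ 2 := by
    nlinarith [sq_nonneg (p * s ^ 2 - q * t ^ 2), mul_le_mul_of_nonneg_right hr
      (mul_nonneg (sq_nonneg s) (sq_nonneg t))]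
  have h2 := (le_abs_self _).trans (abs_le_of_sq_le_sq h1 (by positivity))
  linarith

theorem cs_three (A B C u v t : ℝ) :
    (A * u - B * v - C * t) ^ 2 ≤ (A ^ 2 + B ^ 2 + C ^ 2) * (u ^ 2 + v ^ 2 + t ^ 2) := by
  linarith [sq_nonneg (A * v + B * u), sq_nonneg (A * t + C * u), sq_nonneg (B * t - C * v)]

/-- Entries of a positive semidefinite symmetric matrix of trace one. -/
structure PS (a d g x y z : ℝ) : Prop where
  tr : a + d + g = 1
  pos : ∀ u v t : ℝ, 0 ≤ a * u ^ 2 + d * v ^ 2 + g * t ^ 2 + 2 * x * u * v + 2 * y * u * t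
    + 2 * z * v * t

namespace PS
variable {a d g x y z : ℝ} (h : PS a d g x y z)
include h

theorem a0 : 0 ≤ a := by have := h.pos 1 0 0; simp at this; exact this
theorem d0 : 0 ≤ d := by have := h.pos 0 1 0; simp at this; exact this
theorem g0 : 0 ≤ g := by have := h.pos 0 0 1; simp at this; exact this

theorem det0 : 0 ≤ a * (d * g - z ^ 2) - x * (x * g - z * y) + y * (x * z - d * y) := by
  have hp : (!![a, x, y; x, d, z; y, z, g] : Matrix (Fin 3) (Fin 3) ℝ).PosSemidef := by
    refine Matrix.PosSemidef.of_dotProduct_mulVec_nonneg ?_ fun v => ?_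
    · ext i j; fin_cases i <;> fin_cases j <;> simp
    · have := h.pos (v 0) (v 1) (v 2)
      simp [Matrix.mulVec, dotProduct, Fin.sum_univ_three]
      linarith
  have := hp.det_nonneg
  rw [Matrix.det_fin_three] at this
  simp at this
  linarith

theorem adz : z ^ 2 ≤ d * g := by
  have := h.pos
  have h1 : ∀ t : ℝ, 0 ≤ d * (t * t) + 2 * z * t + g := fun t => by
    have := h.pos 0 t 1; nlinarith
  have := discrim_le_zero h1
  unfold discrim at this; nlinarith

theorem ady : y ^ 2 ≤ a * g := by
  have h1 : ∀ t : ℝ, 0 ≤ a * (t * t) + 2 * y * t + g := fun t => by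
    have := h.pos t 0 1; nlinarith
  have := discrim_le_zero h1
  unfold discrim at this; nlinarith

theorem adx : x ^ 2 ≤ a * d := by
  have h1 : ∀ t : ℝ, 0 ≤ a * (t * t) + 2 * x * t + d := fun t => by
    have := h.pos t 1 0; nlinarith
  have := discrim_le_zero h1
  unfold discrim at this; nlinarith

theorem v_eq : 1 - (a ^ 2 + d ^ 2 + g ^ 2 + 2 * x ^ 2 + 2 * y ^ 2 + 2 * z ^ 2) =
    2 * ((d * g - z ^ 2) + (a * g - y ^ 2) + (a * d - x ^ 2)) := by
  linear_combination (-(a + d + g) - 1) * h.tr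

theorem le_tr (u v t : ℝ) : a * u ^ 2 + d * v ^ 2 + g * t ^ 2 + 2 * x * u * v + 2 * y * u * t
    + 2 * z * v * t ≤ u ^ 2 + v ^ 2 + t ^ 2 := by
  have h1 := h.pos v (-u) 0
  have h2 := h.pos t 0 (-u)
  have h3 := h.pos 0 t (-v)
  have h4 : u ^ 2 + v ^ 2 + t ^ 2 = (a + d + g) * (u ^ 2 + v ^ 2 + t ^ 2) := by rw [h.tr]; ring
  rw [h4]
  linarith

theorem a_le : a ≤ 1 - ((d * g - z ^ 2) + (a * g - y ^ 2) + (a * d - x ^ 2)) := by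
  have := h.tr
  have := h.d0
  have := h.g0
  have e : d + g = (a + d + g) * (d + g) := by rw [h.tr]; ring
  nlinarith [sq_nonneg x, sq_nonneg y, sq_nonneg z, mul_nonneg h.d0 h.g0, sq_nonneg d, sq_nonneg g]

theorem sq_row : a ^ 2 + x ^ 2 + y ^ 2 ≤ a := by
  have e : a = (a + d + g) * a := by rw [h.tr]; ring
  nlinarith [h.adx, h.ady]

theorem cube : a ^ 2 + d ^ 2 + g ^ 2 + 2 * x ^ 2 + 2 * y ^ 2 + 2 * z ^ 2 -
    (a ^ 3 + d ^ 3 + g ^ 3 + 3 * a * x ^ 2 + 3 * a * y ^ 2 + 3 * d * x ^ 2 + 3 * g * y ^ 2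
      + 3 * d * z ^ 2 + 3 * g * z ^ 2 + 6 * x * y * z) ≤
    (d * g - z ^ 2) + (a * g - y ^ 2) + (a * d - x ^ 2) := by
  have h0 := h.det0
  obtain rfl : a = 1 - d - g := by linarith [h.tr]
  linarith

/-- The square of the matrix is bounded by the matrix. -/
theorem sq_le (u v t : ℝ) : (a * u + x * v + y * t) ^ 2 + (x * u + d * v + z * t) ^ 2
    + (y * u + z * v + g * t) ^ 2 ≤ a * u ^ 2 + d * v ^ 2 + g * t ^ 2 + 2 * x * u * v
    + 2 * y * u * t + 2 * z * v * t := by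
  have m0 := sub_nonneg.2 h.adz
  have m1 := sub_nonneg.2 h.ady
  have m2 := sub_nonneg.2 h.adx
  have k1 := psd_two (s := v) (t := u) (r := y * z - x * g) m0 m1 (by
    linarith [mul_nonneg h.g0 h.det0])
  have k2 := psd_two (s := t) (t := u) (r := x * z - y * d) m0 m2 (by
    linarith [mul_nonneg h.d0 h.det0])
  have k3 := psd_two (s := t) (t := v) (r := x * y - z * a) m1 m2 (by
    linarith [mul_nonneg h.a0 h.det0])
  obtain rfl : a = 1 - d - g := by linarith [h.tr]
  linarith

/-- The algebraic part of the evolution of a principal curvature. -/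
theorem zero_order {ω V u v t : ℝ} (hω : 0 ≤ ω) (hω1 : ω ≤ 1) (hV : V ^ 2 ≤ 1)
    (hu : u ^ 2 + v ^ 2 + t ^ 2 ≤ 1) {c₀ c₁ c₂ β f : ℝ} (hc0 : c₀ = a * u + x * v + y * t)
    (hc1 : c₁ = x * u + d * v + z * t) (hc2 : c₂ = y * u + z * v + g * t)
    (hβ : β = u * c₀ + v * c₁ + t * c₂)
    (hf : f = a ^ 2 + d ^ 2 + g ^ 2 + 2 * x ^ 2 + 2 * y ^ 2 + 2 * z ^ 2) :
    2 * ω * (a * c₀ ^ 2 + d * c₁ ^ 2 + g * c₂ ^ 2 + 2 * x * c₀ * c₁ + 2 * y * c₀ * c₂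
      + 2 * z * c₁ * c₂) + 2 * (c₀ ^ 2 + c₁ ^ 2 + c₂ ^ 2) * (V ^ 2 * a)
      + β * (6 * (V ^ 2 * (a ^ 2 + x ^ 2 + y ^ 2)) - 2 * ω * f)
      - 8 * (V ^ 2 * c₀ * (a * c₀ + x * c₁ + y * c₂)) ≤ 30 * (1 - f) := by
  have hβ' : a * u ^ 2 + d * v ^ 2 + g * t ^ 2 + 2 * x * u * v + 2 * y * u * t + 2 * z * v * t = β
    := by rw [hβ, hc0, hc1, hc2]; ring
  have h1 := h.le_tr c₀ c₁ c₂
  have h2 := h.sq_le u v t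
  rw [← hc0, ← hc1, ← hc2, hβ'] at h2
  have hβ0 : 0 ≤ β := by rw [← hβ']; exact h.pos u v t
  have hβ1 : β ≤ 1 := by have := h.le_tr u v t; linarith
  have m0 := sub_nonneg.2 h.adz
  have m1 := sub_nonneg.2 h.ady
  have m2 := sub_nonneg.2 h.adx
  have hv := h.v_eq
  rw [← hf] at hv
  set e := (d * g - z ^ 2) + (a * g - y ^ 2) + (a * d - x ^ 2) with he
  have hV0 := sq_nonneg V
  have q0 : (x * z - y * d) ^ 2 ≤ ((d * g - z ^ 2)) * (a * d - x ^ 2) := by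
    linarith [mul_nonneg h.d0 h.det0]
  have q1 : (y * z - x * g) ^ 2 ≤ (d * g - z ^ 2) * (a * g - y ^ 2) := by
    linarith [mul_nonneg h.g0 h.det0]
  have q2 : (x * y - z * a) ^ 2 ≤ (a * g - y ^ 2) * (a * d - x ^ 2) := by
    linarith [mul_nonneg h.a0 h.det0]
  have e0 : 0 ≤ e := by linarith
  have r1 : a * β - c₀ ^ 2 ≤ 2 * e := by
    have e1 : a * β - c₀ ^ 2 = (a * d - x ^ 2) * v ^ 2 + (a * g - y ^ 2) * t ^ 2
        - 2 * (x * y - z * a) * v * t := by rw [← hβ', hc0]; ring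
    have e2 := psd_two m2 m1 (r := -(x * y - z * a)) (s := v) (t := t) (by linarith)
    have e3 : (a * d - x ^ 2) * v ^ 2 ≤ (a * d - x ^ 2) * 1 := by
      gcongr; linarith [sq_nonneg u, sq_nonneg t]
    have e4 : (a * g - y ^ 2) * t ^ 2 ≤ (a * g - y ^ 2) * 1 := by
      gcongr; linarith [sq_nonneg u, sq_nonneg v]
    linarith
  have r2 : |c₀ - (a * c₀ + x * c₁ + y * c₂)| ≤ 2 * e := by
    have e1 : c₀ - (a * c₀ + x * c₁ + y * c₂) = ((a * g - y ^ 2) + (a * d - x ^ 2)) * u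
        - (y * z - x * g) * v - (x * z - y * d) * t := by
      rw [hc0, hc1, hc2]
      obtain rfl : a = 1 - d - g := by linarith [h.tr]
      ring
    rw [e1]
    refine abs_le_of_sq_le_sq ?_ (by linarith)
    have e2 : (((a * g - y ^ 2) + (a * d - x ^ 2)) * u
        - (y * z - x * g) * v - (x * z - y * d) * t) ^ 2 ≤ (((a * g - y ^ 2) + (a * d - x ^ 2)) ^ 2
        + (y * z - x * g) ^ 2 + (x * z - y * d) ^ 2) * (u ^ 2 + v ^ 2 + t ^ 2) := by
      exact cs_three _ _ _ _ _ _
    refine e2.trans ?_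
    have e3 : ((a * g - y ^ 2) + (a * d - x ^ 2)) ^ 2
        + (y * z - x * g) ^ 2 + (x * z - y * d) ^ 2 ≤ (2 * e) ^ 2 := by
      have : ((a * g - y ^ 2) + (a * d - x ^ 2)) ^ 2 + (d * g - z ^ 2) * (a * g - y ^ 2)
        + (d * g - z ^ 2) * (a * d - x ^ 2) ≤ (2 * e) ^ 2 := by
        rw [he]
        linarith [mul_nonneg m0 m1, mul_nonneg m0 m2, mul_nonneg m1 m2, sq_nonneg (d * g - z ^ 2),
          sq_nonneg (a * g - y ^ 2 + (a * d - x ^ 2))]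
      linarith
    have e5 : 0 ≤ (2 * e) ^ 2 := sq_nonneg _
    calc _ ≤ (2 * e) ^ 2 * 1 := by gcongr
      _ = _ := mul_one _
  have r3 : |c₀| ≤ 1 := by
    rw [← sq_le_one_iff_abs_le_one]
    linarith [sq_nonneg c₁, sq_nonneg c₂]
  have hf0 : 0 ≤ 1 - f := by linarith
  have t1 : 2 * ω * (a * c₀ ^ 2 + d * c₁ ^ 2 + g * c₂ ^ 2 + 2 * x * c₀ * c₁ + 2 * y * c₀ * c₂
      + 2 * z * c₁ * c₂) ≤ 2 * ω * β := by gcongr; linarith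
  have t2 : 2 * (c₀ ^ 2 + c₁ ^ 2 + c₂ ^ 2) * (V ^ 2 * a) ≤ 2 * β * (V ^ 2 * a) := by
    have := h.a0; gcongr
  have t3 : β * (6 * (V ^ 2 * (a ^ 2 + x ^ 2 + y ^ 2))) ≤ β * (6 * (V ^ 2 * a)) := by
    have := h.sq_row; gcongr
  have t4 : ω * β * (1 - f) ≤ 1 * 1 * (1 - f) := by gcongr
  have t5 : V ^ 2 * (a * β - c₀ ^ 2) ≤ 1 * (2 * e) := by
    calc _ ≤ V ^ 2 * (2 * e) := by gcongr
      _ ≤ _ := by gcongr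
  have t6 : V ^ 2 * (c₀ * (c₀ - (a * c₀ + x * c₁ + y * c₂))) ≤ 1 * (2 * e) := by
    have : c₀ * (c₀ - (a * c₀ + x * c₁ + y * c₂)) ≤ 1 * (2 * e) := by
      refine (le_abs_self _).trans ?_
      rw [abs_mul]
      gcongr
    calc _ ≤ V ^ 2 * (1 * (2 * e)) := by gcongr
      _ ≤ 1 * (1 * (2 * e)) := by gcongr
      _ = _ := by ring
  linarith

end PS

end

section

/-! ### Gradient terms in the evolution inequalities -/

open Matrix

variable {φ u w : E3 → ℝ}

theorem abs_sum_le {ι : Type*} [Fintype ι] {r f g : ι → ℝ} {N c : ℝ} (hN : 0 ≤ N)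
    (hf : ∀ i, 0 ≤ f i) (hg : ∀ i, 0 ≤ g i) (hr : ∀ i, r i ^ 2 = f i * g i)
    (h : c ^ 2 * ((∑ i, f i) * ∑ i, g i) ≤ N ^ 2) : |c * ∑ i, r i| ≤ N := by
  refine abs_le_of_sq_le_sq ?_ hN
  have := Finset.sum_sq_le_sum_mul_sum_of_sq_le_mul Finset.univ (fun i _ => hf i)
    (fun i _ => hg i) (fun i _ => (hr i).le)
  rw [mul_pow]
  exact (mul_le_mul_of_nonneg_left this (sq_nonneg c)).trans h

/-- The gradient term in the evolution of the gradient defect. -/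
theorem grad_term {W : Fin 3 → ℝ} (hW : ∀ i, 0 ≤ W i) {C : Fin 3 → Fin 3 → ℝ}
    {s : Fin 3 → Fin 3 → ℝ} {w P N : ℝ} (hN : 0 ≤ N) (hw : 0 ≤ w) (hP : w * P ^ 2 ≤ 1)
    (hC : w * ∑ k, ∑ i, W k * W i * C k i ^ 2 ≤ N ^ 2)
    (hs : ∑ k, ∑ i, W k * W i * s k i ^ 2 ≤ 1) :
    |w * P * ∑ k, ∑ i, W k * W i * C k i * s k i| ≤ N := by
  have key := abs_sum_le (ι := Fin 3 × Fin 3) (r := fun p => W p.1 * W p.2 * C p.1 p.2 * s p.1 p.2)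
    (f := fun p => W p.1 * W p.2 * C p.1 p.2 ^ 2) (g := fun p => W p.1 * W p.2 * s p.1 p.2 ^ 2)
    (N := N) (c := w * P) hN (fun p => by have := hW p.1; have := hW p.2; positivity)
    (fun p => by have := hW p.1; have := hW p.2; positivity) (fun p => by ring)
  simp only [Fintype.sum_prod_type] at key
  refine key ?_
  set F := ∑ k, ∑ i, W k * W i * C k i ^ 2
  set G := ∑ k, ∑ i, W k * W i * s k i ^ 2
  have hF : 0 ≤ F := Finset.sum_nonneg fun k _ => Finset.sum_nonneg fun i _ => by
    have := hW k; have := hW i; positivity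
  have hG : 0 ≤ G := Finset.sum_nonneg fun k _ => Finset.sum_nonneg fun i _ => by
    have := hW k; have := hW i; positivity
  calc (w * P) ^ 2 * (F * G) = (w * P ^ 2) * (w * F) * G := by ring
    _ ≤ 1 * N ^ 2 * 1 := by gcongr
    _ = _ := by ring

/-- The first gradient term in the evolution of a curvature. -/
theorem grad_term₁ {W : Fin 3 → ℝ} (hW : ∀ i, 0 ≤ W i) {C : Fin 3 → Fin 3 → ℝ}
    {m κ y : Fin 3 → ℝ} {w P N : ℝ} (hN : 0 ≤ N) (hw : 0 ≤ w) (hP : w * P ^ 2 ≤ 1)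
    (hC : w * ∑ k, ∑ i, W k * W i * C k i ^ 2 ≤ N ^ 2)
    (hκ : ∀ j, κ j ^ 2 * w = W j * y j) (hy0 : ∀ j, 0 ≤ y j) (hy : ∑ j, y j ≤ 1)
    (hm : w * ∑ k, W k * m k ^ 2 ≤ 1) :
    |w ^ 2 * P * ∑ k, W k * m k * ∑ j, C k j * κ j| ≤ N := by
  have key := abs_sum_le (ι := Fin 3 × Fin 3)
    (r := fun p => W p.1 * m p.1 * C p.1 p.2 * (w * κ p.2))
    (f := fun p => W p.1 * W p.2 * C p.1 p.2 ^ 2)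
    (g := fun p => W p.1 * m p.1 ^ 2 * (w * y p.2))
    (N := N) (c := w * P) hN (fun p => by have := hW p.1; have := hW p.2; positivity)
    (fun p => by have := hW p.1; have := hy0 p.2; positivity) (fun p => by
      linear_combination (W p.1 * m p.1 * C p.1 p.2) ^ 2 * w * hκ p.2)
  simp only [Fintype.sum_prod_type] at key
  have e1 : w ^ 2 * P * ∑ k, W k * m k * ∑ j, C k j * κ j =
      w * P * ∑ k, ∑ j, W k * m k * C k j * (w * κ j) := by
    simp only [Fin.sum_univ_three]; ring
  rw [e1]
  refine key ?_
  have e2 : ∑ k, ∑ j, W k * m k ^ 2 * (w * y j) = (w * ∑ k, W k * m k ^ 2) * ∑ j, y j := by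
    simp only [Fin.sum_univ_three]; ring
  rw [e2]
  set F := ∑ k, ∑ i, W k * W i * C k i ^ 2
  have hF : 0 ≤ F := Finset.sum_nonneg fun k _ => Finset.sum_nonneg fun i _ => by
    have := hW k; have := hW i; positivity
  have hG : 0 ≤ ∑ j, y j := Finset.sum_nonneg fun k _ => hy0 k
  have hM : 0 ≤ w * ∑ k, W k * m k ^ 2 := mul_nonneg hw (Finset.sum_nonneg fun k _ => by
    have := hW k; positivity)
  calc (w * P) ^ 2 * (F * (w * (∑ k, W k * m k ^ 2) * ∑ j, y j)) =
      (w * P ^ 2) * (w * F) * ((w * ∑ k, W k * m k ^ 2) * ∑ j, y j) := by ring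
    _ ≤ 1 * N ^ 2 * (1 * 1) := by gcongr
    _ = _ := by ring

/-- The second gradient term in the evolution of a curvature. -/
theorem grad_term₂ {W : Fin 3 → ℝ} (hW : ∀ i, 0 ≤ W i) {C : Fin 3 → Fin 3 → Fin 3 → ℝ}
    {m κ y : Fin 3 → ℝ} {w P N : ℝ} (hN : 0 ≤ N) (hw : 0 ≤ w) (hP : w * P ^ 2 ≤ 1)
    (hC : ∑ k, ∑ i, ∑ j, W k * W i * W j * C k i j ^ 2 ≤ N ^ 2)
    (hκ : ∀ j, κ j ^ 2 * w = W j * y j) (hy0 : ∀ j, 0 ≤ y j) (hy : ∑ j, y j ≤ 1)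
    (hm : w * ∑ k, W k * m k ^ 2 ≤ 1) :
    |w ^ 2 * P * ∑ k, W k * m k * ∑ i, ∑ j, C k i j * (κ i * κ j)| ≤ N := by
  have key := abs_sum_le (ι := Fin 3 × Fin 3 × Fin 3)
    (r := fun p => W p.1 * m p.1 * C p.1 p.2.1 p.2.2 * (w * κ p.2.1) * (w * κ p.2.2))
    (f := fun p => W p.1 * W p.2.1 * W p.2.2 * C p.1 p.2.1 p.2.2 ^ 2)
    (g := fun p => W p.1 * m p.1 ^ 2 * (w * y p.2.1) * (w * y p.2.2))
    (N := N) (c := P) hN (fun p => by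
      have := hW p.1; have := hW p.2.1; have := hW p.2.2; positivity)
    (fun p => by have := hW p.1; have := hy0 p.2.1; have := hy0 p.2.2; positivity) (fun p => by
      linear_combination (W p.1 * m p.1 * C p.1 p.2.1 p.2.2) ^ 2 * w ^ 2 *
        (κ p.2.2 ^ 2 * w * hκ p.2.1 + W p.2.1 * y p.2.1 * hκ p.2.2))
  simp only [Fintype.sum_prod_type] at key
  have e1 : w ^ 2 * P * ∑ k, W k * m k * ∑ i, ∑ j, C k i j * (κ i * κ j) =
      P * ∑ k, ∑ i, ∑ j, W k * m k * C k i j * (w * κ i) * (w * κ j) := by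
    simp only [Fin.sum_univ_three]; ring
  rw [e1]
  refine key ?_
  have e2 : ∑ k, ∑ i, ∑ j, W k * m k ^ 2 * (w * y i) * (w * y j) =
      w * (w * ∑ k, W k * m k ^ 2) * (∑ j, y j) ^ 2 := by
    simp only [Fin.sum_univ_three]; ring
  rw [e2]
  set F := ∑ k, ∑ i, ∑ j, W k * W i * W j * C k i j ^ 2
  have hF : 0 ≤ F := Finset.sum_nonneg fun k _ => Finset.sum_nonneg fun i _ =>
    Finset.sum_nonneg fun j _ => by
    have := hW k; have := hW i; have := hW j; positivity
  have hG : 0 ≤ ∑ j, y j := Finset.sum_nonneg fun k _ => hy0 k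
  have hM : 0 ≤ w * ∑ k, W k * m k ^ 2 := mul_nonneg hw (Finset.sum_nonneg fun k _ => by
    have := hW k; positivity)
  calc P ^ 2 * (F * (w * (w * ∑ k, W k * m k ^ 2) * (∑ j, y j) ^ 2)) =
      (w * P ^ 2) * F * ((w * ∑ k, W k * m k ^ 2) * (∑ j, y j) ^ 2) := by ring
    _ ≤ 1 * N ^ 2 * (1 * 1 ^ 2) := by gcongr
    _ = _ := by ring

/-- The rescaled second fundamental form in an adapted basis has trace one. -/
theorem Tr.ps (hφ : Tr φ) (b : OB) (x : E3) (h1 : dd (b 1) φ x = 0) (h2 : dd (b 2) φ x = 0)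
    {w H : ℝ} (hw : (1 + dd (b 0) φ x ^ 2)⁻¹ = w) (hH : H ^ 2 = w) :
    PS (w * dd (b 0) (dd (b 0) φ) x) (dd (b 1) (dd (b 1) φ) x) (dd (b 2) (dd (b 2) φ) x)
      (H * dd (b 0) (dd (b 1) φ) x) (H * dd (b 0) (dd (b 2) φ) x) (dd (b 1) (dd (b 2) φ) x) := by
  constructor
  · have h := hφ.pde_val b x h1 h2
    have hw1 : w * (1 + dd (b 0) φ x ^ 2) = 1 := by
      rw [← hw]; exact inv_mul_cancel₀ (by positivity)
    linear_combination w * h + (1 - dd (b 1) (dd (b 1) φ) x - dd (b 2) (dd (b 2) φ) x) * hw1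
  · intro u v t
    have h := hφ.hess_nonneg ((u * H) • b 0 + v • b 1 + t • b 2) x
    rw [dd_dd_basis b _ _ hφ.sm] at h
    have ho := orthonormal_iff_ite.1 b.orthonormal
    simp [Fin.sum_univ_three, inner_add_right, inner_smul_right, ho,
      sort2 hφ.sm b] at h
    rw [← hH]
    linarith

theorem wt_nonneg (b : OB) (x : E3) (i : Fin 3) : 0 ≤ wt b φ x i := by
  unfold wt; split_ifs <;> positivity

theorem nb2_nonneg (b : OB) (x : E3) : 0 ≤ nb2 b φ x :=
  Finset.sum_nonneg fun k _ => Finset.sum_nonneg fun i _ => Finset.sum_nonneg fun j _ => by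
    have := wt_nonneg (φ := φ) b x
    have := this k; have := ‹∀ i, _› i; have := ‹∀ i, _› j; positivity

theorem CC_symm (hφ : Sm φ) (b : OB) (x : E3) (k i j : Fin 3) : CC b φ x k i j = CC b φ x k j i := by
  unfold CC
  rw [dd_comm hφ (b i) (b j)]
  ring

/-- First and second derivatives at a point in an adapted basis. -/
structure Fr (φ : E3 → ℝ) (b : OB) (x : E3) (P w H s00 s01 s02 s11 s12 s22 : ℝ) : Prop where
  h0 : dd (b 0) φ x = P
  h1 : dd (b 1) φ x = 0
  h2 : dd (b 2) φ x = 0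
  w0 : 0 < w
  w1 : w * (1 + P ^ 2) = 1
  H0 : 0 < H
  HH : H ^ 2 = w
  h00 : dd (b 0) (dd (b 0) φ) x = s00
  h01 : dd (b 0) (dd (b 1) φ) x = s01
  h02 : dd (b 0) (dd (b 2) φ) x = s02
  h11 : dd (b 1) (dd (b 1) φ) x = s11
  h12 : dd (b 1) (dd (b 2) φ) x = s12
  h22 : dd (b 2) (dd (b 2) φ) x = s22
  ps : PS (w * s00) s11 s22 (H * s01) (H * s02) s12
  om : om b φ x = w
  vv : vv b φ x = 1 - ((w * s00) ^ 2 + s11 ^ 2 + s22 ^ 2 + 2 * (H * s01) ^ 2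
        + 2 * (H * s02) ^ 2 + 2 * s12 ^ 2)
  YY : YY b φ x = w * P ^ 2 - w * P ^ 2 * (w * s00)

theorem Tr.fr (hφ : Tr φ) (x : E3) :
    ∃ b : OB, ∃ P w H s00 s01 s02 s11 s12 s22, Fr φ b x P w H s00 s01 s02 s11 s12 s22 := by
  obtain ⟨b, h1, h2⟩ := exists_adapted φ x
  have h1 : dd (b 1) φ x = 0 := h1
  have h2 : dd (b 2) φ x = 0 := h2
  have hw0 : 0 < (1 + dd (b 0) φ x ^ 2)⁻¹ := by positivity
  have hw1 : (1 + dd (b 0) φ x ^ 2)⁻¹ * (1 + dd (b 0) φ x ^ 2) = 1 :=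
    inv_mul_cancel₀ (by positivity)
  have hH := sq_sqrt hw0.le
  have hom := (J_om hφ.sm b x 0 h1 h2).val
  refine ⟨b, _, (1 + dd (b 0) φ x ^ 2)⁻¹, √(1 + dd (b 0) φ x ^ 2)⁻¹, _, _, _, _, _, _, rfl, h1, h2,
    hw0, hw1, sqrt_pos.2 hw0, hH, rfl, rfl, rfl, rfl, rfl, rfl, hφ.ps b x h1 h2 rfl hH, hom, ?_, ?_⟩
  · rw [vv_fun hφ b]
    simp only [h1, h2, hom, mul_zero, add_zero, zero_mul, mul_pow, hH]
    generalize (1 + dd (b 0) φ x ^ 2)⁻¹ = w at *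
    generalize dd (b 0) φ x = P at *
    generalize dd (b 0) (dd (b 0) φ) x = s00 at *
    generalize dd (b 0) (dd (b 1) φ) x = s01 at *
    generalize dd (b 0) (dd (b 2) φ) x = s02 at *
    linear_combination (2 * s01 ^ 2 + 2 * s02 ^ 2 + s00 ^ 2 * (1 + w - w * P ^ 2)) * hw1
  · rw [YY_fun hφ b]
    simp only [h1, h2, hom, mul_zero, add_zero, zero_mul]
    ring

theorem wt_one (b : OB) (x : E3) : wt b φ x 1 = 1 := by rw [wt, if_neg (by decide)]
theorem wt_two (b : OB) (x : E3) : wt b φ x 2 = 1 := by rw [wt, if_neg (by decide)]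

namespace Fr
variable {b : OB} {x : E3} {P w H s00 s01 s02 s11 s12 s22 : ℝ}
  (F : Fr φ b x P w H s00 s01 s02 s11 s12 s22)
include F

theorem w_inv : (1 + P ^ 2)⁻¹ = w := by
  have := F.w1
  have h : (0:ℝ) < 1 + P ^ 2 := by positivity
  field_simp; linarith

theorem wP : w * P ^ 2 = 1 - w := by linarith [F.w1]

theorem w_le : w ≤ 1 := by
  have := F.wP; have := mul_nonneg F.w0.le (sq_nonneg P); linarith

theorem wt0 : wt b φ x 0 = w := by rw [wt, if_pos rfl, F.h0, F.w_inv]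

theorem nb0 : w * ∑ k, ∑ i, wt b φ x k * wt b φ x i * CC b φ x k i 0 ^ 2
      ≤ √(nb2 b φ x) ^ 2 := by
  rw [sq_sqrt (nb2_nonneg b x), nb2]
  rw [Finset.mul_sum]
  refine Finset.sum_le_sum fun k _ => ?_
  rw [Finset.mul_sum]
  refine Finset.sum_le_sum fun i _ => ?_
  rw [Fin.sum_univ_three, F.wt0, wt_one, wt_two]
  have := wt_nonneg (φ := φ) b x i
  have := wt_nonneg (φ := φ) b x k
  have : 0 ≤ wt b φ x k * wt b φ x i * 1 * CC b φ x k i 1 ^ 2 := by positivity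
  have : 0 ≤ wt b φ x k * wt b φ x i * 1 * CC b φ x k i 2 ^ 2 := by positivity
  linarith

theorem LL_YY_le (hφ : Tr φ) :
    LL b φ (_root_.YY b φ) x ≤ w * (2 * _root_.vv b φ x + 4 * √(nb2 b φ x)) := by
  have hv0 := F.ps.v_eq
  rw [← F.vv] at hv0
  have hc := F.ps.cube
  have hv := F.vv
  have hwP := F.wP
  have hw0 := F.w0
  have hw1 := F.w_le
  have hm0 := F.ps.adz
  have hm1 := F.ps.ady
  have hm2 := F.ps.adx
  have hgr := grad_term (wt_nonneg (φ := φ) b x) (C := fun k i => CC b φ x k i 0)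
    (s := ![![s00, s01, s02], ![s01, s11, s12], ![s02, s12, s22]]) (sqrt_nonneg _) hw0.le
    (by linarith : w * P ^ 2 ≤ 1) F.nb0 (by
      simp [Fin.sum_univ_three, F.wt0, wt_one, wt_two]
      have := F.HH
      simp only [mul_pow, this] at *
      linarith)
  rw [LL_YY hφ b x F.h1 F.h2 F.h0 F.w_inv F.h00 F.h01 F.h02 F.h11 F.h12 F.h22]
  simp [Fin.sum_univ_three, F.wt0, wt_one, wt_two, -abs_mul] at hgr
  have hg2 := mul_le_mul_of_nonneg_left (abs_le.1 hgr).1 hw0.le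
  have hf1 := F.ps.le_tr (w * s00) (H * s01) (H * s02)
  have hP2 := mul_nonneg (sq_nonneg (w * P)) (sub_nonneg.2 hf1)
  have hc2 := mul_le_mul_of_nonneg_left hc (sq_nonneg w)
  have hv1 : 0 ≤ _root_.vv b φ x := by linarith
  have hw2 : w ^ 2 * _root_.vv b φ x ≤ w * _root_.vv b φ x := by
    gcongr; nlinarith
  have hv2 : 0 ≤ w * _root_.vv b φ x := by positivity
  have hHH := F.HH
  have e2 : w ^ 2 * _root_.vv b φ x = w ^ 2 *
    (2 * ((s11 * s22 - s12 ^ 2) + (w * s00 * s22 - (H * s02) ^ 2) + (w * s00 * s11 - (H * s01) ^ 2))) := by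
    rw [hv0]
  have hH3 : ∀ a c d : ℝ, a * (H * c) * (H * d) = w * a * c * d := fun a c d => by
    rw [← hHH]; ring
  have e3 : ∀ a : ℝ, (H * a) ^ 2 = w * a ^ 2 := fun a => by rw [mul_pow, hHH]
  have e4 : 6 * (H * s01) * (H * s02) * s12 = 6 * w * s01 * s02 * s12 := by rw [← hHH]; ring
  have e5 : 2 * s12 * (H * s01) * (H * s02) = 2 * w * s12 * s01 * s02 := by rw [← hHH]; ring
  have e6 : 2 * (H * s01) * (w * s00) * (H * s01) = 2 * w ^ 2 * s00 * s01 ^ 2 := by rw [← hHH]; ring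
  have e7 : 2 * (H * s02) * (w * s00) * (H * s02) = 2 * w ^ 2 * s00 * s02 ^ 2 := by rw [← hHH]; ring
  simp only [e3, e4, e5, e6, e7] at hP2 hc2 e2
  linarith

set_option maxHeartbeats 1000000 in
theorem LL_TT_le (hφ : Tr φ) {k : E3} (hk : ‖k‖ = 1) :
    LL b φ (fun y => _root_.om b φ y * dd k (dd k φ) y) x
      ≤ 30 * _root_.vv b φ x + 8 * √(nb2 b φ x) := by
  have hk2 : ∑ i, inner ℝ (b i) k ^ 2 = 1 := by
    have := b.sum_sq_norm_inner_right k
    simpa [hk] using this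
  have hfun : (fun y => _root_.om b φ y * dd k (dd k φ) y) = fun y => _root_.om b φ y *
      (inner ℝ (b 0) k ^ 2 * dd (b 0) (dd (b 0) φ) y
      + inner ℝ (b 1) k ^ 2 * dd (b 1) (dd (b 1) φ) y
      + inner ℝ (b 2) k ^ 2 * dd (b 2) (dd (b 2) φ) y
      + 2 * inner ℝ (b 0) k * inner ℝ (b 1) k * dd (b 0) (dd (b 1) φ) y
      + 2 * inner ℝ (b 0) k * inner ℝ (b 2) k * dd (b 0) (dd (b 2) φ) y
      + 2 * inner ℝ (b 1) k * inner ℝ (b 2) k * dd (b 1) (dd (b 2) φ) y) := by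
    funext y
    rw [dd_dd_basis b k k hφ.sm]
    simp only [Fin.sum_univ_three, sort2 hφ.sm b]
    ring
  rw [hfun]
  rw [Fin.sum_univ_three] at hk2
  generalize inner ℝ (b 0) k = k0 at *
  generalize inner ℝ (b 1) k = k1 at *
  generalize inner ℝ (b 2) k = k2 at *
  clear hfun
  rw [LL_TT hφ b x F.h1 F.h2 F.h0 F.w_inv F.h00 F.h01 F.h02 F.h11 F.h12 F.h22 rfl rfl rfl]
  obtain ⟨m0, hm0⟩ : ∃ m, s00 * k0 + s01 * k1 + s02 * k2 = m := ⟨_, rfl⟩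
  obtain ⟨m1, hm1⟩ : ∃ m, s01 * k0 + s11 * k1 + s12 * k2 = m := ⟨_, rfl⟩
  obtain ⟨m2, hm2⟩ : ∃ m, s02 * k0 + s12 * k1 + s22 * k2 = m := ⟨_, rfl⟩
  rw [hm0, hm1, hm2]
  have hw0 := F.w0
  have hwP := F.wP
  have hw1 := F.w_le
  have hHH := F.HH
  have hHm : ∀ a c : ℝ, H * a * (H * c) = w * a * c := fun a c => by rw [← hHH]; ring
  have hHs : ∀ a : ℝ, (H * a) ^ 2 = w * a ^ 2 := fun a => by rw [mul_pow, hHH]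
  have hVV : (H * P) ^ 2 = w * P ^ 2 := hHs P
  have hY : k0 ^ 2 + (H * k1) ^ 2 + (H * k2) ^ 2 ≤ 1 := by
    rw [hHs, hHs]
    have := mul_le_mul_of_nonneg_right hw1 (sq_nonneg k1)
    have := mul_le_mul_of_nonneg_right hw1 (sq_nonneg k2)
    linarith
  have c0 : w * m0 = w * s00 * k0 + H * s01 * (H * k1) + H * s02 * (H * k2) := by
    rw [← hm0, ← hHH]; ring
  have c1 : H * m1 = H * s01 * k0 + s11 * (H * k1) + s12 * (H * k2) := by
    rw [← hm1]; ring
  have c2 : H * m2 = H * s02 * k0 + s12 * (H * k1) + s22 * (H * k2) := by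
    rw [← hm2]; ring
  have hz := F.ps.zero_order hw0.le hw1 (by rw [hVV]; linarith : (H * P) ^ 2 ≤ 1) hY c0 c1 c2 rfl
    rfl
  rw [← F.vv, hVV] at hz
  have hm : w * ∑ i, wt b φ x i * (![m0, m1, m2] i) ^ 2 ≤ 1 := by
    have h1 := F.ps.sq_le k0 (H * k1) (H * k2)
    have h2 := F.ps.le_tr k0 (H * k1) (H * k2)
    rw [← c0, ← c1, ← c2] at h1
    simp [Fin.sum_univ_three, F.wt0, wt_one, wt_two]
    rw [hHs, hHs] at h1
    linarith
  have hs : w * ∑ i, wt b φ x i * (![s00, s01, s02] i) ^ 2 ≤ 1 := by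
    have h1 := F.ps.sq_row
    have := F.ps.tr
    have := F.ps.d0
    have := F.ps.g0
    simp [Fin.sum_univ_three, F.wt0, wt_one, wt_two]
    rw [hHs, hHs] at h1
    linarith
  have hκ : ∀ j, (![k0, k1, k2] j) ^ 2 * w = wt b φ x j * ![k0 ^ 2, w * k1 ^ 2, w * k2 ^ 2] j := by
    intro j
    fin_cases j
    · simp [F.wt0]; ring
    · simp [wt_one]; ring
    · simp [wt_two]; ring
  have hy0 : ∀ j, 0 ≤ ![k0 ^ 2, w * k1 ^ 2, w * k2 ^ 2] j := by
    intro j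
    fin_cases j <;> simp <;> positivity
  have hy : ∑ j, ![k0 ^ 2, w * k1 ^ 2, w * k2 ^ 2] j ≤ 1 := by
    rw [hHs, hHs] at hY
    simpa [Fin.sum_univ_three] using hY
  have g1 := grad_term₁ (wt_nonneg (φ := φ) b x) (C := fun k i => CC b φ x k i 0) (sqrt_nonneg _)
    hw0.le (by linarith : w * P ^ 2 ≤ 1) F.nb0 hκ hy0 hy hm
  have g2 := grad_term₂ (wt_nonneg (φ := φ) b x) (C := CC b φ x) (sqrt_nonneg _)
    hw0.le (by linarith : w * P ^ 2 ≤ 1) (sq_sqrt (nb2_nonneg b x)).ge hκ hy0 hy hs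
  have s01' := CC_symm hφ.sm b x
  simp [Fin.sum_univ_three, F.wt0, wt_one, wt_two, s01' _ 1 0, s01' _ 2 0, s01' _ 2 1,
    -abs_mul] at g1 g2
  have g1' := (abs_le.1 g1).2
  have g2' := (abs_le.1 g2).1
  clear g1 g2 hκ hy0 hy hs hm c0 c1 c2 hY hVV hHs hHm hwP hm0 hm1 hm2 F hw0 hw1 s01'
  subst hHH
  linarith

end Fr

end

section

/-! ### Pointwise estimates -/

open Matrix

variable {φ u w : E3 → ℝ}

theorem sm_vv (hφ : Tr φ) (b : OB) : Sm (vv b φ) := by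
  rw [vv_fun hφ b]
  have s := fun i => hφ.sm.dd (b i)
  have t := fun i j => (hφ.sm.dd (b j)).dd (b i)
  have o := sm_om hφ.sm b
  have s0 := s 0; have s1 := s 1; have s2 := s 2
  have t00 := t 0 0; have t01 := t 0 1; have t02 := t 0 2
  have t11 := t 1 1; have t12 := t 1 2; have t22 := t 2 2
  unfold Sm at *
  fun_prop

theorem sm_YY (hφ : Tr φ) (b : OB) : Sm (YY b φ) := by
  rw [YY_fun hφ b]
  have s := fun i => hφ.sm.dd (b i)
  have t := fun i j => (hφ.sm.dd (b j)).dd (b i)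
  have o := sm_om hφ.sm b
  have s0 := s 0; have s1 := s 1; have s2 := s 2
  have t00 := t 0 0; have t01 := t 0 1; have t02 := t 0 2
  have t11 := t 1 1; have t12 := t 1 2; have t22 := t 2 2
  unfold Sm at *
  fun_prop

theorem Tr.evol (hφ : Tr φ) (x : E3) :
    ∃ N : ℝ, 0 ≤ N ∧ LL b0 φ (vv b0 φ) x = -2 * N ^ 2 ∧
      LL b0 φ (YY b0 φ) x ≤ om b0 φ x * (2 * vv b0 φ x + 4 * N) ∧
      ∀ k : E3, ‖k‖ = 1 →
        LL b0 φ (fun y => om b0 φ y * dd k (dd k φ) y) x ≤ 30 * vv b0 φ x + 8 * N := by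
  obtain ⟨b, P, w, H, s00, s01, s02, s11, s12, s22, F⟩ := hφ.fr x
  have e1 : vv b0 φ = vv b φ := funext (vv_indep b b0 hφ.sm)
  have e2 : YY b0 φ = YY b φ := funext (YY_indep b b0 hφ.sm)
  have e3 : om b0 φ = om b φ := funext (om_indep b b0 φ)
  rw [e1, e2, e3]
  refine ⟨√(nb2 b φ x), sqrt_nonneg _, ?_, ?_, fun k hk => ?_⟩
  · rw [LL_indep b b0 hφ.sm (sm_vv hφ b), LL_vv hφ b x F.h1 F.h2, sq_sqrt (nb2_nonneg b x)]
  · rw [LL_indep b b0 hφ.sm (sm_YY hφ b), F.om]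
    exact F.LL_YY_le hφ
  · have := (sm_om hφ.sm b).mul ((hφ.sm.dd k).dd k)
    rw [LL_indep b b0 hφ.sm this]
    exact F.LL_TT_le hφ hk

theorem Fr.GG_lw {b : OB} {x : E3} {P w H s00 s01 s02 s11 s12 s22 : ℝ}
    (F : Fr φ b x P w H s00 s01 s02 s11 s12 s22) (hφ : Tr φ) : GG b φ (lw φ) (lw φ) x =
      w * P ^ 2 * ((w * s00) ^ 2 + (H * s01) ^ 2 + (H * s02) ^ 2) := by
  have j := fun i => J_lw hφ.sm b x (b i) (b i) F.h1 F.h2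
  rw [GG_adapted F.h1 F.h2, (j 0).fst, (j 1).fst, (j 2).fst]
  simp only [(sort2 hφ.sm b).1, (sort2 hφ.sm b).2.1, F.h00, F.h01, F.h02, F.h0, F.w_inv,
    mul_pow, F.HH]
  ring

/-- Pointwise relations between the basic quantities. -/
theorem Tr.point (hφ : Tr φ) (x : E3) :
    0 ≤ vv b0 φ x ∧ vv b0 φ x ≤ 1 ∧ 0 ≤ YY b0 φ x ∧ YY b0 φ x ≤ 1 - om b0 φ x ∧
      vv b0 φ x / 2 * (1 - om b0 φ x) ≤ YY b0 φ x ∧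
      1 - om b0 φ x - 2 * YY b0 φ x ≤ GG b0 φ (lw φ) (lw φ) x ∧
      GG b0 φ (lw φ) (lw φ) x ≤ 1 - om b0 φ x - YY b0 φ x ∧
      YY b0 φ x ^ 2 + om b0 φ x * vv b0 φ x ≤ LL b0 φ (fun y => φ y - lw φ y) x := by
  obtain ⟨b, P, w, H, s00, s01, s02, s11, s12, s22, F⟩ := hφ.fr x
  rw [LL_sub hφ.sm (sm_lw hφ.sm), LL_indep b b0 hφ.sm hφ.sm, LL_indep b b0 hφ.sm (sm_lw hφ.sm),
    LL_lw hφ b x F.h1 F.h2, LL_self hφ b x F.h1 F.h2, vv_indep b b0 hφ.sm, YY_indep b b0 hφ.sm,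
    om_indep b b0, GG_indep b b0]
  have hG := F.GG_lw hφ
  have hY := F.YY
  have hv := F.vv
  have hv0 := F.ps.v_eq
  rw [← F.vv] at hv0
  have hwP := F.wP
  have hw0 := F.w0
  have hw1 := F.w_le
  have hm0 := F.ps.adz
  have hm1 := F.ps.ady
  have hm2 := F.ps.adx
  have ha := F.ps.a_le
  have hr := F.ps.sq_row
  have ha0 := F.ps.a0
  rw [hwP] at hY hG
  rw [F.om]
  generalize GG b φ (lw φ) (lw φ) x = G at *
  generalize vv b φ x = v at *
  generalize YY b φ x = Y at *
  obtain ⟨r, hr'⟩ : ∃ r, (H * s01) ^ 2 + (H * s02) ^ 2 = r := ⟨_, rfl⟩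
  have hr0 : 0 ≤ r := by rw [← hr']; positivity
  have hG' : G = (1 - w) * ((w * s00) ^ 2 + r) := by rw [hG, ← hr']; ring
  have hrr : (w * s00) ^ 2 + r ≤ w * s00 := by linarith
  have hav : w * s00 ≤ 1 - v / 2 := by linarith
  have hv1 : v ≤ 1 := by rw [hv]; linarith [sq_nonneg (w * s00), sq_nonneg s11, sq_nonneg s22, sq_nonneg (H * s01), sq_nonneg (H * s02), sq_nonneg s12]
  have hv00 : 0 ≤ v := by linarith
  clear hG ha hr hv0 hv hm0 hm1 hm2 F
  generalize w * s00 = a at *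
  have h1w : 0 ≤ 1 - w := by linarith
  subst hY hG'
  refine ⟨hv00, hv1, ?_, ?_, ?_, ?_, ?_, ?_⟩
  · nlinarith
  · nlinarith
  · nlinarith
  · nlinarith [mul_nonneg h1w hr0, mul_nonneg h1w (sq_nonneg (1 - a))]
  · nlinarith
  · have : 0 ≤ (1 - w) * w * (1 - a) ^ 2 := by positivity
    nlinarith [mul_nonneg h1w hr0]

/-- The Hessian is bounded by the metric. -/
theorem Tr.hess_le (hφ : Tr φ) (e x : E3) : dd e (dd e φ) x ≤ ‖e‖ ^ 2 + dd e φ x ^ 2 := by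
  obtain ⟨b, P, w, H, s00, s01, s02, s11, s12, s22, F⟩ := hφ.fr x
  have hn : ∑ i, inner ℝ (b i) e ^ 2 = ‖e‖ ^ 2 := by
    have := b.sum_sq_norm_inner_right e
    simpa using this
  rw [dd_dd_basis b e e hφ.sm, dd_basis b e, ← hn]
  simp only [Fin.sum_univ_three, sort2 hφ.sm b, F.h0, F.h1, F.h2, F.h00, F.h01, F.h02, F.h11,
    F.h12, F.h22]
  have h := F.ps.le_tr (inner ℝ (b 0) e / H) (inner ℝ (b 1) e) (inner ℝ (b 2) e)
  have hH := F.H0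
  have hHH := F.HH
  have hw := F.w1
  generalize inner ℝ (b 0) e = k0 at *
  generalize inner ℝ (b 1) e = k1 at *
  generalize inner ℝ (b 2) e = k2 at *
  have e1 : w * s00 * (k0 / H) ^ 2 = s00 * k0 ^ 2 := by rw [← hHH]; field_simp
  have e2 : 2 * (H * s01) * (k0 / H) * k1 = 2 * s01 * k0 * k1 := by field_simp
  have e3 : 2 * (H * s02) * (k0 / H) * k2 = 2 * s02 * k0 * k2 := by field_simp
  have e4 : (k0 / H) ^ 2 = (1 + P ^ 2) * k0 ^ 2 := by
    rw [div_pow, hHH, div_eq_iff F.w0.ne']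
    linear_combination -k0 ^ 2 * hw
  rw [e1, e2, e3, e4] at h
  linarith

theorem Tr.GG_dd_le (hφ : Tr φ) (k x : E3) : GG b0 φ (dd k φ) (dd k φ) x ≤ dd k (dd k φ) x := by
  obtain ⟨b, P, w, H, s00, s01, s02, s11, s12, s22, F⟩ := hφ.fr x
  rw [GG_indep b b0, GG_adapted F.h1 F.h2, F.h0, F.w_inv]
  have h := fun i => hφ.hess_cs (b i) k x
  have h0 := mul_le_mul_of_nonneg_left (h 0) F.w0.le
  have h1 := h 1
  have h2 := h 2
  have ht := F.ps.tr
  rw [F.h00] at h0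
  rw [F.h11] at h1
  rw [F.h22] at h2
  have : dd k (dd k φ) x = (w * s00 + s11 + s22) * dd k (dd k φ) x := by rw [ht, one_mul]
  rw [this]
  linarith

theorem GG_nonneg (b : OB) (u : E3 → ℝ) (x : E3) : 0 ≤ GG b φ u u x := by
  obtain ⟨b', h1, h2⟩ := exists_adapted φ x
  rw [GG_indep b' b, GG_adapted h1 h2]
  have : 0 ≤ (1 + dd (b' 0) φ x ^ 2)⁻¹ := by positivity
  nlinarith [mul_nonneg this (mul_self_nonneg (dd (b' 0) u x)), mul_self_nonneg (dd (b' 1) u x),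
    mul_self_nonneg (dd (b' 2) u x)]

theorem Tr.GG_inner_le (hφ : Tr φ) (c x : E3) :
    GG b0 φ (fun y => inner ℝ c y) (fun y => inner ℝ c y) x ≤ ‖c‖ ^ 2 := by
  obtain ⟨b, P, w, H, s00, s01, s02, s11, s12, s22, F⟩ := hφ.fr x
  have hn : ∑ i, inner ℝ c (b i) ^ 2 = ‖c‖ ^ 2 := by
    have := b.sum_sq_norm_inner_left c
    simpa using this
  rw [GG_indep b b0, GG_adapted F.h1 F.h2, F.h0, F.w_inv, ← hn, Fin.sum_univ_three]
  simp only [dd_inner]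
  have := mul_le_mul_of_nonneg_right F.w_le (sq_nonneg (inner ℝ c (b 0)))
  linarith

theorem Tr.LL_inner_le (hφ : Tr φ) (c x : E3) :
    |LL b0 φ (fun y => inner ℝ c y) x| ≤ 2 * ‖c‖ := by
  obtain ⟨b, P, w, H, s00, s01, s02, s11, s12, s22, F⟩ := hφ.fr x
  have hn : ∑ i, inner ℝ c (b i) ^ 2 = ‖c‖ ^ 2 := by
    have := b.sum_sq_norm_inner_left c
    simpa using this
  rw [Fin.sum_univ_three] at hn
  rw [LL_indep b b0 hφ.sm (sm_inner c), LL_inner b x F.h1 F.h2, F.h0, F.w_inv, F.h00, F.h01, F.h02]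
  generalize inner ℝ c (b 0) = k0 at *
  generalize inner ℝ c (b 1) = k1 at *
  generalize inner ℝ c (b 2) = k2 at *
  refine abs_le_of_sq_le_sq ?_ (by positivity)
  have h := cs_three (w * s00) (-(H * s01)) (-(H * s02)) (H * k0) k1 k2
  have e : (-2 * w * P * (w * s00 * k0 + s01 * k1 + s02 * k2)) ^ 2 = 4 * ((w * P ^ 2) *
      (w * s00 * (H * k0) - -(H * s01) * k1 - -(H * s02) * k2) ^ 2) := by
    rw [← F.HH]; ring
  rw [e]
  have hwP := F.wP
  have hw0 := F.w0
  have hw1 := F.w_le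
  have hr : (w * s00) ^ 2 + (-(H * s01)) ^ 2 + (-(H * s02)) ^ 2 ≤ 1 := by
    have := F.ps.sq_row; have := F.ps.tr; have := F.ps.d0; have := F.ps.g0
    rw [neg_sq, neg_sq]
    linarith
  have hk : (H * k0) ^ 2 + k1 ^ 2 + k2 ^ 2 ≤ ‖c‖ ^ 2 := by
    rw [mul_pow, F.HH, ← hn]
    have := mul_le_mul_of_nonneg_right F.w_le (sq_nonneg k0)
    linarith
  have hVV : w * P ^ 2 ≤ 1 := by linarith
  calc _ ≤ 4 * (1 * (1 * ‖c‖ ^ 2)) := by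
        gcongr
        exact h.trans (by gcongr)
    _ = _ := by ring

end

section

/-! ### Passing to points of moderate slope -/

open Matrix

variable {φ u w : E3 → ℝ}

/-- `u` is smooth and its image under the linearised operator at `x` is at most `a`. -/
structure Lc (φ : E3 → ℝ) (x : E3) (u : E3 → ℝ) (a : ℝ) : Prop where
  sm : Sm u
  le : LL b0 φ u x ≤ a

namespace Lc
variable {x : E3} {a c : ℝ}

theorem add (hu : Lc φ x u a) (hw : Lc φ x w c) : Lc φ x (fun y => u y + w y) (a + c) :=
  ⟨hu.sm.add hw.sm, by rw [LL_add hu.sm hw.sm]; exact add_le_add hu.le hw.le⟩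

theorem smul (hu : Lc φ x u a) (hc : 0 ≤ c) : Lc φ x (fun y => c * u y) (c * a) :=
  ⟨contDiff_const.mul hu.sm, by rw [LL_smul c hu.sm]; exact mul_le_mul_of_nonneg_left hu.le hc⟩

theorem mono (hu : Lc φ x u a) (h : a ≤ c) : Lc φ x u c := ⟨hu.sm, hu.le.trans h⟩

theorem sq (hu : Sm u) (h : 2 * u x * LL b0 φ u x + 2 * GG b0 φ u u x ≤ a) :
    Lc φ x (fun y => u y ^ 2) a :=
  ⟨hu.pow 2, by rw [LL_sq hu]; exact h⟩

theorem nonneg_of_min (hu : Lc φ x u a) (hφ : Sm φ) (hm : IsLocalMin u x) : 0 ≤ a :=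
  (LL_nonneg_of_min hφ hu.sm hm b0).trans hu.le

end Lc

theorem sm_sub_const (hu : Sm u) (c : ℝ) : Sm (fun y => u y - c) := ContDiff.sub hu contDiff_const

theorem LL_sub_const (hu : Sm u) (c : ℝ) (x : E3) :
    LL b0 φ (fun y => u y - c) x = LL b0 φ u x := by
  rw [LL_sub hu contDiff_const, LL_const, sub_zero]

theorem GG_sub_const (c : ℝ) (x : E3) :
    GG b0 φ (fun y => u y - c) (fun y => u y - c) x = GG b0 φ u u x := by
  have : gv b0 (fun y => u y - c) x = gv b0 u x := by
    funext i; simp only [gv, dd, fderiv_sub_const]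
  rw [GG, this]; rfl

theorem om_eq_exp (φ : E3 → ℝ) (x : E3) : om b0 φ x = exp (-lw φ x) ^ 2 := by
  have h := W2_pos b0 φ x
  rw [← exp_nat_mul, lw, om, ← exp_log (inv_pos.2 h), log_inv]
  congr 1
  push_cast; ring

theorem om_le_one (b : OB) (φ : E3 → ℝ) (x : E3) : om b φ x ≤ 1 := by
  have := gv_sq_nonneg b φ x
  exact inv_le_one_of_one_le₀ (by linarith)

theorem lw_nonneg (φ : E3 → ℝ) (x : E3) : 0 ≤ lw φ x := by
  have := gv_sq_nonneg b0 φ x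
  have := log_nonneg (by linarith : 1 ≤ 1 + gv b0 φ x ⬝ᵥ gv b0 φ x)
  unfold lw; positivity

theorem Tr.LL_lw' (hφ : Tr φ) (x : E3) :
    LL b0 φ (lw φ) x = om b0 φ x * (1 - vv b0 φ x) - GG b0 φ (lw φ) (lw φ) x := by
  obtain ⟨b, h1, h2⟩ := exists_adapted φ x
  rw [LL_indep b b0 hφ.sm (sm_lw hφ.sm), LL_lw hφ b x h1 h2, om_indep b b0, GG_indep b b0,
    vv_indep b b0 hφ.sm]

theorem Tr.LL_Hinv (hφ : Tr φ) (x : E3) :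
    LL b0 φ (fun y => exp (-1 * lw φ y)) x =
      exp (-1 * lw φ x) * (2 * GG b0 φ (lw φ) (lw φ) x - om b0 φ x * (1 - vv b0 φ x)) := by
  have s := sm_lw hφ.sm
  rw [LL_exp (u := fun y => -1 * lw φ y) (contDiff_const.mul s), LL_smul (-1) s, hφ.LL_lw']
  have : gv b0 (fun y => -1 * lw φ y) x = -gv b0 (lw φ) x := by
    funext i
    have := ((J.of s x (b0 i) (b0 i)).smul (-1)).fst
    simp only [gv, this, Pi.neg_apply]; ring
  have h2 : GG b0 φ (fun y => -1 * lw φ y) (fun y => -1 * lw φ y) x =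
      GG b0 φ (lw φ) (lw φ) x := by
    rw [GG, GG, this]
    simp only [dotProduct_neg, neg_dotProduct]; ring
  rw [h2]; ring

theorem sum_sq_b (b : OB) (z : E3) : ∑ i, inner ℝ (b i) z ^ 2 = ‖z‖ ^ 2 := by
  have := b.sum_sq_norm_inner_right z
  simpa using this

theorem abs_inner_b_le (b : OB) (i : Fin 3) (z : E3) : |inner ℝ (b i) z| ≤ ‖z‖ := by
  have := abs_real_inner_le_norm (b i) z
  simpa using this

theorem Tr.Lc_coord_sq (hφ : Tr φ) {e : E3} (he : ‖e‖ = 1) (c : ℝ) (x : E3) :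
    Lc φ x (fun y => (inner ℝ e y - c) ^ 2) (4 * |inner ℝ e x - c| + 2) := by
  refine Lc.sq (sm_sub_const (sm_inner e) c) ?_
  rw [LL_sub_const (sm_inner e), GG_sub_const (u := fun y => inner ℝ e y)]
  have h1 := hφ.LL_inner_le e x
  have h2 := hφ.GG_inner_le e x
  rw [he] at h1 h2
  have h3 : (inner ℝ e x - c) * LL b0 φ (fun y => inner ℝ e y) x ≤ |inner ℝ e x - c| * (2 * 1) := by
    refine (le_abs_self _).trans ?_
    rw [abs_mul]; gcongr
  linarith

theorem Tr.Lc_dist_sq (hφ : Tr φ) (x₀ x : E3) :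
    Lc φ x (fun y => ‖y - x₀‖ ^ 2) (12 * ‖x - x₀‖ + 6) := by
  have h := fun i => hφ.Lc_coord_sq (b0.norm_eq_one i) (inner ℝ (b0 i) x₀) x
  have := ((h 0).add (h 1)).add (h 2)
  have e : (fun y => ‖y - x₀‖ ^ 2) = fun y => (inner ℝ (b0 0) y - inner ℝ (b0 0) x₀) ^ 2 +
      (inner ℝ (b0 1) y - inner ℝ (b0 1) x₀) ^ 2 + (inner ℝ (b0 2) y - inner ℝ (b0 2) x₀) ^ 2 := by
    funext y
    rw [← sum_sq_b b0, Fin.sum_univ_three]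
    simp only [inner_sub_right]
  rw [e]
  refine this.mono ?_
  have k := fun i => abs_inner_b_le b0 i (x - x₀)
  have k0 := k 0; have k1 := k 1; have k2 := k 2
  simp only [inner_sub_right] at k0 k1 k2
  linarith

theorem scalar_moderate {τ ι ρ μ H v Y G N d : ℝ} (hτ : 0 < τ) (hτ1 : τ ≤ 1 / 40)
    (hμ : 1 ≤ τ * μ) (hμ0 : 0 < μ) (hι0 : 0 < ι) (hρ0 : 0 < ρ) (hρ2 : τ * ι * ρ = 100)
    (hρ1 : 1 ≤ ρ) (hHp : 0 < H) (hH2 : H ≤ 1 / 2) (hv0 : 0 ≤ v) (hY0 : 0 ≤ Y)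
    (hd : d < ρ) (hxo' : H ^ 2 ≤ 1 / 4) (hle : Y + μ * v ≤ 5 / 2 * τ)
    (hG : 1 - H ^ 2 - 2 * Y ≤ G)
    (hfin : 0 ≤ H ^ 2 * (2 * v + 4 * N) + μ * (-2 * N ^ 2) +
      τ * (ι * (H ^ 2 * (1 - v) - G) + -1 * (H * (2 * G - H ^ 2 * (1 - v)))) +
      (ρ ^ 2)⁻¹ * (12 * d + 6)) : False := by
  have hG1 : 5 / 8 ≤ G := by
    have := mul_nonneg hμ0.le hv0
    linarith
  have hf : H ^ 2 * (1 - v) ≤ 1 / 4 := by nlinarith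
  have k1 : ι * (H ^ 2 * (1 - v) - G) ≤ ι * (-3 / 8) := by gcongr; linarith
  have k2 : -1 * (H * (2 * G - H ^ 2 * (1 - v))) ≤ - H := by nlinarith
  have k3 : τ * (ι * (H ^ 2 * (1 - v) - G) + -1 * (H * (2 * G - H ^ 2 * (1 - v)))) ≤
      τ * (ι * (-3 / 8) - H) := by gcongr; linarith
  have k4 : (ρ ^ 2)⁻¹ * (12 * d + 6) ≤ τ * ι * (18 / 100) := by
    rw [inv_mul_le_iff₀ (by positivity)]
    have : ρ ^ 2 * (τ * ι * (18 / 100)) = 18 * ρ := by linear_combination (18 / 100 * ρ) * hρ2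
    rw [this]; linarith
  have k5 : H ^ 2 * (4 * N) ≤ 2 * μ * N ^ 2 + τ * H / 4 := by
    have a1 : 0 ≤ 2 * μ * (N - H ^ 2 / μ) ^ 2 := by positivity
    have a2 : 2 * μ * (N - H ^ 2 / μ) ^ 2 = 2 * μ * N ^ 2 - H ^ 2 * (4 * N) + 2 * H ^ 4 / μ := by
      have e : H ^ 2 / μ * μ = H ^ 2 := div_mul_cancel₀ _ hμ0.ne'
      have e2 : 2 * H ^ 4 / μ = 2 * (H ^ 2 / μ) * H ^ 2 := by ring
      rw [e2]
      linear_combination (-4 * N + 2 * (H ^ 2 / μ)) * e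
    have a3 : 2 * H ^ 4 / μ ≤ τ * H / 4 := by
      rw [div_le_iff₀ hμ0]
      have b1 : H ^ 3 ≤ (1 / 2) ^ 3 := by gcongr
      have b2 : 2 * H ^ 4 ≤ H / 4 := by
        have := mul_le_mul_of_nonneg_left b1 hHp.le
        linarith
      have b3 := mul_le_mul_of_nonneg_right hμ hHp.le
      linarith
    linarith
  have k6 : H ^ 2 * (2 * v) ≤ τ * H / 4 := by
    have b1 : v ≤ 5 / 2 * τ * τ := by
      have := mul_le_mul_of_nonneg_left hle hτ.le
      have := mul_le_mul_of_nonneg_right hμ hv0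
      have : 0 ≤ τ * Y := by positivity
      linarith
    have b2 : 5 / 2 * τ * τ ≤ 1 / 4 * τ := by gcongr; linarith
    have b3 : H * v ≤ 1 / 2 * (1 / 4 * τ) := by gcongr; linarith
    have := mul_le_mul_of_nonneg_left b3 hHp.le
    linarith
  have : 0 < τ * ι := by positivity
  have : 0 < τ * H := by positivity
  linarith

/-- An almost cylindrical point on a steep part of the graph propagates to a point of
moderate slope. -/
theorem Tr.exists_moderate (hφ : Tr φ) {τ μ : ℝ} (hτ : 0 < τ) (hτ1 : τ ≤ 1 / 40) (hμ : 1 ≤ τ * μ)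
    {x₀ : E3} (h0 : om b0 φ x₀ ≤ 1 / 4) (hx : YY b0 φ x₀ + μ * vv b0 φ x₀ ≤ τ) :
    ∃ x, om b0 φ x = 1 / 4 ∧ YY b0 φ x + μ * vv b0 φ x ≤ 3 * τ := by
  have hμ0 : 0 < μ := by
    by_contra h
    have := mul_nonpos_of_nonneg_of_nonpos hτ.le (not_lt.1 h)
    linarith
  have hl0 := lw_nonneg φ x₀
  obtain ⟨ι, hι⟩ : ∃ ι, (1 + lw φ x₀)⁻¹ = ι := ⟨_, rfl⟩
  have hι0 : 0 < ι := by rw [← hι]; positivity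
  have hι1 : ι * lw φ x₀ ≤ 1 := by
    rw [← hι, inv_mul_le_iff₀ (by positivity)]; linarith
  have hι2 : ι ≤ 1 := by rw [← hι]; exact inv_le_one_of_one_le₀ (by linarith)
  obtain ⟨ρ, hρ⟩ : ∃ ρ, 100 / (τ * ι) = ρ := ⟨_, rfl⟩
  have hρ0 : 0 < ρ := by rw [← hρ]; positivity
  have hρ2 : τ * ι * ρ = 100 := by rw [← hρ]; field_simp
  have hτι : τ * ι ≤ 1 := by nlinarith
  have hρ1 : 1 ≤ ρ := by nlinarith
  let Ψ : E3 → ℝ := fun y => YY b0 φ y + μ * vv b0 φ y + τ * (ι * lw φ y + -exp (-1 * lw φ y))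
    + (ρ ^ 2)⁻¹ * ‖y - x₀‖ ^ 2
  have sH : Sm (fun y => exp (-1 * lw φ y)) := (contDiff_const.mul (sm_lw hφ.sm)).exp
  have cY := (sm_YY hφ b0).continuous
  have cv := (sm_vv hφ b0).continuous
  have cl := (sm_lw hφ.sm).continuous
  have co := (sm_om hφ.sm b0).continuous
  have hcont : Continuous Ψ := by
    have := sH.continuous
    fun_prop
  have hK : IsCompact (Metric.closedBall x₀ ρ ∩ {y | om b0 φ y ≤ 1 / 4}) :=
    (isCompact_closedBall x₀ ρ).inter_right (isClosed_le co continuous_const)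
  obtain ⟨x, ⟨hxb, hxo⟩, hmin⟩ := hK.exists_isMinOn ⟨x₀, by simp [hρ0.le], h0⟩ hcont.continuousOn
  have hx0 : Ψ x ≤ Ψ x₀ := hmin ⟨by simp [hρ0.le], h0⟩
  have hΨ0 : Ψ x₀ ≤ 2 * τ := by
    have := exp_pos (-1 * lw φ x₀)
    simp only [Ψ, sub_self, norm_zero]
    nlinarith
  obtain ⟨hv0, hv1, hY0, -, -, hG, -, -⟩ := hφ.point x
  have hoe := om_eq_exp φ x
  have hne : -lw φ x = -1 * lw φ x := by ring
  rw [hne] at hoe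
  have hHp := exp_pos (-1 * lw φ x)
  have hlx := lw_nonneg φ x
  have hΨx : Ψ x = YY b0 φ x + μ * vv b0 φ x + τ * (ι * lw φ x + -exp (-1 * lw φ x))
    + (ρ ^ 2)⁻¹ * ‖x - x₀‖ ^ 2 := rfl
  obtain ⟨H, hH⟩ : ∃ H, exp (-1 * lw φ x) = H := ⟨_, rfl⟩
  have hLH := hφ.LL_Hinv x
  rw [hH] at hΨx hoe hHp hLH
  have hxo' : H ^ 2 ≤ 1 / 4 := by rw [← hoe]; exact hxo
  have hH2 : H ≤ 1 / 2 := by nlinarith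
  have hd0 : 0 ≤ (ρ ^ 2)⁻¹ * ‖x - x₀‖ ^ 2 := by positivity
  have hl1 : 0 ≤ τ * (ι * lw φ x) := by positivity
  have hτH := mul_le_mul_of_nonneg_left hH2 hτ.le
  have hle : YY b0 φ x + μ * vv b0 φ x ≤ 5 / 2 * τ := by linarith
  rcases (show om b0 φ x ≤ 1 / 4 from hxo).lt_or_eq with hlt | heq
  swap
  · exact ⟨x, heq, by linarith⟩
  exfalso
  have hμv : 0 ≤ μ * vv b0 φ x := by positivity
  have hdist : ‖x - x₀‖ < ρ := by
    rw [Metric.mem_closedBall, dist_eq_norm] at hxb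
    refine lt_of_le_of_ne hxb fun he => ?_
    rw [he, inv_mul_cancel₀ (by positivity)] at hΨx
    linarith
  have hloc : IsLocalMin Ψ x := by
    refine IsMinOn.isLocalMin hmin (Filter.inter_mem ?_ ?_)
    · exact Metric.closedBall_mem_nhds_of_mem (by rwa [Metric.mem_ball, dist_eq_norm])
    · exact Filter.mem_of_superset ((isOpen_lt co continuous_const).mem_nhds hlt)
        fun y (hy : om b0 φ y < 1 / 4) => (show om b0 φ y ≤ 1 / 4 from hy.le)
  obtain ⟨N, hN0, hLv, hLY, -⟩ := hφ.evol x
  have L1 : Lc φ x (YY b0 φ) _ := ⟨sm_YY hφ b0, hLY⟩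
  have L2 : Lc φ x (fun y => μ * vv b0 φ y) _ := Lc.smul ⟨sm_vv hφ b0, hLv.le⟩ hμ0.le
  have L3 : Lc φ x (fun y => ι * lw φ y) _ := Lc.smul ⟨sm_lw hφ.sm, (hφ.LL_lw' x).le⟩ hι0.le
  have L4 : Lc φ x (fun y => -exp (-1 * lw φ y)) _ := ⟨sH.neg, by
    have : (fun y => -exp (-1 * lw φ y)) = fun y => -1 * exp (-1 * lw φ y) := by
      funext y; ring
    rw [this, LL_smul (-1) sH, hLH]⟩
  have L5 := (hφ.Lc_dist_sq x₀ x).smul (c := (ρ ^ 2)⁻¹) (by positivity)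
  have hfin := ((((L1.add L2).add ((L3.add L4).smul hτ.le))).add L5).nonneg_of_min hφ.sm hloc
  rw [hoe] at hfin hG
  exact scalar_moderate hτ hτ1 hμ hμ0 hι0 hρ0 hρ2 hρ1 hHp hH2 hv0 hY0 hdist hxo' hle (by linarith)
    hfin

end

section

/-! ### Nearly cylindrical points -/

open Matrix

theorem exists_delta_of_compact {X : Type*} [TopologicalSpace X] {C : Set X} (hC : IsCompact C)
    {f g : X → ℝ} (hf : Continuous f) (hg : Continuous g) {η : ℝ}
    (h : ∀ x ∈ C, g x ≤ 0 → f x < η) : ∃ δ > 0, ∀ x ∈ C, g x < δ → f x < η := by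
  have hK : IsCompact (C ∩ {x | η ≤ f x}) := hC.inter_right (isClosed_le continuous_const hf)
  rcases (C ∩ {x | η ≤ f x}).eq_empty_or_nonempty with he | hne
  · refine ⟨1, one_pos, fun x hx _ => ?_⟩
    by_contra hlt
    have : x ∈ C ∩ {x | η ≤ f x} := ⟨hx, not_lt.1 hlt⟩
    rw [he] at this
    exact this
  · obtain ⟨x₀, hx₀, hmin⟩ := hK.exists_isMinOn hne hg.continuousOn
    refine ⟨g x₀, ?_, fun x hx hgx => ?_⟩
    · by_contra hle
      exact absurd (h x₀ hx₀.1 (not_lt.1 hle)) (not_lt.2 hx₀.2)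
    · by_contra hlt
      exact absurd (hmin ⟨hx, not_lt.1 hlt⟩ : g x₀ ≤ g x) (not_le.2 hgx)

/-- Algebraic estimates for nearly cylindrical second order data. -/
theorem grim_vec (M : ℝ) {η : ℝ} (hη : 0 < η) : ∃ δ > 0, ∀ X : Fin 9 → ℝ, (∀ i, |X i| ≤ M) →
    |X 1| ≤ δ → |X 2| ≤ δ → |X 4| ≤ δ → |X 5| ≤ δ → |X 6| ≤ δ → |X 7| ≤ δ → |X 8| ≤ δ →
    (1 + X 0 ^ 2 + X 1 ^ 2 + X 2 ^ 2) * (X 3 + X 6 + X 8 - 1) =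
      X 0 * (X 0 * X 3 + X 1 * X 4 + X 2 * X 5) + X 1 * (X 0 * X 4 + X 1 * X 6 + X 2 * X 7) +
        X 2 * (X 0 * X 5 + X 1 * X 7 + X 2 * X 8) →
    |-2 * (1 + X 0 ^ 2 + X 1 ^ 2 + X 2 ^ 2)⁻¹ *
      (X 0 * X 4 + X 1 * X 6 + X 2 * X 7 - (X 3 + X 6 + X 8 - 1) * X 1)| +
    |-2 * (1 + X 0 ^ 2 + X 1 ^ 2 + X 2 ^ 2)⁻¹ *
      (X 0 * X 5 + X 1 * X 7 + X 2 * X 8 - (X 3 + X 6 + X 8 - 1) * X 2)| +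
    |-2 * (1 + X 0 ^ 2 + X 1 ^ 2 + X 2 ^ 2)⁻¹ *
      (X 0 * X 3 + X 1 * X 4 + X 2 * X 5 - (X 3 + X 6 + X 8 - 1) * X 0) +
      2 * X 0 / (1 + X 0 ^ 2) ^ 2 * (X 3 ^ 2 + X 4 ^ 2 + X 5 ^ 2 -
      (1 + X 0 ^ 2 + X 1 ^ 2 + X 2 ^ 2)⁻¹ * (X 0 * X 3 + X 1 * X 4 + X 2 * X 5) ^ 2)| +
    ((1 - (1 + X 0 ^ 2)⁻¹ * X 3) ^ 2 + ((1 + X 0 ^ 2)⁻¹ * X 4) ^ 2 +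
      ((1 + X 0 ^ 2)⁻¹ * X 5) ^ 2) < η ∧
    1 / 2 < X 3 ^ 2 + X 4 ^ 2 + X 5 ^ 2 -
      (1 + X 0 ^ 2 + X 1 ^ 2 + X 2 ^ 2)⁻¹ * (X 0 * X 3 + X 1 * X 4 + X 2 * X 5) ^ 2 := by
  let w : (Fin 9 → ℝ) → ℝ := fun X => (1 + X 0 ^ 2 + X 1 ^ 2 + X 2 ^ 2)⁻¹
  let f : (Fin 9 → ℝ) → ℝ := fun X =>
    |-2 * w X * (X 0 * X 4 + X 1 * X 6 + X 2 * X 7 - (X 3 + X 6 + X 8 - 1) * X 1)| +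
    |-2 * w X * (X 0 * X 5 + X 1 * X 7 + X 2 * X 8 - (X 3 + X 6 + X 8 - 1) * X 2)| +
    |-2 * w X * (X 0 * X 3 + X 1 * X 4 + X 2 * X 5 - (X 3 + X 6 + X 8 - 1) * X 0) +
      2 * X 0 / (1 + X 0 ^ 2) ^ 2 *
      (X 3 ^ 2 + X 4 ^ 2 + X 5 ^ 2 - w X * (X 0 * X 3 + X 1 * X 4 + X 2 * X 5) ^ 2)| +
    ((1 - (1 + X 0 ^ 2)⁻¹ * X 3) ^ 2 + ((1 + X 0 ^ 2)⁻¹ * X 4) ^ 2 + ((1 + X 0 ^ 2)⁻¹ * X 5) ^ 2)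
  let f₂ : (Fin 9 → ℝ) → ℝ := fun X =>
    -(X 3 ^ 2 + X 4 ^ 2 + X 5 ^ 2 - w X * (X 0 * X 3 + X 1 * X 4 + X 2 * X 5) ^ 2)
  let g : (Fin 9 → ℝ) → ℝ := fun X => |X 1| + |X 2| + |X 4| + |X 5| + |X 6| + |X 7| + |X 8|
  let C : Set (Fin 9 → ℝ) := Metric.closedBall 0 (max M 1) ∩
    {X | (1 + X 0 ^ 2 + X 1 ^ 2 + X 2 ^ 2) * (X 3 + X 6 + X 8 - 1) =
      X 0 * (X 0 * X 3 + X 1 * X 4 + X 2 * X 5) + X 1 * (X 0 * X 4 + X 1 * X 6 + X 2 * X 7) +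
        X 2 * (X 0 * X 5 + X 1 * X 7 + X 2 * X 8)}
  have hw : Continuous w := by
    refine Continuous.inv₀ (by fun_prop) fun X => ?_
    positivity
  have hi : Continuous fun X : Fin 9 → ℝ => (1 + X 0 ^ 2)⁻¹ := by
    refine Continuous.inv₀ (by fun_prop) fun X => ?_
    positivity
  have hd : Continuous fun X : Fin 9 → ℝ => 2 * X 0 / (1 + X 0 ^ 2) ^ 2 := by
    refine Continuous.div (by fun_prop) (by fun_prop) fun X => ?_
    positivity
  have hf : Continuous f := by fun_prop
  have hf₂ : Continuous f₂ := by fun_prop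
  have hg : Continuous g := by fun_prop
  have hC : IsCompact C := (isCompact_closedBall _ _).inter_right
    (isClosed_eq (by fun_prop) (by fun_prop))
  have key : ∀ X ∈ C, g X ≤ 0 → X 1 = 0 ∧ X 2 = 0 ∧ X 4 = 0 ∧ X 5 = 0 ∧ X 6 = 0 ∧ X 7 = 0 ∧
      X 8 = 0 ∧ X 3 = 1 + X 0 ^ 2 := by
    rintro X ⟨-, hX⟩ hgX
    have h1 := abs_nonneg (X 1); have h2 := abs_nonneg (X 2); have h4 := abs_nonneg (X 4)
    have h5 := abs_nonneg (X 5); have h6 := abs_nonneg (X 6); have h7 := abs_nonneg (X 7)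
    have h8 := abs_nonneg (X 8)
    have k : ∀ i, |X i| ≤ 0 → X i = 0 := fun i h => abs_nonpos_iff.1 h
    simp only [g] at hgX
    have e1 := k 1 (by linarith); have e2 := k 2 (by linarith); have e4 := k 4 (by linarith)
    have e5 := k 5 (by linarith); have e6 := k 6 (by linarith); have e7 := k 7 (by linarith)
    have e8 := k 8 (by linarith)
    refine ⟨e1, e2, e4, e5, e6, e7, e8, ?_⟩
    simp only [Set.mem_ofPred_eq, e1, e2, e4, e5, e6, e7, e8] at hX
    linear_combination hX
  obtain ⟨δ, hδ, H⟩ := exists_delta_of_compact hC (η := η) hf hg fun X hX hgX => by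
    obtain ⟨e1, e2, e4, e5, e6, e7, e8, e3⟩ := key X hX hgX
    have hp : (0:ℝ) < 1 + X 0 ^ 2 := by positivity
    have : f X = 0 := by
      simp only [f, w, e1, e2, e4, e5, e6, e7, e8, e3]
      have : -(2 * (1 + X 0 ^ 2)⁻¹ * (X 0 * (1 + X 0 ^ 2) - X 0 ^ 2 * X 0)) +
          2 * X 0 / (1 + X 0 ^ 2) ^ 2 *
          ((1 + X 0 ^ 2) ^ 2 - (1 + X 0 ^ 2)⁻¹ * (X 0 * (1 + X 0 ^ 2)) ^ 2) = 0 := by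
        field_simp; ring
      simp [this, inv_mul_cancel₀ hp.ne']
    rw [this]; exact hη
  obtain ⟨δ₂, hδ₂, H₂⟩ := exists_delta_of_compact hC (η := -1 / 2) hf₂ hg fun X hX hgX => by
    obtain ⟨e1, e2, e4, e5, e6, e7, e8, e3⟩ := key X hX hgX
    have hp : (0:ℝ) < 1 + X 0 ^ 2 := by positivity
    have : f₂ X = -(1 + X 0 ^ 2) := by
      simp only [f₂, w, e1, e2, e4, e5, e3]
      field_simp; ring
    rw [this]
    have := sq_nonneg (X 0)
    linarith
  refine ⟨min δ δ₂ / 8, by positivity, ?_⟩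
  intro X hM h1 h2 h4 h5 h6 h7 h8 hpde
  have hX : X ∈ C := by
    refine ⟨?_, hpde⟩
    rw [mem_closedBall_zero_iff, pi_norm_le_iff_of_nonneg (by positivity)]
    exact fun i => (hM i).trans (le_max_left _ _)
  have hgX : g X < min δ δ₂ := by
    have : 0 < min δ δ₂ := by positivity
    simp only [g]
    linarith
  refine ⟨H _ hX (hgX.trans_le (min_le_left _ _)), ?_⟩
  have := H₂ _ hX (hgX.trans_le (min_le_right _ _))
  simp only [f₂, w] at this
  linarith

theorem Tr.LL_inner_basis (hφ : Tr φ) (b : OB) (x : E3) (k : Fin 3) :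
    LL b φ (fun y => inner ℝ (b k) y) x = -2 * om b φ x *
      (∑ i, dd (b i) φ x * dd (b i) (dd (b k) φ) x -
        (∑ i, dd (b i) (dd (b i) φ) x - 1) * dd (b k) φ x) := by
  have h := hφ.pde b x
  have hW := W2_pos b φ x
  have e : om b φ x * (gv b φ x ⬝ᵥ hm b φ x *ᵥ gv b φ x) = (hm b φ x).trace - 1 := by
    rw [om, ← h, inv_mul_cancel_left₀ hW.ne']
  have g : gv b (fun y => inner ℝ (b k) y) x = Pi.single k 1 := by
    funext i
    simp only [gv, dd_inner, OB_inner, Pi.single_apply, eq_comm]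
  have z : hm b (fun y => inner ℝ (b k) y) x = 0 := by
    ext i j
    simp only [hm, dd_inner, dd_const, Matrix.zero_apply]
  rw [LL, e, g, z]
  have s1 : gv b φ x ⬝ᵥ Pi.single k 1 = dd (b k) φ x := dotProduct_single_one _ _
  rw [s1]
  simp [Matrix.trace, gv, hm, dotProduct]

theorem sm_arctan (hu : Sm u) : Sm (fun y => arctan (u y)) := contDiff_arctan.comp hu

theorem GG_le (b : OB) (u : E3 → ℝ) (x : E3) :
    GG b φ u u x ≤ dd (b 0) u x ^ 2 + dd (b 1) u x ^ 2 + dd (b 2) u x ^ 2 := by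
  have h := W2_pos b φ x
  have : 0 ≤ om b φ x * (gv b φ x ⬝ᵥ gv b u x) * (gv b φ x ⬝ᵥ gv b u x) := by
    rw [mul_assoc]
    exact mul_nonneg (inv_nonneg.2 h.le) (mul_self_nonneg _)
  rw [GG]
  simp only [gv, dotProduct, Fin.sum_univ_three] at this ⊢
  linarith

theorem abs_le_of_sq_le_mul {a c d δ M : ℝ} (hδ : 0 ≤ δ) (hM : 0 < M) (h : a ^ 2 ≤ c * d)
    (hc : c ≤ M) (hd0 : 0 ≤ d) (hd : d ≤ δ ^ 2 / M) : |a| ≤ δ := by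
  refine abs_le_of_sq_le_sq ?_ hδ
  calc a ^ 2 ≤ c * d := h
    _ ≤ M * (δ ^ 2 / M) := by gcongr
    _ = δ ^ 2 := by field_simp

/-- Where the Hessian is nearly of rank one and the gradient nearly points in its direction,
the graph is close to a grim reaper cylinder. -/
theorem exists_grim (Λ : ℝ) {η : ℝ} (hη : 0 < η) : ∃ δ > 0, ∀ φ, Tr φ → ∀ (b : OB) (x : E3),
    |dd (b 0) φ x| ≤ Λ → |dd (b 1) φ x| ≤ δ → |dd (b 2) φ x| ≤ δ →
    dd (b 1) (dd (b 1) φ) x ≤ δ → dd (b 2) (dd (b 2) φ) x ≤ δ →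
    |LL b0 φ (fun y => inner ℝ (b 1) y) x| + |LL b0 φ (fun y => inner ℝ (b 2) y) x| +
      |LL b0 φ (fun y => inner ℝ (b 0) y - arctan (dd (b 0) φ y)) x| +
      GG b0 φ (fun y => inner ℝ (b 0) y - arctan (dd (b 0) φ y))
        (fun y => inner ℝ (b 0) y - arctan (dd (b 0) φ y)) x < η ∧
    1 / 2 < GG b0 φ (dd (b 0) φ) (dd (b 0) φ) x := by
  obtain ⟨δ, hδ, H⟩ := grim_vec (1 + |Λ| + Λ ^ 2) hη
  have hM : 0 < 1 + |Λ| + Λ ^ 2 := by positivity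
  refine ⟨min (min δ 1) ((min δ 1) ^ 2 / (1 + |Λ| + Λ ^ 2)), by positivity, ?_⟩
  intro φ hφ b x h0 h1 h2 h11 h22
  have m0 : 0 < min δ 1 := by positivity
  have n1 := hφ.hess_nonneg (b 1) x
  have n2 := hφ.hess_nonneg (b 2) x
  have h0' := hφ.hess_le (b 0) x
  rw [b.norm_eq_one, one_pow] at h0'
  have hΛ : dd (b 0) φ x ^ 2 ≤ Λ ^ 2 := sq_le_sq' (by linarith [neg_abs_le (dd (b 0) φ x)])
    ((le_abs_self _).trans h0)
  have hΛ' : Λ ≤ |Λ| := le_abs_self _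
  have hΛ0 := abs_nonneg Λ
  have k11 := h11.trans (min_le_right _ _)
  have k22 := h22.trans (min_le_right _ _)
  have a11 : |dd (b 1) (dd (b 1) φ) x| ≤ min δ 1 := by
    rw [abs_of_nonneg n1]; exact h11.trans (min_le_left _ _)
  have a22 : |dd (b 2) (dd (b 2) φ) x| ≤ min δ 1 := by
    rw [abs_of_nonneg n2]; exact h22.trans (min_le_left _ _)
  have a01 : |dd (b 0) (dd (b 1) φ) x| ≤ min δ 1 :=
    abs_le_of_sq_le_mul m0.le hM (hφ.hess_cs _ _ x) (by linarith) n1 k11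
  have a02 : |dd (b 0) (dd (b 2) φ) x| ≤ min δ 1 :=
    abs_le_of_sq_le_mul m0.le hM (hφ.hess_cs _ _ x) (by linarith) n2 k22
  have a12 : |dd (b 1) (dd (b 2) φ) x| ≤ min δ 1 := by
    refine abs_le_of_sq_le_mul m0.le hM (hφ.hess_cs _ _ x) ?_ n2 k22
    have := (abs_le.1 a11).2.trans (min_le_right _ _)
    linarith [sq_nonneg Λ]
  have a1 := h1.trans (min_le_left _ _)
  have a2 := h2.trans (min_le_left _ _)
  have a00 : |dd (b 0) (dd (b 0) φ) x| ≤ 1 + |Λ| + Λ ^ 2 := by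
    rw [abs_of_nonneg (hφ.hess_nonneg _ _)]; linarith
  have hδ' := min_le_left δ 1
  have h1' : min δ 1 ≤ 1 + |Λ| + Λ ^ 2 := by linarith [min_le_right δ 1, sq_nonneg Λ]
  have hp := hφ.pde b x
  obtain ⟨s1, s2, s3⟩ := sort2 hφ.sm b
  have := H ![dd (b 0) φ x, dd (b 1) φ x, dd (b 2) φ x, dd (b 0) (dd (b 0) φ) x,
    dd (b 0) (dd (b 1) φ) x, dd (b 0) (dd (b 2) φ) x, dd (b 1) (dd (b 1) φ) x,
    dd (b 1) (dd (b 2) φ) x, dd (b 2) (dd (b 2) φ) x] (by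
      intro i
      fin_cases i
      exacts [h0.trans (by linarith [sq_nonneg Λ]), a1.trans h1', a2.trans h1', a00, a01.trans h1',
        a02.trans h1', a11.trans h1', a12.trans h1', a22.trans h1'])
    (a1.trans hδ') (a2.trans hδ') (a01.trans hδ') (a02.trans hδ') (a11.trans hδ') (a12.trans hδ')
    (a22.trans hδ') (by
      simp only [Matrix.trace, Matrix.diag, gv, hm, dotProduct, Matrix.mulVec,
        Fin.sum_univ_three, s1, s2, s3] at hp
      simp [-mul_eq_mul_left_iff]
      linear_combination hp)
  simp only [Matrix.cons_val] at this
  have hom : (1 + dd (b 0) φ x ^ 2 + dd (b 1) φ x ^ 2 + dd (b 2) φ x ^ 2)⁻¹ = om b φ x := by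
    rw [om]
    simp only [gv, dotProduct, Fin.sum_univ_three]
    congr 1; ring
  have sA := sm_arctan (hφ.sm.dd (b 0))
  have hGG : GG b φ (dd (b 0) φ) (dd (b 0) φ) x = dd (b 0) (dd (b 0) φ) x ^ 2 +
      dd (b 0) (dd (b 1) φ) x ^ 2 + dd (b 0) (dd (b 2) φ) x ^ 2 - om b φ x *
      (dd (b 0) φ x * dd (b 0) (dd (b 0) φ) x + dd (b 1) φ x * dd (b 0) (dd (b 1) φ) x +
        dd (b 2) φ x * dd (b 0) (dd (b 2) φ) x) ^ 2 := by
    simp only [GG, gv, dotProduct, Fin.sum_univ_three, s1, s2]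
    ring
  rw [hom, ← hGG] at this
  rw [GG_indep b b0, LL_indep b b0 hφ.sm (sm_inner _), LL_indep b b0 hφ.sm (sm_inner _),
    LL_indep b b0 hφ.sm ((sm_inner _).sub sA), LL_sub (sm_inner _) sA, LL_arctan (hφ.sm.dd _),
    LL_dd hφ, hφ.LL_inner_basis, hφ.LL_inner_basis, hφ.LL_inner_basis]
  refine ⟨lt_of_le_of_lt ?_ this.1, by rw [GG_indep b b0]; exact this.2⟩
  simp only [Fin.sum_univ_three, s1, s2, s3]
  have hg := GG_le (φ := φ) b (fun y => inner ℝ (b 0) y - arctan (dd (b 0) φ y)) x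
  have d : ∀ i, dd (b i) (fun y => inner ℝ (b 0) y - arctan (dd (b 0) φ y)) x =
      inner ℝ (b 0) (b i) - (1 + dd (b 0) φ x ^ 2)⁻¹ * dd (b i) (dd (b 0) φ) x := fun i =>
    ((J.inner x (b i) (b i) (b 0)).sub (J.of (hφ.sm.dd (b 0)) x (b i) (b i)).arctan).fst
  have o0 : inner ℝ (b 0) (b 0) = (1 : ℝ) := by simp
  have o1 : inner ℝ (b 0) (b 1) = (0 : ℝ) := by simp [OB_inner]
  have o2 : inner ℝ (b 0) (b 2) = (0 : ℝ) := by simp [OB_inner]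
  simp only [d, o0, o1, o2, s1, s2, zero_sub, neg_sq] at hg
  refine add_le_add (add_le_add (add_le_add (le_of_eq ?_) (le_of_eq ?_)) (le_of_eq ?_)) ?_
  · congr 1
  · congr 1
  · congr 1; ring
  · exact hg

end

section

/-! ### Steep ends of nearly cylindrical points -/

open Matrix

variable {φ u w : E3 → ℝ}

theorem scalar_end {i Λ μ ν N M v n w S11 S22 z1 z2 β1 β2 ζ Lζ Gζ G : ℝ} (hi : 0 < i)
    (hiΛ : i * Λ ≤ 1) (hμ0 : 0 < μ) (hν0 : 0 < ν) (hN : 0 < N) (hM : 0 < M)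
    (hμ : 25 * (90 * ν + 32 * ν ^ 2) ≤ i * μ) (hν : 150 * N * M ≤ i * ν)
    (hv : μ * v ≤ 3 / 2) (hT : ν * (w * S11 + w * S22) ≤ 3 / 2) (hw : 1 ≤ w * M)
    (h11 : 0 ≤ S11) (h22 : 0 ≤ S22) (hz1 : |z1| ≤ 10 * Λ) (hz2 : |z2| ≤ 10 * Λ) (hζ : |ζ| ≤ 2)
    (hGζ : 0 ≤ Gζ) (hη : |β1| + |β2| + |Lζ| + Gζ < i / 100) (hG : 1 / 2 < G)
    (hfin : 0 ≤ μ * (-2 * n ^ 2) + ν * ((30 * v + 8 * n) + (30 * v + 8 * n)) +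
      N * (2 * S11 + 2 * S22) + i / 50 * ((2 * z1 * β1 + 2) + (2 * z2 * β2 + 2)) +
      (2 * ζ * Lζ + 2 * Gζ) + i / 4 * (-(2 * G))) : False := by
  have a1 : μ * (-2 * n ^ 2) + ν * ((30 * v + 8 * n) + (30 * v + 8 * n)) ≤ i / 25 := by
    obtain ⟨A, hA⟩ : ∃ A, ν / μ = A := ⟨_, rfl⟩
    have hA0 : 0 < A := by rw [← hA]; positivity
    have hAμ : A * μ = ν := by rw [← hA]; exact div_mul_cancel₀ _ hμ0.ne'
    have h1 : 25 * (90 * A + 32 * A * ν) ≤ i := by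
      have : 25 * (90 * A + 32 * A * ν) * μ ≤ i * μ := by
        rw [show 25 * (90 * A + 32 * A * ν) * μ = 25 * (90 * (A * μ) + 32 * (A * μ) * ν) by ring,
          hAμ]
        linarith
      exact le_of_mul_le_mul_right this hμ0
    have h2 : 0 ≤ 2 * μ * (n - 4 * A) ^ 2 := by positivity
    have h3 : A * (μ * v) ≤ A * (3 / 2) := by gcongr
    have e : μ * (-2 * n ^ 2) + ν * ((30 * v + 8 * n) + (30 * v + 8 * n)) =
      -(2 * μ * (n - 4 * A) ^ 2) + 60 * (A * (μ * v)) + 32 * A * ν := by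
      rw [← hAμ]; ring
    rw [e]; linarith
  have a2 : N * (2 * S11 + 2 * S22) ≤ i / 50 := by
    have h1 : ν * (S11 + S22) ≤ 3 / 2 * M := by
      have := mul_le_mul_of_nonneg_right hT hM.le
      have h2 := mul_le_mul_of_nonneg_left hw (show 0 ≤ ν * (S11 + S22) by positivity)
      linarith
    have h2 : N * (2 * S11 + 2 * S22) * ν ≤ i / 50 * ν := by
      have := mul_le_mul_of_nonneg_left h1 hN.le
      linarith
    exact le_of_mul_le_mul_right h2 hν0
  have a3 : ∀ z β : ℝ, |z| ≤ 10 * Λ → i / 50 * (2 * z * β) ≤ |β| := by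
    intro z β hz
    have h1 : z * β ≤ 10 * Λ * |β| :=
      (le_abs_self _).trans (by rw [abs_mul]; gcongr)
    have h2 := mul_le_mul_of_nonneg_left h1 hi.le
    have h3 := mul_le_mul_of_nonneg_right hiΛ (abs_nonneg β)
    have := abs_nonneg β
    linarith
  have b1 := a3 z1 β1 hz1
  have b2 := a3 z2 β2 hz2
  have a4 : ζ * Lζ ≤ 2 * |Lζ| := (le_abs_self _).trans (by rw [abs_mul]; gcongr)
  have a5 : i * (1 / 2) < i * G := by gcongr
  have := abs_nonneg β1; have := abs_nonneg β2; have := abs_nonneg Lζ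
  linarith

theorem Tr.end_step (hφ : Tr φ) (b : OB) (x : E3) {μ ν N i t a₁ a₂ z₁ z₂ ζ₀ : ℝ} (hμ : 0 ≤ μ)
    (hν : 0 ≤ ν) (hN : 0 ≤ N) (hi : 0 ≤ i) {ζ : E3 → ℝ} (hζ : Sm ζ)
    (hloc : IsLocalMin (fun y => μ * _root_.vv b0 φ y + ν * (_root_.om b0 φ y * dd (b 1) (dd (b 1) φ) y +
        _root_.om b0 φ y * dd (b 2) (dd (b 2) φ) y) +
      N * ((dd (b 1) φ y - a₁) ^ 2 + (dd (b 2) φ y - a₂) ^ 2) +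
      i / 50 * ((inner ℝ (b 1) y - z₁) ^ 2 + (inner ℝ (b 2) y - z₂) ^ 2) +
      (ζ y - ζ₀) ^ 2 + t * dd (b 0) φ y + i / 4 * (-(dd (b 0) φ y) ^ 2)) x) :
    ∃ n, 0 ≤ μ * (-2 * n ^ 2) + ν * ((30 * _root_.vv b0 φ x + 8 * n) +
        (30 * _root_.vv b0 φ x + 8 * n)) +
      N * (2 * dd (b 1) (dd (b 1) φ) x + 2 * dd (b 2) (dd (b 2) φ) x) +
      i / 50 * ((2 * (inner ℝ (b 1) x - z₁) * LL b0 φ (fun y => inner ℝ (b 1) y) x + 2) +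
        (2 * (inner ℝ (b 2) x - z₂) * LL b0 φ (fun y => inner ℝ (b 2) y) x + 2)) +
      (2 * (ζ x - ζ₀) * LL b0 φ ζ x + 2 * GG b0 φ ζ ζ x) +
      i / 4 * (-(2 * GG b0 φ (dd (b 0) φ) (dd (b 0) φ) x)) := by
  obtain ⟨n, hn0, hv, -, hT⟩ := hφ.evol x
  refine ⟨n, ?_⟩
  have sT := fun k => (sm_om hφ.sm b0).mul ((hφ.sm.dd (b k)).dd (b k))
  have T1 : Lc φ x _ _ := ⟨sT 1, hT (b 1) (b.norm_eq_one 1)⟩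
  have T2 : Lc φ x _ _ := ⟨sT 2, hT (b 2) (b.norm_eq_one 2)⟩
  have V : Lc φ x _ _ := ⟨sm_vv hφ b0, hv.le⟩
  have Pk : ∀ k a, Lc φ x (fun y => (dd (b k) φ y - a) ^ 2) (2 * dd (b k) (dd (b k) φ) x) := by
    intro k a
    refine Lc.sq (sm_sub_const (hφ.sm.dd _) a) ?_
    rw [LL_sub_const (hφ.sm.dd _), GG_sub_const, LL_dd hφ]
    linarith [hφ.GG_dd_le (b k) x]
  have Zk : ∀ k z, Lc φ x (fun y => (inner ℝ (b k) y - z) ^ 2)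
      (2 * (inner ℝ (b k) x - z) * LL b0 φ (fun y => inner ℝ (b k) y) x + 2) := by
    intro k z
    refine Lc.sq (sm_sub_const (sm_inner _) z) ?_
    rw [LL_sub_const (sm_inner _), GG_sub_const (u := fun y => inner ℝ (b k) y)]
    have := hφ.GG_inner_le (b k) x
    rw [b.norm_eq_one] at this
    linarith
  have Z : Lc φ x (fun y => (ζ y - ζ₀) ^ 2) (2 * (ζ x - ζ₀) * LL b0 φ ζ x + 2 * GG b0 φ ζ ζ x) := by
    refine Lc.sq (sm_sub_const hζ ζ₀) ?_
    rw [LL_sub_const hζ, GG_sub_const]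
  have L : Lc φ x (fun y => t * dd (b 0) φ y) 0 :=
    ⟨contDiff_const.mul (hφ.sm.dd _), by rw [LL_smul t (hφ.sm.dd _), LL_dd hφ, mul_zero]⟩
  have Q : Lc φ x (fun y => -(dd (b 0) φ y) ^ 2)
      (-(2 * GG b0 φ (dd (b 0) φ) (dd (b 0) φ) x)) := by
    have s2 : Sm (fun y => (dd (b 0) φ y) ^ 2) := (hφ.sm.dd _).pow 2
    refine ⟨s2.neg, ?_⟩
    have e : (fun y => -(dd (b 0) φ y) ^ 2) = fun y => -1 * (dd (b 0) φ y) ^ 2 := by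
      funext y; ring
    rw [e, LL_smul (-1) s2, LL_sq (hφ.sm.dd _), LL_dd hφ]
    linarith
  have := ((((((V.smul hμ).add ((T1.add T2).smul hν)).add
    (((Pk 1 a₁).add (Pk 2 a₂)).smul hN)).add
    (((Zk 1 z₁).add (Zk 2 z₂)).smul (c := i / 50) (by positivity))).add Z).add L).add
    (Q.smul (c := i / 4) (by positivity))
  have := this.nonneg_of_min hφ.sm hloc
  linarith

set_option maxHeartbeats 4000000 in
/-- From a nearly cylindrical point of moderate slope one reaches points of slope `Λ` in both
directions within controlled distance. -/
theorem exists_end {Λ : ℝ} (hΛ : 16 ≤ Λ) : ∃ δ > 0, ∀ φ, Tr φ → ∀ (b : OB) (x₀ : E3),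
    |dd (b 0) φ x₀| ≤ 2 → |dd (b 1) φ x₀| ≤ δ → |dd (b 2) φ x₀| ≤ δ →
    dd (b 1) (dd (b 1) φ) x₀ ≤ δ → dd (b 2) (dd (b 2) φ) x₀ ≤ δ → vv b0 φ x₀ ≤ δ →
    ∀ s : ℝ, s ^ 2 = 1 → ∃ q, s * dd (b 0) φ q = -Λ ∧ |dd (b 1) φ q| ≤ 1 / 200 ∧
      |dd (b 2) φ q| ≤ 1 / 200 ∧ |inner ℝ (b 0) q - inner ℝ (b 0) x₀| ≤ 2 + π ∧
      |inner ℝ (b 1) q - inner ℝ (b 1) x₀| ≤ 10 * Λ ∧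
      |inner ℝ (b 2) q - inner ℝ (b 2) x₀| ≤ 10 * Λ := by
  have hΛ0 : 0 < Λ := by linarith
  obtain ⟨i, hi⟩ : ∃ i, (Λ ^ 2)⁻¹ = i := ⟨_, rfl⟩
  have hi0 : 0 < i := by rw [← hi]; positivity
  have hiL : i * Λ ^ 2 = 1 := by rw [← hi]; exact inv_mul_cancel₀ (by positivity)
  have hiΛ : i * Λ ≤ 1 := by
    rw [← hiL]; gcongr; nlinarith
  obtain ⟨δ₁, hδ₁, hgrim⟩ := exists_grim Λ (show 0 < i / 100 by positivity)
  obtain ⟨δ, hδ⟩ : ∃ δ, min δ₁ (1 / 200) = δ := ⟨_, rfl⟩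
  have hδ0 : 0 < δ := by rw [← hδ]; positivity
  have hδa : δ ≤ δ₁ := by rw [← hδ]; exact min_le_left _ _
  have hδb : δ ≤ 1 / 200 := by rw [← hδ]; exact min_le_right _ _
  obtain ⟨N, hN⟩ : ∃ N, 6 / δ ^ 2 = N := ⟨_, rfl⟩
  have hN0 : 0 < N := by rw [← hN]; positivity
  have hNδ : N * δ ^ 2 = 6 := by rw [← hN]; field_simp
  obtain ⟨M, hM⟩ : ∃ M, 2 + Λ ^ 2 = M := ⟨_, rfl⟩
  have hM0 : 0 < M := by rw [← hM]; positivity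
  obtain ⟨ν, hν⟩ : ∃ ν, max (150 * N * M / i) (3 / 2 * M / δ) = ν := ⟨_, rfl⟩
  have hν0 : 0 < ν := by rw [← hν]; positivity
  have hν1 : 150 * N * M ≤ i * ν := by
    rw [← div_le_iff₀' hi0, ← hν]; exact le_max_left _ _
  have hν2 : 3 / 2 * M ≤ δ * ν := by
    rw [← div_le_iff₀' hδ0, ← hν]; exact le_max_right _ _
  obtain ⟨μ, hμ⟩ : ∃ μ, 25 * (90 * ν + 32 * ν ^ 2) / i = μ := ⟨_, rfl⟩
  have hμ0 : 0 < μ := by rw [← hμ]; positivity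
  have hμ1 : 25 * (90 * ν + 32 * ν ^ 2) ≤ i * μ := by
    rw [← div_le_iff₀' hi0, hμ]
  refine ⟨min (δ / 2) (min (1 / (16 * μ)) (1 / (32 * ν))), by positivity, ?_⟩
  intro φ hφ b x₀ h0 h1 h2 h11 h22 hv s hs
  have c1 := h1.trans (min_le_left _ _)
  have c2 := h2.trans (min_le_left _ _)
  have c11 := h11.trans ((min_le_right _ _).trans (min_le_right _ _))
  have c22 := h22.trans ((min_le_right _ _).trans (min_le_right _ _))
  have cv := hv.trans ((min_le_right _ _).trans (min_le_left _ _))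
  rw [le_div_iff₀' (by positivity)] at c11 c22 cv
  let T : E3 → ℝ := fun y => om b0 φ y * dd (b 1) (dd (b 1) φ) y + om b0 φ y *
    dd (b 2) (dd (b 2) φ) y
  let ζ : E3 → ℝ := fun y => inner ℝ (b 0) y - arctan (dd (b 0) φ y)
  let Ψ : E3 → ℝ := fun y => μ * vv b0 φ y + ν * T y +
    N * ((dd (b 1) φ y - dd (b 1) φ x₀) ^ 2 + (dd (b 2) φ y - dd (b 2) φ x₀) ^ 2) +
    i / 50 * ((inner ℝ (b 1) y - inner ℝ (b 1) x₀) ^ 2 +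
      (inner ℝ (b 2) y - inner ℝ (b 2) x₀) ^ 2) +
    (ζ y - ζ x₀) ^ 2 + s / Λ * dd (b 0) φ y + i / 4 * (-(dd (b 0) φ y) ^ 2)
  have sζ : Sm ζ := (sm_inner _).sub (sm_arctan (hφ.sm.dd _))
  have cvv := (sm_vv hφ b0).continuous
  have com := (sm_om hφ.sm b0).continuous
  have cp := fun k => (hφ.sm.dd (b k)).continuous
  have cS := fun k => ((hφ.sm.dd (b k)).dd (b k)).continuous
  have cz := fun k => (sm_inner (b k)).continuous
  have cζ := sζ.continuous
  have c0 := cp 0; have c1' := cp 1; have c2' := cp 2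
  have d1 := cS 1; have d2 := cS 2
  have e0 := cz 0; have e1 := cz 1; have e2 := cz 2
  have cT : Continuous T := by fun_prop
  have hΨc : Continuous Ψ := by fun_prop
  have hz0 : ∀ y, |ζ y - ζ x₀| ≤ 2 → |inner ℝ (b 0) y - inner ℝ (b 0) x₀| ≤ 2 + π := by
    intro y hy
    have a := abs_le.1 hy
    have a1 := arctan_lt_pi_div_two (dd (b 0) φ y)
    have a2 := neg_pi_div_two_lt_arctan (dd (b 0) φ y)
    have a3 := arctan_lt_pi_div_two (dd (b 0) φ x₀)
    have a4 := neg_pi_div_two_lt_arctan (dd (b 0) φ x₀)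
    simp only [ζ] at a
    rw [abs_le]
    constructor <;> linarith
  let K : Set E3 := {y | (inner ℝ (b 1) y - inner ℝ (b 1) x₀) ^ 2 +
    (inner ℝ (b 2) y - inner ℝ (b 2) x₀) ^ 2 ≤ (10 * Λ) ^ 2} ∩ {y | |ζ y - ζ x₀| ≤ 2} ∩
    {y | |dd (b 0) φ y| ≤ Λ}
  have hK : IsCompact K := by
    refine (isCompact_closedBall x₀ (20 * Λ)).of_isClosed_subset ?_ ?_
    · exact ((isClosed_le (by fun_prop) continuous_const).inter
        (isClosed_le (by fun_prop) continuous_const)).inter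
        (isClosed_le (by fun_prop) continuous_const)
    · rintro y ⟨⟨h, h'⟩, -⟩
      have h' := hz0 y h'
      rw [Metric.mem_closedBall, dist_eq_norm]
      refine abs_le_of_sq_le_sq' ?_ (by positivity) |>.2
      rw [← sum_sq_b b, Fin.sum_univ_three]
      simp only [inner_sub_right]
      have : (inner ℝ (b 0) y - inner ℝ (b 0) x₀) ^ 2 ≤ Λ ^ 2 := by
        rw [sq_le_sq, abs_of_pos hΛ0]
        linarith [pi_lt_four]
      have h : (inner ℝ (b 1) y - inner ℝ (b 1) x₀) ^ 2 +
        (inner ℝ (b 2) y - inner ℝ (b 2) x₀) ^ 2 ≤ (10 * Λ) ^ 2 := h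
      nlinarith
  have hx₀K : x₀ ∈ K := by
    refine ⟨⟨?_, ?_⟩, ?_⟩
    · show (inner ℝ (b 1) x₀ - inner ℝ (b 1) x₀) ^ 2 + (inner ℝ (b 2) x₀ - inner ℝ (b 2) x₀) ^ 2 ≤
        (10 * Λ) ^ 2
      rw [sub_self, sub_self]; nlinarith
    · show |ζ x₀ - ζ x₀| ≤ 2
      simp
    · show |dd (b 0) φ x₀| ≤ Λ
      linarith
  obtain ⟨x, hxK, hmin⟩ := hK.exists_isMinOn ⟨x₀, hx₀K⟩ hΨc.continuousOn
  obtain ⟨⟨hxz, hxζ⟩, hxp⟩ := hxK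
  have hxζ : |ζ x - ζ x₀| ≤ 2 := hxζ
  have hxp : |dd (b 0) φ x| ≤ Λ := hxp
  have hxz : (inner ℝ (b 1) x - inner ℝ (b 1) x₀) ^ 2 +
    (inner ℝ (b 2) x - inner ℝ (b 2) x₀) ^ 2 ≤ (10 * Λ) ^ 2 := hxz
  have hsabs : |s| = 1 := by
    rw [← pow_eq_one_iff_of_nonneg (abs_nonneg s) two_ne_zero, sq_abs, hs]
  have hΨ0 : Ψ x₀ ≤ 1 / 4 := by
    have ho := om_le_one b0 φ x₀
    have ho0 := om_pos b0 φ x₀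
    have n1 := hφ.hess_nonneg (b 1) x₀
    have n2 := hφ.hess_nonneg (b 2) x₀
    have t1 : T x₀ ≤ 1 * dd (b 1) (dd (b 1) φ) x₀ + 1 * dd (b 2) (dd (b 2) φ) x₀ := by
      simp only [T]; gcongr
    have t2 : ν * T x₀ ≤ ν * (1 * dd (b 1) (dd (b 1) φ) x₀ + 1 * dd (b 2) (dd (b 2) φ) x₀) := by
      gcongr
    have t3 : s / Λ * dd (b 0) φ x₀ ≤ 1 / 8 := by
      refine (le_abs_self _).trans ?_
      rw [abs_mul, abs_div, hsabs, abs_of_pos hΛ0]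
      calc 1 / Λ * |dd (b 0) φ x₀| ≤ 1 / 16 * 2 := by gcongr
        _ = 1 / 8 := by norm_num
    have t4 : i / 4 * (-(dd (b 0) φ x₀) ^ 2) ≤ 0 := by
      have : 0 ≤ i / 4 * (dd (b 0) φ x₀) ^ 2 := by positivity
      linarith
    simp only [Ψ, sub_self]
    linarith
  have hΨx : Ψ x ≤ 1 / 4 := (hmin hx₀K : Ψ x ≤ Ψ x₀).trans hΨ0
  obtain ⟨hv0, -⟩ := hφ.point x
  have ho0 := om_pos b0 φ x
  have n1 := hφ.hess_nonneg (b 1) x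
  have n2 := hφ.hess_nonneg (b 2) x
  have hT0 : 0 ≤ ν * T x := by simp only [T]; positivity
  have hμv0 : 0 ≤ μ * vv b0 φ x := by positivity
  have hp2 : dd (b 0) φ x ^ 2 ≤ Λ ^ 2 := by rwa [sq_le_sq, abs_of_pos hΛ0]
  have hκ : -(1 / 4) ≤ i / 4 * (-(dd (b 0) φ x) ^ 2) := by
    have := mul_le_mul_of_nonneg_left hp2 hi0.le
    linarith
  have hsp : |s / Λ * dd (b 0) φ x| ≤ 1 := by
    rw [abs_mul, abs_div, hsabs, abs_of_pos hΛ0, one_div, inv_mul_le_iff₀ hΛ0, mul_one]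
    exact hxp
  have hsp1 := (abs_le.1 hsp).1
  have hP0 : 0 ≤ N * ((dd (b 1) φ x - dd (b 1) φ x₀) ^ 2 + (dd (b 2) φ x - dd (b 2) φ x₀) ^ 2) := by
    positivity
  have hz0' : 0 ≤ i / 50 * ((inner ℝ (b 1) x - inner ℝ (b 1) x₀) ^ 2 +
      (inner ℝ (b 2) x - inner ℝ (b 2) x₀) ^ 2) := by positivity
  have hΨe : Ψ x = μ * vv b0 φ x + ν * T x +
    N * ((dd (b 1) φ x - dd (b 1) φ x₀) ^ 2 + (dd (b 2) φ x - dd (b 2) φ x₀) ^ 2) +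
    i / 50 * ((inner ℝ (b 1) x - inner ℝ (b 1) x₀) ^ 2 +
      (inner ℝ (b 2) x - inner ℝ (b 2) x₀) ^ 2) +
    (ζ x - ζ x₀) ^ 2 + s / Λ * dd (b 0) φ x + i / 4 * (-(dd (b 0) φ x) ^ 2) := rfl
  have hζ0 := sq_nonneg (ζ x - ζ x₀)
  have hpδ : ∀ a c : ℝ, N * (a - c) ^ 2 ≤ 3 / 2 → |c| ≤ δ / 2 → |a| ≤ δ := by
    intro a c h hc
    have : (a - c) ^ 2 ≤ (δ / 2) ^ 2 := by
      refine le_of_mul_le_mul_left ?_ hN0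
      linarith
    have := abs_le_of_sq_le_sq this (by positivity)
    have e : a = (a - c) + c := by ring
    rw [e]
    exact (abs_add_le _ _).trans (by linarith)
  have hN1 : 0 ≤ N * (dd (b 1) φ x - dd (b 1) φ x₀) ^ 2 := by positivity
  have hN2 : 0 ≤ N * (dd (b 2) φ x - dd (b 2) φ x₀) ^ 2 := by positivity
  have hP3 : N * ((dd (b 1) φ x - dd (b 1) φ x₀) ^ 2 + (dd (b 2) φ x - dd (b 2) φ x₀) ^ 2) ≤ 3 / 2 := by
    linarith
  have hpx1 := hpδ (dd (b 1) φ x) _ (by linarith) c1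
  have hpx2 := hpδ (dd (b 2) φ x) _ (by linarith) c2
  have hx1 : |inner ℝ (b 1) x - inner ℝ (b 1) x₀| ≤ 10 * Λ :=
    abs_le_of_sq_le_sq (by linarith [sq_nonneg (inner ℝ (b 2) x - inner ℝ (b 2) x₀)])
      (by positivity)
  have hx2 : |inner ℝ (b 2) x - inner ℝ (b 2) x₀| ≤ 10 * Λ :=
    abs_le_of_sq_le_sq (by linarith [sq_nonneg (inner ℝ (b 1) x - inner ℝ (b 1) x₀)])
      (by positivity)
  by_cases hend : s * dd (b 0) φ x = -Λ
  · exact ⟨x, hend, hpx1.trans hδb, hpx2.trans hδb, hz0 x hxζ, hx1, hx2⟩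
  exfalso
  have hl1 : (inner ℝ (b 1) x - inner ℝ (b 1) x₀) ^ 2 +
      (inner ℝ (b 2) x - inner ℝ (b 2) x₀) ^ 2 < (10 * Λ) ^ 2 := by
    refine lt_of_le_of_ne hxz fun he => ?_
    rw [he] at hΨe
    linarith
  have hl2 : |ζ x - ζ x₀| < 2 := by
    refine lt_of_le_of_ne hxζ fun he => ?_
    have : (ζ x - ζ x₀) ^ 2 = 4 := by rw [← sq_abs, he]; norm_num
    linarith
  have hl3 : |dd (b 0) φ x| < Λ := by
    refine lt_of_le_of_ne hxp fun he => ?_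
    have h1 : |s * dd (b 0) φ x| = Λ := by rw [abs_mul, hsabs, he, one_mul]
    rcases abs_eq hΛ0.le |>.1 h1 with h | h
    · have : s / Λ * dd (b 0) φ x = 1 := by
        rw [div_mul_eq_mul_div, h, div_self hΛ0.ne']
      linarith
    · exact hend h
  have hloc : IsLocalMin Ψ x := by
    have o1 : IsOpen {y : E3 | (inner ℝ (b 1) y - inner ℝ (b 1) x₀) ^ 2 +
        (inner ℝ (b 2) y - inner ℝ (b 2) x₀) ^ 2 < (10 * Λ) ^ 2} :=
      isOpen_lt (by fun_prop) continuous_const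
    have o2 : IsOpen {y : E3 | |ζ y - ζ x₀| < 2} := isOpen_lt (by fun_prop) continuous_const
    have o3 : IsOpen {y : E3 | |dd (b 0) φ y| < Λ} := isOpen_lt c0.abs continuous_const
    refine IsMinOn.isLocalMin hmin (Filter.inter_mem (Filter.inter_mem ?_ ?_) ?_)
    · filter_upwards [o1.mem_nhds hl1] with y hy using le_of_lt hy
    · filter_upwards [o2.mem_nhds hl2] with y hy using le_of_lt hy
    · filter_upwards [o3.mem_nhds hl3] with y hy using le_of_lt hy
  obtain ⟨n, hfin⟩ := hφ.end_step b x hμ0.le hν0.le hN0.le hi0.le sζ hloc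
  have hW : om b0 φ x * (1 + (dd (b 0) φ x ^ 2 + dd (b 1) φ x ^ 2 + dd (b 2) φ x ^ 2)) = 1 := by
    rw [om_indep b b0, om]
    simp only [gv, dotProduct, Fin.sum_univ_three, ← sq]
    have : 0 < 1 + (dd (b 0) φ x ^ 2 + dd (b 1) φ x ^ 2 + dd (b 2) φ x ^ 2) := by positivity
    exact inv_mul_cancel₀ this.ne'
  have q : ∀ a : ℝ, |a| ≤ δ → a ^ 2 ≤ 1 / 2 := by
    intro a ha
    have h1 : |a| ≤ 1 / 2 := by linarith only [ha, hδb]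
    have h2 : a ^ 2 ≤ (1 / 2) ^ 2 := by
      rw [← sq_abs]
      exact pow_le_pow_left₀ (abs_nonneg a) h1 2
    linarith only [h2]
  have q1 := q _ hpx1
  have q2 := q _ hpx2
  have hwM : 1 ≤ om b0 φ x * M := by
    rw [← hW]
    gcongr
    linarith
  have hTx : ν * (om b0 φ x * dd (b 1) (dd (b 1) φ) x + om b0 φ x * dd (b 2) (dd (b 2) φ) x) ≤
      3 / 2 := by
    change ν * T x ≤ 3 / 2
    linarith
  have hSk : ∀ S : ℝ, 0 ≤ S → ν * (om b0 φ x * S) ≤ 3 / 2 → S ≤ δ := by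
    intro S hS h
    refine le_of_mul_le_mul_left ?_ hν0
    have h1 := mul_le_mul_of_nonneg_left hwM (mul_nonneg hν0.le hS)
    have h2 := mul_le_mul_of_nonneg_right h hM0.le
    linarith
  have hS1 := hSk (dd (b 1) (dd (b 1) φ) x) n1 (by
    have : 0 ≤ ν * (om b0 φ x * dd (b 2) (dd (b 2) φ) x) := by positivity
    linarith)
  have hS2 := hSk (dd (b 2) (dd (b 2) φ) x) n2 (by
    have : 0 ≤ ν * (om b0 φ x * dd (b 1) (dd (b 1) φ) x) := by positivity
    linarith)
  obtain ⟨g1, g2⟩ := hgrim φ hφ b x hxp (hpx1.trans hδa) (hpx2.trans hδa) (hS1.trans hδa)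
    (hS2.trans hδa)
  exact scalar_end hi0 hiΛ hμ0 hν0 hN0 hM0 hμ1 hν1 (by linarith) hTx hwM n1 n2 hx1 hx2 hxζ
    (GG_nonneg _ _ _) g1 g2 hfin

end

section

/-! ### Almost one dimensional Hessians -/

open Matrix

variable {φ u w : E3 → ℝ}

theorem dd_dd_comb (hu : Sm u) (s t : ℝ) (e e' x : E3) :
    dd (s • e + t • e') (dd (s • e + t • e') u) x =
      s ^ 2 * dd e (dd e u) x + 2 * s * t * dd e (dd e' u) x + t ^ 2 * dd e' (dd e' u) x := by
  have h1 : dd (s • e + t • e') u = fun y => s * dd e u y + t * dd e' u y := by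
    funext y; rw [dd_add_dir, dd_smul_dir, dd_smul_dir]
  have h2 : ∀ v, dd v (fun y => s * dd e u y + t * dd e' u y) x =
      s * dd v (dd e u) x + t * dd v (dd e' u) x := fun v =>
    (((J.of (hu.dd e) x v v).smul s).add ((J.of (hu.dd e') x v v).smul t)).fst
  rw [h1, h2, dd_add_dir, dd_add_dir, dd_smul_dir, dd_smul_dir, dd_smul_dir, dd_smul_dir,
    dd_comm hu e' e]
  ring

theorem dd_dd_smul (hu : Sm u) (s : ℝ) (e x : E3) :
    dd (s • e) (dd (s • e) u) x = s ^ 2 * dd e (dd e u) x := by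
  have := dd_dd_comb hu s 0 e e x
  simpa using this

/-- A basis whose first vector maximises the second derivative. -/
theorem exists_top_basis (hu : Sm u) (x : E3) : ∃ b : OB,
    (∀ k, k ≠ 0 → dd (b 0) (dd (b k) u) x = 0) ∧
      ∀ k, dd (b k) (dd (b k) u) x ≤ dd (b 0) (dd (b 0) u) x := by
  have hc : Continuous fun e => dd e (dd e u) x := by
    have : (fun e => dd e (dd e u) x) = fun e => ∑ i, ∑ j, inner ℝ (b0 i) e * inner ℝ (b0 j) e *
        dd (b0 i) (dd (b0 j) u) x := by
      funext e; exact dd_dd_basis b0 e e hu x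
    rw [this]
    fun_prop
  have hne : (Metric.sphere (0 : E3) 1).Nonempty := ⟨b0 0, by simp⟩
  obtain ⟨e, he, hmax⟩ := (isCompact_sphere (0 : E3) 1).exists_isMaxOn hne hc.continuousOn
  rw [mem_sphere_zero_iff_norm] at he
  obtain ⟨b, rfl⟩ := exists_OB e he
  have hle : ∀ y : E3, dd y (dd y u) x ≤ ‖y‖ ^ 2 * dd (b 0) (dd (b 0) u) x := by
    intro y
    rcases eq_or_ne y 0 with rfl | hy
    · have := dd_dd_smul hu 0 (0 : E3) x
      simp at this ⊢
      linarith
    · have hn : ‖y‖ ≠ 0 := norm_ne_zero_iff.2 hy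
      have h := hmax (show ‖y‖⁻¹ • y ∈ Metric.sphere (0 : E3) 1 by
        rw [mem_sphere_zero_iff_norm, norm_smul]; simp [hn])
      have h : dd (‖y‖⁻¹ • y) (dd (‖y‖⁻¹ • y) u) x ≤ dd (b 0) (dd (b 0) u) x := h
      rw [dd_dd_smul hu, inv_pow, inv_mul_le_iff₀ (by positivity)] at h
      exact h
  have hk : ∀ k, dd (b k) (dd (b k) u) x ≤ dd (b 0) (dd (b 0) u) x := by
    intro k
    have := hle (b k)
    rwa [b.norm_eq_one, one_pow, one_mul] at this
  refine ⟨b, fun k hk0 => ?_, hk⟩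
  have hq : ∀ t : ℝ, 2 * t * dd (b 0) (dd (b k) u) x + t ^ 2 * dd (b k) (dd (b k) u) x ≤
      t ^ 2 * dd (b 0) (dd (b 0) u) x := by
    intro t
    have h := hle ((1 : ℝ) • b 0 + t • b k)
    have hn : ‖(1 : ℝ) • b 0 + t • b k‖ ^ 2 = 1 + t ^ 2 := by
      rw [← sum_sq_b b, Fin.sum_univ_three]
      simp only [inner_add_right, inner_smul_right, OB_inner]
      fin_cases k <;> simp at hk0 ⊢
    rw [hn, dd_dd_comb hu] at h
    linarith
  obtain ⟨a, ha⟩ : ∃ a, dd (b 0) (dd (b k) u) x = a := ⟨_, rfl⟩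
  obtain ⟨K, hK⟩ : ∃ K, dd (b 0) (dd (b 0) u) x - dd (b k) (dd (b k) u) x = K := ⟨_, rfl⟩
  have hK0 : 0 ≤ K := by rw [← hK]; linarith [hk k]
  obtain ⟨t, ht⟩ : ∃ t, a / (K + 1) = t := ⟨_, rfl⟩
  have h1 := hq t
  rw [ha] at h1 ⊢
  have h2 : 2 * (a / (K + 1)) * a ≤ (a / (K + 1)) ^ 2 * K := by rw [ht, ← hK]; linarith
  have h3 : 2 * a ^ 2 * (K + 1) ≤ a ^ 2 * K := by
    have := mul_le_mul_of_nonneg_right h2 (sq_nonneg (K + 1))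
    have e1 : 2 * (a / (K + 1)) * a * (K + 1) ^ 2 = 2 * a ^ 2 * (K + 1) := by field_simp
    have e2 : (a / (K + 1)) ^ 2 * K * (K + 1) ^ 2 = a ^ 2 * K := by field_simp
    linarith
  have : a ^ 2 ≤ 0 := by nlinarith [sq_nonneg a, mul_nonneg (sq_nonneg a) hK0]
  exact pow_eq_zero_iff two_ne_zero |>.1 (le_antisymm this (sq_nonneg a))

theorem scalar_top {p0 p1 p2 S0 S1 S2 z w : ℝ} (hw : 0 < w)
    (hw1 : w * (1 + (p0 ^ 2 + p1 ^ 2 + p2 ^ 2)) = 1) (hS1 : 0 ≤ S1) (hS2 : 0 ≤ S2)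
    (h1 : S1 ≤ S0) (h2 : S2 ≤ S0) (hz : z ^ 2 ≤ S1 * S2)
    (htr : S0 + S1 + S2 = 1 + w * (p0 ^ 2 * S0 + p1 ^ 2 * S1 + p2 ^ 2 * S2 + 2 * p1 * p2 * z)) :
    2 / 3 * w * (S1 + S2) ≤ (S0 + S1 + S2 - w *
      (p0 ^ 2 * S0 + p1 ^ 2 * S1 + p2 ^ 2 * S2 + 2 * p1 * p2 * z)) ^ 2 -
      (S0 ^ 2 + S1 ^ 2 + S2 ^ 2 + 2 * z ^ 2) +
      2 * w * (p0 ^ 2 * S0 ^ 2 + (p1 * S1 + p2 * z) ^ 2 + (p1 * z + p2 * S2) ^ 2) -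
      w ^ 2 * (p0 ^ 2 * S0 + p1 ^ 2 * S1 + p2 ^ 2 * S2 + 2 * p1 * p2 * z) ^ 2 := by
  have hq : ∀ s t : ℝ, 0 ≤ s ^ 2 * S1 + t ^ 2 * S2 + 2 * s * t * z := by
    intro s t
    rcases hS1.eq_or_lt with h | h
    · have : z = 0 := by
        rw [← h, zero_mul] at hz
        exact pow_eq_zero_iff two_ne_zero |>.1 (le_antisymm hz (sq_nonneg z))
      rw [this, ← h, mul_zero, mul_zero, zero_add, add_zero]; positivity
    · refine nonneg_of_mul_nonneg_right ?_ h
      nlinarith [sq_nonneg (S1 * s + z * t), mul_nonneg (sq_nonneg t) (sub_nonneg.2 hz)]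
  have hS0 : 1 / 3 ≤ S0 := by
    have := mul_nonneg hw.le (hq p1 p2)
    have : 0 ≤ w * (p0 ^ 2 * S0) := by
      have : 0 ≤ S0 := hS1.trans h1
      positivity
    linarith
  have k1 := hq p2 (-p1)
  have k2 : 0 ≤ p0 ^ 2 * (S1 * S2 - z ^ 2) := mul_nonneg (sq_nonneg _) (sub_nonneg.2 hz)
  have k3 := mul_nonneg (show 0 ≤ S0 by linarith) k1
  have k4 : 1 / 3 * (S1 + S2) ≤ S0 * (S1 + S2) := by gcongr
  have key : (S0 + S1 + S2 - w *
      (p0 ^ 2 * S0 + p1 ^ 2 * S1 + p2 ^ 2 * S2 + 2 * p1 * p2 * z)) ^ 2 -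
      (S0 ^ 2 + S1 ^ 2 + S2 ^ 2 + 2 * z ^ 2) +
      2 * w * (p0 ^ 2 * S0 ^ 2 + (p1 * S1 + p2 * z) ^ 2 + (p1 * z + p2 * S2) ^ 2) -
      w ^ 2 * (p0 ^ 2 * S0 + p1 ^ 2 * S1 + p2 ^ 2 * S2 + 2 * p1 * p2 * z) ^ 2 =
      2 * w * (S0 * (S1 + S2) + (S1 * S2 - z ^ 2)) + 2 * w * (p0 ^ 2 * (S1 * S2 - z ^ 2) +
        S0 * (p2 ^ 2 * S1 + (-p1) ^ 2 * S2 + 2 * p2 * -p1 * z)) := by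
    linear_combination (-2 * (S0 * (S1 + S2) + (S1 * S2 - z ^ 2))) * hw1
  rw [key]
  have k5 := mul_le_mul_of_nonneg_left k4 hw.le
  have k6 := mul_nonneg hw.le (sub_nonneg.2 hz)
  have k7 := mul_nonneg hw.le k2
  have k8 := mul_nonneg hw.le k3
  linarith

theorem Tr.top_basis_le (hφ : Tr φ) (x : E3) : ∃ b : OB,
    2 / 3 * om b0 φ x * (dd (b 1) (dd (b 1) φ) x + dd (b 2) (dd (b 2) φ) x) ≤ vv b0 φ x := by
  obtain ⟨b, h0, hk⟩ := exists_top_basis hφ.sm x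
  refine ⟨b, ?_⟩
  have h01 := h0 1 (by decide)
  have h02 := h0 2 (by decide)
  have hW := W2_pos b φ x
  have hpde := hφ.pde b x
  rw [vv_indep b b0 hφ.sm, om_indep b b0]
  have hw := om_pos b φ x
  have hw1 : om b φ x * (1 + gv b φ x ⬝ᵥ gv b φ x) = 1 := inv_mul_cancel₀ hW.ne'
  have hcs := hφ.hess_cs (b 1) (b 2) x
  simp only [vv, gv, hm, Matrix.mul_apply, dotProduct, mulVec, Matrix.trace, Matrix.diag, Fin.sum_univ_three, sort2 hφ.sm b, h01, h02] at hpde hw1 ⊢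
  generalize om b φ x = w at *
  refine (scalar_top hw (p0 := dd (b 0) φ x) (p1 := dd (b 1) φ x) (p2 := dd (b 2) φ x)
    (by linarith) (hφ.hess_nonneg _ _) (hφ.hess_nonneg _ _) (hk 1) (hk 2) hcs ?_).trans (le_of_eq ?_)
  · linear_combination w * hpde - (dd (b 0) (dd (b 0) φ) x + dd (b 1) (dd (b 1) φ) x + dd (b 2) (dd (b 2) φ) x - 1) * hw1
  · have e : (dd (b 0) (dd (b 0) φ) x + dd (b 1) (dd (b 1) φ) x + dd (b 2) (dd (b 2) φ) x) - w * (dd (b 0) φ x ^ 2 * dd (b 0) (dd (b 0) φ) x + dd (b 1) φ x ^ 2 * dd (b 1) (dd (b 1) φ) x + dd (b 2) φ x ^ 2 * dd (b 2) (dd (b 2) φ) x + 2 * dd (b 1) φ x * dd (b 2) φ x * dd (b 1) (dd (b 2) φ) x) = 1 := by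
      linear_combination w * hpde - (dd (b 0) (dd (b 0) φ) x + dd (b 1) (dd (b 1) φ) x + dd (b 2) (dd (b 2) φ) x - 1) * hw1
    rw [e]
    ring

end

section

/-! ### Growth outside a slab -/

open Matrix

variable {φ u w : E3 → ℝ}

theorem om_mul_sum (b : OB) (φ : E3 → ℝ) (x : E3) :
    om b0 φ x * (1 + (dd (b 0) φ x ^ 2 + dd (b 1) φ x ^ 2 + dd (b 2) φ x ^ 2)) = 1 := by
  rw [om_indep b b0, om]
  simp only [gv, dotProduct, Fin.sum_univ_three, ← sq]
  have : 0 < 1 + (dd (b 0) φ x ^ 2 + dd (b 1) φ x ^ 2 + dd (b 2) φ x ^ 2) := by positivity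
  exact inv_mul_cancel₀ this.ne'

theorem sum_sq_le_three (b : OB) {x : E3} (h : 1 / 4 ≤ om b0 φ x) :
    dd (b 0) φ x ^ 2 + dd (b 1) φ x ^ 2 + dd (b 2) φ x ^ 2 ≤ 3 := by
  have h1 := om_mul_sum b φ x
  have : 1 / 4 * (1 + (dd (b 0) φ x ^ 2 + dd (b 1) φ x ^ 2 + dd (b 2) φ x ^ 2)) ≤
      om b0 φ x * (1 + (dd (b 0) φ x ^ 2 + dd (b 1) φ x ^ 2 + dd (b 2) φ x ^ 2)) := by gcongr
  linarith

/-- Near the cylinder there is a basis in which the second derivative is almost a multiple of a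
rank one form. -/
theorem exists_small_basis {δ : ℝ} (hδ : 0 < δ) : ∃ ε > 0, ∀ φ, Tr φ → ∀ x, 1 / 4 ≤ om b0 φ x →
    YY b0 φ x ≤ ε → vv b0 φ x ≤ ε → ∃ b : OB, |dd (b 0) φ x| ≤ 2 ∧ |dd (b 1) φ x| ≤ δ ∧
      |dd (b 2) φ x| ≤ δ ∧ dd (b 1) (dd (b 1) φ) x ≤ δ ∧ dd (b 2) (dd (b 2) φ) x ≤ δ := by
  refine ⟨min (δ * (δ ^ 2 / 4)) (δ / 6), by positivity, ?_⟩
  intro φ hφ x ho hY hv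
  have hY := hY.trans (min_le_left _ _)
  have hv := hv.trans (min_le_right _ _)
  have h2 : ∀ b : OB, |dd (b 0) φ x| ≤ 2 := by
    intro b
    refine abs_le_of_sq_le_sq ?_ (by norm_num)
    have := sum_sq_le_three b ho
    linarith [sq_nonneg (dd (b 1) φ x), sq_nonneg (dd (b 2) φ x)]
  obtain ⟨b, P, w, H, s00, s01, s02, s11, s12, s22, F⟩ := hφ.fr x
  have hw := F.w1
  have how := F.om
  rw [om_indep b0 b] at how
  rw [YY_indep b b0 hφ.sm, F.YY] at hY
  have htr := F.ps.tr
  have hd := F.ps.d0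
  have hg := F.ps.g0
  rcases le_or_gt (δ ^ 2 / 4) (w * P ^ 2) with h | h
  · have : δ ^ 2 / 4 * (s11 + s22) ≤ δ ^ 2 / 4 * δ := by
      calc δ ^ 2 / 4 * (s11 + s22) ≤ w * P ^ 2 * (s11 + s22) := by gcongr
        _ = w * P ^ 2 - w * P ^ 2 * (w * s00) := by linear_combination w * P ^ 2 * htr
        _ ≤ _ := by linarith
    have := le_of_mul_le_mul_left this (by positivity)
    refine ⟨b, h2 b, ?_, ?_, ?_, ?_⟩
    · rw [F.h1, abs_zero]; exact hδ.le
    · rw [F.h2, abs_zero]; exact hδ.le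
    · rw [F.h11]; linarith
    · rw [F.h22]; linarith
  · have hP : P ^ 2 ≤ δ ^ 2 := by
      rw [how] at ho
      have : 1 / 4 * P ^ 2 ≤ w * P ^ 2 := by gcongr
      linarith
    obtain ⟨c, hc⟩ := hφ.top_basis_le x
    have e1 := om_mul_sum c φ x
    have hS1 := hφ.hess_nonneg (c 1) x
    have hS2 := hφ.hess_nonneg (c 2) x
    have e2 : 2 / 3 * (1 / 4) * (dd (c 1) (dd (c 1) φ) x + dd (c 2) (dd (c 2) φ) x) ≤
        2 / 3 * om b0 φ x * (dd (c 1) (dd (c 1) φ) x + dd (c 2) (dd (c 2) φ) x) := by gcongr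
    rw [how] at e1
    have e3 : dd (c 0) φ x ^ 2 + dd (c 1) φ x ^ 2 + dd (c 2) φ x ^ 2 = P ^ 2 := by
      have := mul_left_cancel₀ F.w0.ne' (e1.trans hw.symm)
      linarith
    refine ⟨c, h2 c, ?_, ?_, by linarith, by linarith⟩
    · refine abs_le_of_sq_le_sq ?_ hδ.le
      linarith [sq_nonneg (dd (c 0) φ x), sq_nonneg (dd (c 2) φ x)]
    · refine abs_le_of_sq_le_sq ?_ hδ.le
      linarith [sq_nonneg (dd (c 0) φ x), sq_nonneg (dd (c 1) φ x)]

theorem dd_shift (u : E3 → ℝ) (a e : E3) :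
    dd e (fun z => u (a + z)) = fun z => dd e u (a + z) := by
  funext z
  unfold dd
  rw [fderiv_comp_add_left]

theorem dd_translate (u : E3 → ℝ) (a : E3) (c : ℝ) (e : E3) :
    dd e (fun z => u (a + z) - c) = fun z => dd e u (a + z) := by
  rw [← dd_shift]
  funext z
  unfold dd
  rw [fderiv_sub_const]

theorem Tr.translate (hφ : Tr φ) (a : E3) (c : ℝ) : Tr (fun z => φ (a + z) - c) := by
  refine ⟨(hφ.sm.comp (contDiff_const.add contDiff_id)).sub contDiff_const, ?_, ?_⟩
  · refine ⟨convex_univ, fun y _ z _ s t hs ht hst => ?_⟩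
    have := hφ.conv.2 (Set.mem_univ (a + y)) (Set.mem_univ (a + z)) hs ht hst
    have e : s • (a + y) + t • (a + z) = a + (s • y + t • z) := by
      have : a = (s + t) • a := by rw [hst, one_smul]
      nth_rw 3 [this]
      module
    rw [e] at this
    simp only [smul_eq_mul] at this ⊢
    have e2 : c = s * c + t * c := by rw [← add_mul, hst, one_mul]
    linarith
  · intro b x
    have := hφ.pde b (a + x)
    have e : hm b (fun z => φ (a + z) - c) x = hm b φ (a + x) := by
      funext i j
      simp only [hm, dd_translate, dd_shift]
    have e' : gv b (fun z => φ (a + z) - c) x = gv b φ (a + x) := by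
      funext i
      simp only [gv, dd_translate]
    change (1 + gv b (fun z => φ (a + z) - c) x ⬝ᵥ gv b (fun z => φ (a + z) - c) x) *
      ((hm b (fun z => φ (a + z) - c) x).trace - 1) = gv b (fun z => φ (a + z) - c) x ⬝ᵥ
        hm b (fun z => φ (a + z) - c) x *ᵥ gv b (fun z => φ (a + z) - c) x
    rw [e, e', this]

/-- Linear growth with slope `Λ` in direction `e` beyond distance `ρ`. -/
def Slab (φ : E3 → ℝ) (e : E3) (Λ ρ : ℝ) : Prop :=
  ∀ z, ρ ≤ inner ℝ e z → Λ * (inner ℝ e z - ρ) ≤ φ z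

/-- The gradient as a vector. -/
def gr (φ : E3 → ℝ) (x : E3) : E3 := (InnerProductSpace.toDual ℝ E3).symm (fderiv ℝ φ x)

theorem dd_eq_inner_gr (φ : E3 → ℝ) (e x : E3) : dd e φ x = inner ℝ (gr φ x) e := by
  rw [gr, InnerProductSpace.toDual_symm_apply]; rfl

theorem norm_gr_sq (b : OB) (φ : E3 → ℝ) (x : E3) :
    ‖gr φ x‖ ^ 2 = dd (b 0) φ x ^ 2 + dd (b 1) φ x ^ 2 + dd (b 2) φ x ^ 2 := by
  rw [← sum_sq_b b, Fin.sum_univ_three]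
  simp only [dd_eq_inner_gr, real_inner_comm]

theorem inner_eq_sum (b : OB) (x y : E3) : inner ℝ x y = inner ℝ (b 0) x * inner ℝ (b 0) y +
    inner ℝ (b 1) x * inner ℝ (b 1) y + inner ℝ (b 2) x * inner ℝ (b 2) y := by
  rw [← b.sum_inner_mul_inner x y, Fin.sum_univ_three]
  simp only [real_inner_comm x]

theorem Tr.slab_of_gr (hφ : Tr φ) {q : E3} {Λ ρ L : ℝ} (hL0 : 0 < L)
    (hΛL : Λ ≤ L) (hq : dd q φ q - φ q ≤ L * ρ) :
    Slab φ (L⁻¹ • gr φ q) Λ ρ := by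
  intro z hz
  have h1 := hφ.grad_le q z
  rw [dd_eq_inner_gr, inner_sub_right, ← dd_eq_inner_gr _ q] at h1
  have h2 : inner ℝ (gr φ q) z = L * inner ℝ (L⁻¹ • gr φ q) z := by
    rw [real_inner_smul_left, mul_inv_cancel_left₀ hL0.ne']
  have h3 : Λ * (inner ℝ (L⁻¹ • gr φ q) z - ρ) ≤ L * (inner ℝ (L⁻¹ • gr φ q) z - ρ) :=
    mul_le_mul_of_nonneg_right hΛL (sub_nonneg.2 hz)
  linarith

theorem gr_translate (φ : E3 → ℝ) (a : E3) (c : ℝ) (z : E3) :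
    gr (fun z => φ (a + z) - c) z = gr φ (a + z) := by
  rw [gr, gr, fderiv_sub_const, fderiv_comp_add_left]

theorem scalar_slab {Λ s x0 x1 x2 p0 p1 p2 a0 a1 a2 : ℝ} (hΛ : 16 ≤ Λ) (hs : |s| = 1)
    (hx0 : |x0| ≤ 2 + π) (hx1 : |x1| ≤ 10 * Λ) (hx2 : |x2| ≤ 10 * Λ) (hp0 : s * p0 = -Λ)
    (hp1 : |p1| ≤ 1 / 200) (hp2 : |p2| ≤ 1 / 200) (ha0 : |a0| ≤ 2) (ha1 : |a1| ≤ 1 / 200)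
    (ha2 : |a2| ≤ 1 / 200) :
    x0 * p0 + x1 * p1 + x2 * p2 - (x0 * a0 + x1 * a1 + x2 * a2) ≤ Λ * 7 := by
  have hx0 : |x0| ≤ 21 / 4 := hx0.trans (by linarith [pi_lt_d2])
  have hp0 : |p0| ≤ Λ := by
    have := congrArg abs hp0
    rw [abs_mul, hs, one_mul, abs_neg, abs_of_pos (show 0 < Λ by linarith)] at this
    exact this.le
  have h : ∀ x y X Y : ℝ, |x| ≤ X → |y| ≤ Y → |x * y| ≤ X * Y := by
    intro x y X Y hx hy
    rw [abs_mul]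
    have := (abs_nonneg x).trans hx
    gcongr
  have h1 := (abs_le.1 (h _ _ _ _ hx0 hp0)).2
  have h2 := (abs_le.1 (h _ _ _ _ hx1 hp1)).2
  have h3 := (abs_le.1 (h _ _ _ _ hx2 hp2)).2
  have h4 := (abs_le.1 (h _ _ _ _ hx0 ha0)).1
  have h5 := (abs_le.1 (h _ _ _ _ hx1 ha1)).1
  have h6 := (abs_le.1 (h _ _ _ _ hx2 ha2)).1
  linarith

theorem Tr.end_slab (hφ : Tr φ) (b : OB) {x₀ q : E3} {Λ s : ℝ} (hΛ : 16 ≤ Λ) (hs : s ^ 2 = 1)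
    (ha0 : |dd (b 0) φ x₀| ≤ 2) (ha1 : |dd (b 1) φ x₀| ≤ 1 / 200)
    (ha2 : |dd (b 2) φ x₀| ≤ 1 / 200) (hp0 : s * dd (b 0) φ q = -Λ)
    (hp1 : |dd (b 1) φ q| ≤ 1 / 200) (hp2 : |dd (b 2) φ q| ≤ 1 / 200)
    (hx0 : |inner ℝ (b 0) q - inner ℝ (b 0) x₀| ≤ 2 + π)
    (hx1 : |inner ℝ (b 1) q - inner ℝ (b 1) x₀| ≤ 10 * Λ)
    (hx2 : |inner ℝ (b 2) q - inner ℝ (b 2) x₀| ≤ 10 * Λ) :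
    ∃ L > 0, L ^ 2 ≤ Λ ^ 2 + 1 / 20000 ∧ ‖gr φ q‖ = L ∧
      Slab (fun z => φ (x₀ + z) - φ x₀) (L⁻¹ • gr φ q) Λ 7 := by
  have hsabs : |s| = 1 := by
    rw [← pow_eq_one_iff_of_nonneg (abs_nonneg s) two_ne_zero, sq_abs, hs]
  have hn := norm_gr_sq b φ q
  have e0 : dd (b 0) φ q ^ 2 = Λ ^ 2 := by
    have : (s * dd (b 0) φ q) ^ 2 = Λ ^ 2 := by rw [hp0]; ring
    rw [mul_pow, hs, one_mul] at this
    exact this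
  have e1 : dd (b 1) φ q ^ 2 ≤ (1 / 200) ^ 2 := sq_le_sq' (abs_le.1 hp1).1 (abs_le.1 hp1).2
  have e2 : dd (b 2) φ q ^ 2 ≤ (1 / 200) ^ 2 := sq_le_sq' (abs_le.1 hp2).1 (abs_le.1 hp2).2
  have hΛL : Λ ≤ ‖gr φ q‖ := by
    refine abs_le_of_sq_le_sq' ?_ (norm_nonneg _) |>.2
    rw [hn, e0]
    linarith [sq_nonneg (dd (b 1) φ q), sq_nonneg (dd (b 2) φ q)]
  have hL0 : 0 < ‖gr φ q‖ := by linarith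
  refine ⟨‖gr φ q‖, hL0, by rw [hn, e0]; linarith, rfl, ?_⟩
  have h := (hφ.translate x₀ (φ x₀)).slab_of_gr (q := q - x₀) (ρ := 7) hL0 hΛL ?_
  · rwa [gr_translate, add_sub_cancel] at h
  · have h1 := hφ.grad_le x₀ q
    rw [dd_translate]
    beta_reduce
    rw [add_sub_cancel]
    rw [dd_basis b (q - x₀), Fin.sum_univ_three] at h1 ⊢
    simp only [inner_sub_right] at h1 ⊢
    have := scalar_slab hΛ hsabs hx0 hx1 hx2 hp0 hp1 hp2 ha0 ha1 ha2
    have h3 := mul_le_mul_of_nonneg_right hΛL (show (0 : ℝ) ≤ 7 by norm_num)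
    linarith

theorem Tr.neg_le (hφ : Tr φ) {x₀ : E3} (h : 1 / 4 ≤ om b0 φ x₀) (z : E3) :
    -(2 * ‖z‖) ≤ φ (x₀ + z) - φ x₀ := by
  have h1 := hφ.grad_le x₀ (x₀ + z)
  rw [add_sub_cancel_left, dd_eq_inner_gr] at h1
  have h2 := abs_le.1 (abs_real_inner_le_norm (gr φ x₀) z)
  have h3 : ‖gr φ x₀‖ ≤ 2 := by
    refine abs_le_of_sq_le_sq' ?_ (by norm_num) |>.2
    rw [norm_gr_sq b0]
    linarith [sum_sq_le_three b0 h]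
  have h4 := mul_le_mul_of_nonneg_right h3 (norm_nonneg z)
  linarith

/-- At a point of moderate slope which is nearly cylindrical, a translator grows fast outside a
slab. -/
theorem exists_slabs {Λ : ℝ} (hΛ : 16 ≤ Λ) : ∃ ε > 0, ∀ φ, Tr φ → ∀ x, 1 / 4 ≤ om b0 φ x →
    YY b0 φ x ≤ ε → vv b0 φ x ≤ ε → ∃ e₁ e₂ : E3, ‖e₁‖ = 1 ∧ ‖e₂‖ = 1 ∧
      inner ℝ e₁ e₂ ≤ -(199 / 200) ∧ Slab (fun z => φ (x + z) - φ x) e₁ Λ 7 ∧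
      Slab (fun z => φ (x + z) - φ x) e₂ Λ 7 := by
  obtain ⟨δ, hδ, hend⟩ := exists_end hΛ
  obtain ⟨ε, hε, hb⟩ := exists_small_basis (show 0 < min δ (1 / 200) by positivity)
  refine ⟨min ε δ, by positivity, ?_⟩
  intro φ hφ x ho hY hv
  obtain ⟨b, ha0, ha1, ha2, h11, h22⟩ := hb φ hφ x ho (hY.trans (min_le_left _ _))
    (hv.trans (min_le_left _ _))
  have c1 := ha1.trans (min_le_right _ _)
  have c2 := ha2.trans (min_le_right _ _)
  have := hend φ hφ b x ha0 (ha1.trans (min_le_left _ _)) (ha2.trans (min_le_left _ _))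
    (h11.trans (min_le_left _ _)) (h22.trans (min_le_left _ _)) (hv.trans (min_le_right _ _))
  obtain ⟨q, hq0, hq1, hq2, hx0, hx1, hx2⟩ := this 1 (by norm_num)
  obtain ⟨r, hr0, hr1, hr2, hy0, hy1, hy2⟩ := this (-1) (by norm_num)
  obtain ⟨L, hL, hL2, hLn, hS⟩ := hφ.end_slab b hΛ (by norm_num) ha0 c1 c2 hq0 hq1 hq2 hx0 hx1 hx2
  obtain ⟨M, hM, hM2, hMn, hT⟩ := hφ.end_slab b hΛ (by norm_num) ha0 c1 c2 hr0 hr1 hr2 hy0 hy1 hy2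
  refine ⟨L⁻¹ • gr φ q, M⁻¹ • gr φ r, ?_, ?_, ?_, hS, hT⟩
  · rw [norm_smul, hLn, norm_inv, Real.norm_of_nonneg hL.le, inv_mul_cancel₀ hL.ne']
  · rw [norm_smul, hMn, norm_inv, Real.norm_of_nonneg hM.le, inv_mul_cancel₀ hM.ne']
  · have hin : inner ℝ (gr φ q) (gr φ r) ≤ -Λ ^ 2 + 1 / 20000 := by
      rw [inner_eq_sum b]
      simp only [real_inner_comm (gr φ _) (b _), ← dd_eq_inner_gr]
      have h : ∀ x y : ℝ, |x| ≤ 1 / 200 → |y| ≤ 1 / 200 → x * y ≤ 1 / 200 * (1 / 200) := by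
        intro x y hx hy
        refine (le_abs_self _).trans ?_
        rw [abs_mul]
        gcongr
      have h1 := h _ _ hq1 hr1
      have h2 := h _ _ hq2 hr2
      have e0 : dd (b 0) φ q = -Λ := by linarith
      have e1 : dd (b 0) φ r = Λ := by linarith
      rw [e0, e1]
      linarith
    have hLM : L * M ≤ Λ ^ 2 + 1 / 20000 := by linarith [sq_nonneg (L - M)]
    rw [real_inner_smul_left, real_inner_smul_right, inv_mul_le_iff₀ hL, inv_mul_le_iff₀ hM]
    have : (256 : ℝ) ≤ Λ ^ 2 := by
      have := pow_le_pow_left₀ (by norm_num) hΛ 2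
      linarith
    linarith

end

section

/-! ### Barriers -/

open Matrix

variable {φ u w : E3 → ℝ}

/-- The paraboloid `c - (z₀ - α) - s/2 (z₁² + z₂²)`. -/
def pq (b : OB) (c α s : ℝ) (z : E3) : ℝ := c - (inner ℝ (b 0) z - α) -
  s / 2 * (inner ℝ (b 1) z * inner ℝ (b 1) z + inner ℝ (b 2) z * inner ℝ (b 2) z)

theorem jet_pq (b : OB) (c α s : ℝ) (x e e' : E3) : J x e e' (pq b c α s) (pq b c α s x)
    (-inner ℝ (b 0) e - s * (inner ℝ (b 1) x * inner ℝ (b 1) e + inner ℝ (b 2) x * inner ℝ (b 2) e))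
    (-inner ℝ (b 0) e' -
      s * (inner ℝ (b 1) x * inner ℝ (b 1) e' + inner ℝ (b 2) x * inner ℝ (b 2) e'))
    (-(s * (inner ℝ (b 1) e * inner ℝ (b 1) e' + inner ℝ (b 2) e * inner ℝ (b 2) e'))) := by
  have j1 := J.inner x e e' (b 1)
  have j2 := J.inner x e e' (b 2)
  have j := ((J.const x e e' c).sub ((J.inner x e e' (b 0)).sub (J.const x e e' α))).sub
    (((j1.mul j1).add (j2.mul j2)).smul (s / 2))
  refine ⟨j.sm, rfl, j.fst.trans ?_, j.snd.trans ?_, j.hes.trans ?_⟩ <;> ring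

/-- First and second order conditions at a minimum of the barrier function. -/
theorem Tr.barrier_min (hφ : Tr φ) (b : OB) {c α s m : ℝ} {q : E3} (hs : 0 ≤ s) (hm : 0 ≤ m)
    (hq : IsLocalMin (fun z => exp (-(1 / 2) * φ z) - m * pq b c α s z) q) :
    (∀ v, 1 / 2 * exp (-(1 / 2) * φ q) * dd v φ q = m * (inner ℝ (b 0) v +
      s * (inner ℝ (b 1) q * inner ℝ (b 1) v + inner ℝ (b 2) q * inner ℝ (b 2) v))) ∧
      exp (-(1 / 2) * φ q) ≤ 12 * m * s := by
  have j := fun v : E3 => (((J.of hφ.sm q v v).smul (-(1 / 2))).exp).sub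
    ((jet_pq b c α s q v v).smul m)
  have hmin := fun v => dd_of_min (j v).sm hq v
  refine ⟨fun v => ?_, ?_⟩
  · have := (hmin v).1
    rw [(j v).fst] at this
    linarith
  · have h2 : ∀ v, ‖v‖ = 1 → 0 ≤ exp (-(1 / 2) * φ q) *
        (-(1 / 2) * dd v (dd v φ) q + 1 / 4 * dd v φ q ^ 2) + m * s := by
      intro v hv
      have h := (hmin v).2
      rw [(j v).hes] at h
      have h3 := sum_sq_b b v
      rw [Fin.sum_univ_three, hv] at h3
      have h4 : m * s * (inner ℝ (b 1) v ^ 2 + inner ℝ (b 2) v ^ 2) ≤ m * s * 1 := by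
        gcongr
        linarith [sq_nonneg (inner ℝ (b 0) v)]
      linarith
    obtain ⟨b', P, w, H, s00, s01, s02, s11, s12, s22, F⟩ := hφ.fr q
    have k0 := h2 (b' 0) (b'.norm_eq_one 0)
    have k1 := h2 (b' 1) (b'.norm_eq_one 1)
    have k2 := h2 (b' 2) (b'.norm_eq_one 2)
    rw [F.h00, F.h0] at k0
    rw [F.h11, F.h1] at k1
    rw [F.h22, F.h2] at k2
    have hw0 := F.w0
    have hw1 := F.w1
    have htr := F.ps.tr
    have hE := exp_pos (-(1 / 2) * φ q)
    generalize exp (-(1 / 2) * φ q) = E at *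
    have hP : w * P ^ 2 ≤ 1 := by linarith
    have hw : w ≤ 1 := by
      have : 0 ≤ w * P ^ 2 := by positivity
      linarith
    have k0' := mul_nonneg hw0.le k0
    have e1 : w * (m * s) ≤ 1 * (m * s) := by gcongr
    have e2 : E * (w * P ^ 2) ≤ E * 1 := by gcongr
    have e3 : E * (w * s00 + s11 + s22) = E := by rw [htr, mul_one]
    linarith

theorem isCompact_pq (b : OB) (c α : ℝ) {s : ℝ} (hs : 0 < s) :
    IsCompact {z : E3 | α ≤ inner ℝ (b 0) z ∧ 0 ≤ pq b c α s z} := by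
  obtain ⟨M, hM⟩ : ∃ M, |α| + |c| + 1 + 2 * |c| / s = M := ⟨_, rfl⟩
  have hM1 : 1 ≤ M := by
    rw [← hM]
    have : 0 ≤ |α| + |c| + 2 * |c| / s := by positivity
    linarith
  have hcont : Continuous (pq b c α s) := by
    unfold pq
    fun_prop
  refine (isCompact_closedBall (0 : E3) (2 * M)).of_isClosed_subset ?_ ?_
  · have o1 : IsClosed {z : E3 | α ≤ inner ℝ (b 0) z} := isClosed_le continuous_const (by fun_prop)
    have o2 : IsClosed {z : E3 | 0 ≤ pq b c α s z} := isClosed_le continuous_const hcont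
    exact o1.inter o2
  · rintro z ⟨h1, h2⟩
    rw [mem_closedBall_zero_iff]
    refine abs_le_of_sq_le_sq' ?_ (by positivity) |>.2
    rw [← sum_sq_b b, Fin.sum_univ_three]
    unfold pq at h2
    have a0 := abs_nonneg c
    have a1 := le_abs_self c
    have hs2 : 0 ≤ s / 2 * (inner ℝ (b 1) z * inner ℝ (b 1) z +
        inner ℝ (b 2) z * inner ℝ (b 2) z) :=
      mul_nonneg (by positivity) (add_nonneg (mul_self_nonneg _) (mul_self_nonneg _))
    have h3 : |inner ℝ (b 0) z| ≤ M := by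
      have h5 : 0 ≤ 2 * |c| / s := by positivity
      have h6 := neg_abs_le α
      have h7 := le_abs_self α
      rw [abs_le]
      constructor <;> linarith
    have h4 : inner ℝ (b 1) z ^ 2 + inner ℝ (b 2) z ^ 2 ≤ M := by
      have : (inner ℝ (b 1) z ^ 2 + inner ℝ (b 2) z ^ 2) ≤ 2 * |c| / s := by
        rw [le_div_iff₀ hs]
        linarith
      have h8 : 0 ≤ |α| := abs_nonneg α
      linarith
    have h5 : inner ℝ (b 0) z ^ 2 ≤ M ^ 2 := by
      rw [← sq_abs]; gcongr
    nlinarith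

/-- A translator that is small on a disc and larger further along the axis grows linearly. -/
theorem Tr.barrier (hφ : Tr φ) (b : OB) {h c α s : ℝ} (hh : 0 < h) (hc : 0 < c) (hα : 0 ≤ α)
    (hs : 0 < s) (hdisc : ∀ x, inner ℝ (b 0) x = α →
      s * (inner ℝ (b 1) x ^ 2 + inner ℝ (b 2) x ^ 2) ≤ 2 * c → φ x ≤ h)
    (haxis : h + 2 ≤ φ ((α + c / 2) • b 0)) :
    ∃ e : E3, ‖e‖ = 1 ∧ ‖e - b 0‖ ^ 2 ≤ 8 * c * s ∧ Slab φ e (1 / (6 * s)) (α + 2 * c) := by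
  obtain ⟨m, hm⟩ : ∃ m, exp (-(1 / 2) * h) / c = m := ⟨_, rfl⟩
  have hm0 : 0 < m := by rw [← hm]; positivity
  have hmc : m * c = exp (-(1 / 2) * h) := by rw [← hm]; exact div_mul_cancel₀ _ hc.ne'
  let Φ : E3 → ℝ := fun z => exp (-(1 / 2) * φ z) - m * pq b c α s z
  have cpq : Continuous (pq b c α s) := by
    unfold pq
    fun_prop
  have hΦ : Continuous Φ := by
    have := hφ.sm.continuous
    fun_prop
  have haK : (α + c / 2) • b 0 ∈ {z : E3 | α ≤ inner ℝ (b 0) z ∧ 0 ≤ pq b c α s z} := by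
    constructor
    · rw [inner_smul_right, OB_inner]; simp; positivity
    · simp only [pq, inner_smul_right, OB_inner]
      simp
      linarith
  have haΦ : Φ ((α + c / 2) • b 0) < 0 := by
    have h1 : pq b c α s ((α + c / 2) • b 0) = c / 2 := by
      simp only [pq, inner_smul_right, OB_inner]
      simp
      ring
    have h2 : exp (-(1 / 2) * φ ((α + c / 2) • b 0)) ≤ exp (-(1 / 2) * h) * exp (-1) := by
      rw [← exp_add]
      exact exp_le_exp.2 (by linarith)
    have h3 : exp (-1) < 1 / 2 := by
      rw [exp_neg, one_div]
      exact inv_strictAnti₀ (by norm_num) (by linarith [exp_one_gt_d9])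
    have h4 := mul_lt_mul_of_pos_left h3 (exp_pos (-(1 / 2) * h))
    simp only [Φ, h1]
    linarith
  obtain ⟨q, ⟨hq1, hq2⟩, hmin⟩ := (isCompact_pq b c α hs).exists_isMinOn ⟨_, haK⟩ hΦ.continuousOn
  have hqΦ : Φ q < 0 := lt_of_le_of_lt (hmin haK) haΦ
  have hqΦ : exp (-(1 / 2) * φ q) < m * pq b c α s q := by
    simp only [Φ] at hqΦ; linarith
  have hqQ : 0 < pq b c α s q := by
    refine lt_of_le_of_ne hq2 fun he => ?_
    rw [← he, mul_zero] at hqΦ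
    exact absurd (exp_pos (-(1 / 2) * φ q)) hqΦ.le.not_gt
  have hzz : 0 ≤ s * (inner ℝ (b 1) q ^ 2 + inner ℝ (b 2) q ^ 2) := by positivity
  have hqQ' : 0 < c - (inner ℝ (b 0) q - α) -
      s / 2 * (inner ℝ (b 1) q ^ 2 + inner ℝ (b 2) q ^ 2) := by
    have := hqQ
    unfold pq at this
    linarith
  have hqc : pq b c α s q ≤ c := by
    unfold pq
    linarith
  have hqh : h < φ q := by
    have h1 : exp (-(1 / 2) * φ q) < exp (-(1 / 2) * h) := by
      rw [← hmc]
      exact hqΦ.trans_le (by gcongr)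
    have := exp_lt_exp.1 h1
    linarith
  have hq1' : α < inner ℝ (b 0) q := by
    refine lt_of_le_of_ne hq1 fun he => ?_
    exact absurd (hdisc q he.symm (by linarith)) (not_le.2 hqh)
  have hloc : IsLocalMin Φ q := by
    have o1 : IsOpen {z : E3 | α < inner ℝ (b 0) z} := isOpen_lt continuous_const (by fun_prop)
    have o2 : IsOpen {z : E3 | 0 < pq b c α s z} := isOpen_lt continuous_const cpq
    refine IsMinOn.isLocalMin hmin ?_
    filter_upwards [o1.mem_nhds hq1', o2.mem_nhds hqQ] with z h1 h2 using ⟨le_of_lt h1, le_of_lt h2⟩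
  obtain ⟨hgrad, hE⟩ := hφ.barrier_min b hs.le hm0.le hloc
  have hE0 := exp_pos (-(1 / 2) * φ q)
  obtain ⟨lam, hlam⟩ : ∃ l, 2 * m / exp (-(1 / 2) * φ q) = l := ⟨_, rfl⟩
  have hl0 : 0 < lam := by rw [← hlam]; positivity
  have hlE : lam * exp (-(1 / 2) * φ q) = 2 * m := by rw [← hlam]; exact div_mul_cancel₀ _ hE0.ne'
  have hls : 1 / (6 * s) ≤ lam := by
    rw [← hlam, div_le_div_iff₀ (by positivity) hE0]
    linarith
  let n : E3 := b 0 + (s * inner ℝ (b 1) q) • b 1 + (s * inner ℝ (b 2) q) • b 2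
  have hnv : ∀ v, inner ℝ n v = inner ℝ (b 0) v +
      s * (inner ℝ (b 1) q * inner ℝ (b 1) v + inner ℝ (b 2) q * inner ℝ (b 2) v) := by
    intro v
    simp only [n, inner_add_left, real_inner_smul_left]
    ring
  have hgr : gr φ q = lam • n := by
    refine ext_inner_right ℝ fun v => ?_
    rw [← dd_eq_inner_gr, real_inner_smul_left, hnv]
    have h1 := hgrad v
    refine mul_left_cancel₀ hE0.ne' ?_
    rw [← mul_assoc, mul_comm (exp _) lam, hlE]
    linarith
  have hd : ‖n - b 0‖ ^ 2 ≤ 2 * c * s := by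
    have : n - b 0 = (s * inner ℝ (b 1) q) • b 1 + (s * inner ℝ (b 2) q) • b 2 := by
      simp only [n]; abel
    rw [this, ← sum_sq_b b, Fin.sum_univ_three]
    simp only [inner_add_right, inner_smul_right, OB_inner]
    simp
    have h1 : s * (inner ℝ (b 1) q ^ 2 + inner ℝ (b 2) q ^ 2) ≤ 2 * c := by linarith
    have := mul_le_mul_of_nonneg_left h1 hs.le
    linarith
  have hn1 : 1 ≤ ‖n‖ := by
    have h1 : inner ℝ n (b 0) = 1 := by
      rw [hnv]; simp only [OB_inner]; simp
    have := real_inner_le_norm n (b 0)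
    rwa [h1, b.norm_eq_one, mul_one] at this
  have hgn : ‖gr φ q‖ = lam * ‖n‖ := by rw [hgr, norm_smul, Real.norm_of_nonneg hl0.le]
  have hn0 : 0 < ‖n‖ := by linarith
  have heq : ‖gr φ q‖⁻¹ • gr φ q = ‖n‖⁻¹ • n := by
    rw [hgn, hgr, smul_smul, mul_inv, mul_assoc, mul_comm ‖n‖⁻¹ lam, ← mul_assoc,
      inv_mul_cancel₀ hl0.ne', one_mul]
  refine ⟨‖n‖⁻¹ • n, ?_, ?_, ?_⟩
  · rw [norm_smul, norm_inv, norm_norm, inv_mul_cancel₀ hn0.ne']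
  · have h1 : ‖‖n‖⁻¹ • n - n‖ = ‖n‖ - 1 := by
      have : ‖n‖⁻¹ • n - n = (‖n‖⁻¹ - 1) • n := by rw [sub_smul, one_smul]
      rw [this, norm_smul, Real.norm_of_nonpos (by
        have := inv_le_one_of_one_le₀ hn1
        linarith), neg_mul, sub_mul, inv_mul_cancel₀ hn0.ne']
      ring
    have h2 : ‖n‖ ≤ ‖n - b 0‖ + 1 := by
      have := norm_add_le (n - b 0) (b 0)
      rwa [sub_add_cancel, b.norm_eq_one] at this
    have h3 : ‖‖n‖⁻¹ • n - b 0‖ ≤ 2 * ‖n - b 0‖ := by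
      have := norm_add_le (‖n‖⁻¹ • n - n) (n - b 0)
      rw [sub_add_sub_cancel] at this
      linarith
    have h4 := pow_le_pow_left₀ (norm_nonneg _) h3 2
    linarith
  · rw [← heq]
    refine hφ.slab_of_gr (by rw [hgn]; positivity) ?_ ?_
    · rw [hgn]
      have : lam * 1 ≤ lam * ‖n‖ := by gcongr
      linarith
    · rw [dd_eq_inner_gr, hgr, real_inner_smul_left, hnv, norm_smul, Real.norm_of_nonneg hl0.le]
      have h1 : inner ℝ (b 0) q + s * (inner ℝ (b 1) q * inner ℝ (b 1) q +
          inner ℝ (b 2) q * inner ℝ (b 2) q) ≤ α + 2 * c := by linarith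
      have h2 : lam * (α + 2 * c) * 1 ≤ lam * (α + 2 * c) * ‖n‖ := by gcongr
      have h3 := mul_le_mul_of_nonneg_left h1 hl0.le
      linarith

end

section

/-! ### Low points -/

open Matrix

variable {φ u w : E3 → ℝ}

theorem tenth_le_arctan_sub : arctan 2 + 1 / 10 ≤ arctan 3 := by
  have hm : MonotoneOn (fun x => arctan x - x / 10) (Set.Icc 2 3) := by
    have hd : ∀ x : ℝ, HasDerivAt (fun x => arctan x - x / 10) (1 / (1 + x ^ 2) - 1 / 10) x :=
      fun x => (hasDerivAt_arctan x).sub ((hasDerivAt_id' x).div_const 10)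
    refine monotoneOn_of_deriv_nonneg (convex_Icc 2 3)
      (fun x _ => (hd x).continuousAt.continuousWithinAt)
      (fun x _ => (hd x).differentiableAt.differentiableWithinAt) fun x hx => ?_
    rw [interior_Icc] at hx
    rw [(hd x).deriv, sub_nonneg]
    refine one_div_le_one_div_of_le (by positivity) ?_
    nlinarith [hx.1, hx.2]
  have := hm (a := 2) (b := 3) (by norm_num) (by norm_num) (by norm_num)
  norm_num at this ⊢
  linarith

/-- Along a unit line, `arctan` of the slope grows at most linearly. -/
theorem Tr.arctan_slope_le (hφ : Tr φ) {e : E3} (he : ‖e‖ = 1) {s t : ℝ} (hst : s ≤ t) :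
    arctan (dd e φ (t • e)) - t ≤ arctan (dd e φ (s • e)) - s := by
  have hd : ∀ t : ℝ, HasDerivAt (fun t => arctan (dd e φ (t • e)) - t)
      (1 / (1 + dd e φ (t • e) ^ 2) * dd e (dd e φ) (t • e) - 1) t := by
    intro t
    have h := hasDerivAt_line (hφ.sm.dd (e := e)) 0 e t
    simp only [zero_add] at h
    exact h.arctan.sub (hasDerivAt_id' t)
  refine antitone_of_hasDerivAt_nonpos hd (fun t => ?_) hst
  have h := hφ.hess_le e (t • e)
  rw [he] at h
  have hp : 0 < 1 + dd e φ (t • e) ^ 2 := by positivity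
  show 1 / (1 + dd e φ (t • e) ^ 2) * dd e (dd e φ) (t • e) - 1 ≤ 0
  rw [one_div_mul_eq_div, sub_nonpos, div_le_one hp]
  linarith

theorem Tr.le_near_zero (hφ : Tr φ) (h0 : φ 0 = 0) (hlow : ∀ z, -(2 * ‖z‖) ≤ φ z) {e : E3}
    (he : ‖e‖ = 1) {t : ℝ} (ht : 0 ≤ t) (ht' : t ≤ 1 / 20) : φ (t • e) ≤ 3 * t := by
  have h1 : dd e φ ((-(1 / 20) : ℝ) • e) ≤ 2 := by
    have h := hφ.grad_le ((-(1 / 20) : ℝ) • e) 0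
    have h2 := hlow ((-(1 / 20) : ℝ) • e)
    rw [norm_smul, he] at h2
    rw [zero_sub, neg_smul, neg_neg, dd_smul_dir, h0] at h
    rw [neg_smul] at h2 ⊢
    norm_num at h2 h ⊢
    linarith
  have h2 := hφ.arctan_slope_le he (s := -(1 / 20)) (t := t) (by linarith)
  have h3 : arctan (dd e φ (t • e)) ≤ arctan 3 := by
    have := arctan_strictMono.monotone h1
    have := tenth_le_arctan_sub
    linarith
  have h4 := arctan_strictMono.le_iff_le.1 h3
  have h := hφ.grad_le (t • e) 0
  rw [zero_sub, ← neg_smul, dd_smul_dir, h0] at h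
  have := mul_le_mul_of_nonneg_left h4 ht
  linarith

/-- If a translator is large on the long sides of a rectangle, then it is small somewhere on the
short side. -/
theorem Tr.exists_low (hφ : Tr φ) (h0 : φ 0 = 0) (hlow : ∀ z, -(2 * ‖z‖) ≤ φ z) {y e : E3}
    (hy : ‖y‖ = 1) (he : ‖e‖ = 1) (hye : inner ℝ y e = 0) {B r h : ℝ} (hB : 2 ≤ B) (hr : 0 < r)
    (hBr : 3 * B * r + 3 / 2 * B ^ 2 < h)
    (hbox : ∀ s, -(2 * B) ≤ s → s ≤ r → h ≤ φ (s • y + B • e) ∧ h ≤ φ (s • y + (-B) • e)) :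
    ∃ z, -B ≤ z ∧ z ≤ B ∧ φ (r • y + z • e) ≤ h := by
  by_contra! hcon
  have hey : inner ℝ e y = 0 := by rw [real_inner_comm]; exact hye
  have hyy : inner ℝ y y = 1 := by rw [real_inner_self_eq_norm_sq, hy]; norm_num
  have hee : inner ℝ e e = 1 := by rw [real_inner_self_eq_norm_sq, he]; norm_num
  let G : E3 → ℝ := fun z => φ z - (3 * B * inner ℝ y z + 3 / 2 * (inner ℝ e z * inner ℝ e z))
  have j := fun x v : E3 => (J.of hφ.sm x v v).sub (((J.inner x v v y).smul (3 * B)).add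
    (((J.inner x v v e).mul (J.inner x v v e)).smul (3 / 2)))
  have hG : ∀ s t : ℝ, G (s • y + t • e) = φ (s • y + t • e) - (3 * B * s + 3 / 2 * t ^ 2) := by
    intro s t
    simp only [G, inner_add_right, inner_smul_right, hyy, hye, hey, hee]
    ring
  have hsmG : Sm G := (j 0 0).sm
  have hc : Continuous fun p : ℝ × ℝ => G (p.1 • y + p.2 • e) := by
    have := hsmG.continuous
    fun_prop
  obtain ⟨⟨s, t⟩, ⟨hs, ht⟩, hmin⟩ :=
    (isCompact_Icc (a := -(2 * B)) (b := r)).prod (isCompact_Icc (a := -B) (b := B))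
      |>.exists_isMinOn ⟨(0, 0), ⟨⟨by linarith, by linarith⟩, ⟨by linarith, by linarith⟩⟩⟩
        hc.continuousOn
  have hG0 : G (s • y + t • e) ≤ 0 := by
    have h2 : G (s • y + t • e) ≤ G ((0 : ℝ) • y + (0 : ℝ) • e) := hmin (a := (0, 0))
      ⟨⟨by simp; linarith, by simp; linarith⟩, ⟨by simp; linarith, by simp; linarith⟩⟩
    have h3 := hG 0 0
    simp only [zero_smul, add_zero, h0] at h2 h3
    linarith
  simp only at hs ht
  have ht2 : t ^ 2 ≤ B ^ 2 := sq_le_sq' ht.1 ht.2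
  have hsr : 3 * B * s ≤ 3 * B * r := mul_le_mul_of_nonneg_left hs.2 (by linarith)
  rw [hG] at hG0
  have i1 : t < B := by
    refine lt_of_le_of_ne ht.2 fun h' => ?_
    have := (hbox s hs.1 hs.2).1
    rw [← h'] at this
    linarith
  have i2 : -B < t := by
    refine lt_of_le_of_ne ht.1 fun h' => ?_
    have := (hbox s hs.1 hs.2).2
    rw [h'] at this
    linarith
  have i3 : s < r := by
    refine lt_of_le_of_ne hs.2 fun h' => ?_
    have := hcon t ht.1 ht.2
    rw [← h'] at this
    linarith
  have i4 : -(2 * B) < s := by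
    refine lt_of_le_of_ne hs.1 fun h' => ?_
    have h1 := hlow (s • y + t • e)
    have h2 := norm_add_le (s • y) (t • e)
    rw [norm_smul, norm_smul, hy, he, ← h', Real.norm_eq_abs, Real.norm_eq_abs, abs_neg,
      abs_of_nonneg (by linarith : 0 ≤ 2 * B)] at h2
    have h3 : |t| ≤ B := abs_le.2 ht
    rw [← h'] at h1 hG0
    nlinarith
  let ζ : E3 := B • e + (-t) • y
  have hζ : ∀ τ : ℝ, s • y + t • e + τ • ζ = (s - τ * t) • y + (t + τ * B) • e := by
    intro τ
    simp only [ζ]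
    module
  have hlm : IsLocalMin (fun τ : ℝ => G (s • y + t • e + τ • ζ)) 0 := by
    have c1 : ContinuousAt (fun τ : ℝ => s - τ * t) 0 := by fun_prop
    have c2 : ContinuousAt (fun τ : ℝ => t + τ * B) 0 := by fun_prop
    have n1 : Set.Ioo (-(2 * B)) r ∈ nhds (s - 0 * t) := by
      rw [zero_mul, sub_zero]; exact Ioo_mem_nhds i4 i3
    have n2 : Set.Ioo (-B) B ∈ nhds (t + 0 * B) := by
      rw [zero_mul, add_zero]; exact Ioo_mem_nhds i2 i1
    filter_upwards [c1.preimage_mem_nhds n1, c2.preimage_mem_nhds n2] with τ m1 m2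
    rw [hζ τ, zero_smul, add_zero]
    exact hmin (a := (s - τ * t, t + τ * B)) ⟨⟨m1.1.le, m1.2.le⟩, ⟨m2.1.le, m2.2.le⟩⟩
  have hd := deriv2_nonneg_of_min (fun τ => hasDerivAt_line hsmG (s • y + t • e) ζ τ)
    (hasDerivAt_line (hsmG.dd ζ) (s • y + t • e) ζ 0) hlm
  rw [zero_smul, add_zero] at hd
  obtain ⟨d1, d2⟩ := hd
  have k1 := (j (s • y + t • e) ζ).fst
  have k2 := (j (s • y + t • e) ζ).hes
  have hyζ : inner ℝ y ζ = -t := by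
    simp only [ζ, inner_add_right, inner_smul_right, hyy, hye]; ring
  have heζ : inner ℝ e ζ = B := by
    simp only [ζ, inner_add_right, inner_smul_right, hee, hey]; ring
  have hez : inner ℝ e (s • y + t • e) = t := by
    simp only [inner_add_right, inner_smul_right, hee, hey]; ring
  change dd ζ G _ = _ at k1
  change dd ζ (dd ζ G) _ = _ at k2
  rw [k1, hyζ, heζ, hez] at d1
  rw [k2, heζ] at d2
  have h5 := hφ.hess_le ζ (s • y + t • e)
  have h6 : ‖ζ‖ ^ 2 = B ^ 2 + t ^ 2 := by
    rw [← real_inner_self_eq_norm_sq]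
    simp only [ζ, inner_add_right, inner_add_left, inner_smul_right, real_inner_smul_left, hee,
      hey, hye, hyy]
    ring
  have h7 : dd ζ φ (s • y + t • e) = 0 := by linarith
  rw [h6, h7] at h5
  nlinarith

end

section

/-! ### Convex hulls of low points -/

open Matrix

variable {φ u w : E3 → ℝ}

theorem Tr.two_points_aux (hφ : Tr φ) (h0 : φ 0 = 0) (hlow : ∀ z, -(2 * ‖z‖) ≤ φ z) {e f y : E3}
    (he : ‖e‖ = 1) (hf : ‖f‖ = 1) (hy : ‖y‖ = 1) (hye : inner ℝ y e = 0)
    (hef : inner ℝ e f ≤ -(199 / 200)) {D r h : ℝ} (hD : 1 ≤ D) (hr : 0 < r)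
    (hBr : 12 * D * r + 24 * D ^ 2 < h) (hE : ∀ z, D ≤ inner ℝ e z → h ≤ φ z)
    (hE' : ∀ z, φ z ≤ h → inner ℝ e z ≤ D) (hF : ∀ z, D ≤ inner ℝ f z → h ≤ φ z)
    (hF' : ∀ z, φ z ≤ h → inner ℝ f z ≤ D) (hfy : inner ℝ f y ≤ 1 / 10) (hfy0 : 0 ≤ inner ℝ f y) :
    r * inner ℝ f y ≤ 2 * D ∧
      (∃ z, -(4 * D) ≤ z ∧ z ≤ D ∧ φ (r • y + z • e) ≤ h) ∧
      ∃ z, -(4 * D) ≤ z ∧ z ≤ D ∧ φ (r • (-y) + z • e) ≤ h := by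
  have hey : inner ℝ e y = 0 := by rw [real_inner_comm]; exact hye
  have hee : inner ℝ e e = 1 := by rw [real_inner_self_eq_norm_sq, he]; norm_num
  have hfe : inner ℝ f e ≤ -(199 / 200) := by rw [real_inner_comm]; exact hef
  have hfe1 : -1 ≤ inner ℝ f e := by
    have := neg_abs_le (inner ℝ f e)
    have h2 := abs_real_inner_le_norm f e
    rw [he, hf] at h2
    linarith
  have ee : ∀ s t : ℝ, inner ℝ e (s • y + t • e) = t := by
    intro s t
    rw [inner_add_right, inner_smul_right, inner_smul_right, hey, hee]; ring
  have ff : ∀ s t : ℝ, inner ℝ f (s • y + t • e) = s * inner ℝ f y + t * inner ℝ f e := by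
    intro s t
    rw [inner_add_right, inner_smul_right, inner_smul_right]
  have hBr' : 3 * (4 * D) * r + 3 / 2 * (4 * D) ^ 2 < h := by linarith
  obtain ⟨z, z1, z2, z3⟩ := hφ.exists_low h0 hlow hy he hye (B := 4 * D) (by linarith) hr hBr'
    fun s hs hs' => ⟨hE _ (by rw [ee]; linarith), hF _ (by rw [ff]; nlinarith)⟩
  have zD : z ≤ D := by
    have := hE' _ z3
    rwa [ee] at this
  have hrf : r * inner ℝ f y ≤ 2 * D := by
    have := hF' _ z3
    rw [ff] at this
    nlinarith
  refine ⟨hrf, ⟨z, z1, zD, z3⟩, ?_⟩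
  have hn : ∀ s t : ℝ, s • (-y) + t • e = (-s) • y + t • e := fun s t => by
    rw [smul_neg, neg_smul]
  obtain ⟨z', y1, y2, y3⟩ := hφ.exists_low h0 hlow (y := -y) (by rw [norm_neg, hy]) he
    (by rw [inner_neg_left, hye, neg_zero]) (B := 4 * D) (by linarith) hr hBr'
    fun s hs hs' => ⟨hE _ (by rw [hn, ee]; linarith), hF _ (by rw [hn, ff]; nlinarith)⟩
  refine ⟨z', y1, ?_, y3⟩
  have := hE' _ y3
  rwa [hn, ee] at this

theorem Tr.two_points (hφ : Tr φ) (h0 : φ 0 = 0) (hlow : ∀ z, -(2 * ‖z‖) ≤ φ z) {e f y : E3}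
    (he : ‖e‖ = 1) (hf : ‖f‖ = 1) (hy : ‖y‖ = 1) (hye : inner ℝ y e = 0)
    (hef : inner ℝ e f ≤ -(199 / 200)) {D r h : ℝ} (hD : 1 ≤ D) (hr : 0 < r)
    (hBr : 12 * D * r + 24 * D ^ 2 < h) (hE : ∀ z, D ≤ inner ℝ e z → h ≤ φ z)
    (hE' : ∀ z, φ z ≤ h → inner ℝ e z ≤ D) (hF : ∀ z, D ≤ inner ℝ f z → h ≤ φ z)
    (hF' : ∀ z, φ z ≤ h → inner ℝ f z ≤ D) (hfy : |inner ℝ f y| ≤ 1 / 10) :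
    r * |inner ℝ f y| ≤ 2 * D ∧
      (∃ z, -(4 * D) ≤ z ∧ z ≤ D ∧ φ (r • y + z • e) ≤ h) ∧
      ∃ z, -(4 * D) ≤ z ∧ z ≤ D ∧ φ (r • (-y) + z • e) ≤ h := by
  rcases le_total 0 (inner ℝ f y) with hs | hs
  · rw [abs_of_nonneg hs] at hfy ⊢
    exact hφ.two_points_aux h0 hlow he hf hy hye hef hD hr hBr hE hE' hF hF' hfy hs
  · rw [abs_of_nonpos hs] at hfy ⊢
    have := hφ.two_points_aux h0 hlow he hf (y := -y) (by rw [norm_neg, hy])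
      (by rw [inner_neg_left, hye, neg_zero]) hef hD hr hBr hE hE' hF hF'
      (by rwa [inner_neg_right]) (by rw [inner_neg_right]; linarith)
    rw [inner_neg_right, neg_neg] at this
    exact ⟨this.1, this.2.2, this.2.1⟩

theorem Tr.comb_le (hφ : Tr φ) {x y : E3} {a c h : ℝ} (hx : φ x ≤ h) (hy : φ y ≤ h) (ha : 0 ≤ a)
    (hc : 0 ≤ c) (hac : a + c = 1) : φ (a • x + c • y) ≤ h := by
  have h1 := hφ.conv.2 (Set.mem_univ x) (Set.mem_univ y) ha hc hac
  simp only [smul_eq_mul] at h1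
  have h2 := mul_le_mul_of_nonneg_left hx ha
  have h3 := mul_le_mul_of_nonneg_left hy hc
  have h4 : a * h + c * h = h := by rw [← add_mul, hac, one_mul]
  linarith

theorem Tr.smul_le (hφ : Tr φ) (h0 : φ 0 = 0) {x : E3} {a : ℝ} (ha : 0 ≤ a) (ha' : a ≤ 1) :
    φ (a • x) ≤ a * φ x := by
  have h1 := hφ.conv.2 (Set.mem_univ x) (Set.mem_univ 0) ha (sub_nonneg.2 ha')
    (add_sub_cancel a 1)
  simpa [h0] using h1

/-- Convexity fills a segment through a point of the axis. -/
theorem Tr.segment_le (hφ : Tr φ) (h0 : φ 0 = 0) {e y : E3} {h g α ε r D z τ : ℝ} (hh : 0 ≤ h)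
    (hg : φ (g • e) ≤ h) (hz : φ (r • y + z • e) ≤ h) (hε : 0 ≤ ε) (hε1 : ε ≤ 1) (hr : 0 < ε * r)
    (hα : 0 < α) (hαg : α ≤ g) (hz0 : -(4 * D) ≤ z) (hz1 : z ≤ D)
    (h1 : α ≤ (1 - ε) * g - 4 * D * ε) (h2 : (1 - ε) * g + D * ε ≤ 2 * α) (hτ : 0 ≤ τ)
    (hτ' : τ ≤ ε * r / 2) : φ (α • e + τ • y) ≤ h := by
  obtain ⟨β, hβ⟩ : ∃ β, (1 - ε) * g + ε * z = β := ⟨_, rfl⟩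
  have e1 := mul_le_mul_of_nonneg_left hz0 hε
  have e2 := mul_le_mul_of_nonneg_left hz1 hε
  have b1 : α ≤ β := by linarith
  have b2 : β ≤ 2 * α := by linarith
  have b0 : 0 < β := by linarith
  have hg0 : 0 < g := by linarith
  have p1 : φ ((1 - ε) • (g • e) + ε • (r • y + z • e)) ≤ h :=
    hφ.comb_le hg hz (by linarith) hε (by ring)
  have p2 : φ ((α / β) • ((1 - ε) • (g • e) + ε • (r • y + z • e))) ≤ h := by
    have q1 : α / β ≤ 1 := (div_le_one b0).2 b1
    have q0 : 0 ≤ α / β := by positivity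
    refine (hφ.smul_le h0 q0 q1).trans ?_
    nlinarith
  have p3 : φ ((α / g) • (g • e)) ≤ h := by
    have q1 : α / g ≤ 1 := (div_le_one hg0).2 hαg
    have q0 : 0 ≤ α / g := by positivity
    refine (hφ.smul_le h0 q0 q1).trans ?_
    nlinarith
  have p3' : φ (α • e) ≤ h := by
    rwa [smul_smul, div_mul_cancel₀ _ hg0.ne'] at p3
  have hT : 0 < α / β * (ε * r) := by positivity
  have hT2 : ε * r / 2 ≤ α / β * (ε * r) := by
    have : 1 / 2 ≤ α / β := by
      rw [div_le_div_iff₀ (by norm_num) b0]; linarith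
    nlinarith
  have p2' : (α / β) • ((1 - ε) • (g • e) + ε • (r • y + z • e)) =
      α • e + (α / β * (ε * r)) • y := by
    have : α • e = (α / β * β) • e := by rw [div_mul_cancel₀ _ b0.ne']
    rw [this, ← hβ]
    module
  rw [p2'] at p2
  obtain ⟨T, hTe⟩ : ∃ T, α / β * (ε * r) = T := ⟨_, rfl⟩
  rw [hTe] at p2 hT hT2
  have := hφ.comb_le (a := τ / T) (c := 1 - τ / T) p2 p3' (by positivity)
    (by rw [sub_nonneg, div_le_one hT]; linarith) (by ring)
  convert this using 2
  have : τ • y = (τ / T * T) • y := by rw [div_mul_cancel₀ _ hT.ne']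
  rw [this]
  module

theorem Tr.disc_le (hφ : Tr φ) (b : OB) {h α R : ℝ}
    (h1 : ∀ τ, |τ| ≤ 2 * R → φ (α • b 0 + τ • b 1) ≤ h)
    (h2 : ∀ τ, |τ| ≤ 2 * R → φ (α • b 0 + τ • b 2) ≤ h) (hR : 0 ≤ R) {x : E3}
    (hx : inner ℝ (b 0) x = α) (hxR : inner ℝ (b 1) x ^ 2 + inner ℝ (b 2) x ^ 2 ≤ R ^ 2) :
    φ x ≤ h := by
  have k1 : |inner ℝ (b 1) x| ≤ R := abs_le_of_sq_le_sq (by nlinarith [sq_nonneg (inner ℝ (b 2) x)]) hR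
  have k2 : |inner ℝ (b 2) x| ≤ R := abs_le_of_sq_le_sq (by nlinarith [sq_nonneg (inner ℝ (b 1) x)]) hR
  have hs : x = (1 / 2 : ℝ) • (α • b 0 + (2 * inner ℝ (b 1) x) • b 1) +
      (1 / 2 : ℝ) • (α • b 0 + (2 * inner ℝ (b 2) x) • b 2) := by
    have := b.sum_repr' x
    rw [Fin.sum_univ_three, hx] at this
    rw [← this]
    simp only [inner_add_right, inner_smul_right, OB_inner]
    simp
    module
  rw [hs]
  refine hφ.comb_le (h1 _ ?_) (h2 _ ?_) (by norm_num) (by norm_num) (by norm_num) <;>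
  · rw [abs_mul, abs_two]; linarith

end

section

/-! ### Improvement of slabs -/

open Matrix

variable {φ u w : E3 → ℝ}

theorem Slab.lower {e : E3} {Λ ρ ε : ℝ} (hS : Slab φ e Λ ρ) (hΛ : 0 < Λ) (hρ : 0 < ρ)
    (hε : 0 < ε) :
    (∀ z, (1 + ε) * ρ ≤ inner ℝ e z → ε * Λ * ρ ≤ φ z) ∧
      ∀ z, φ z ≤ ε * Λ * ρ → inner ℝ e z ≤ (1 + ε) * ρ := by
  have hερ : 0 < ε * ρ := by positivity
  refine ⟨fun z hz => (hS z (by linarith)).trans' ?_, fun z hz => ?_⟩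
  · have := mul_le_mul_of_nonneg_left (show ε * ρ ≤ inner ℝ e z - ρ by linarith) hΛ.le
    linarith
  · by_contra! hc
    have h1 := hS z (by linarith)
    have := mul_lt_mul_of_pos_left (show ε * ρ < inner ℝ e z - ρ by linarith) hΛ
    linarith

theorem Tr.exists_level (hφ : Tr φ) (h0 : φ 0 = 0) (hlow : ∀ z, -(2 * ‖z‖) ≤ φ z) {e : E3}
    (he : ‖e‖ = 1) {D h : ℝ} (hD : 0 ≤ D) (hh : 1 ≤ h) (hDh : h ≤ φ (D • e)) :
    ∃ g, 1 / 20 ≤ g ∧ g ≤ D ∧ φ (g • e) = h := by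
  have hc : Continuous fun t : ℝ => φ (t • e) := by
    have := hφ.sm.continuous
    fun_prop
  obtain ⟨g, hg, hgh⟩ := intermediate_value_Icc hD hc.continuousOn
    (show h ∈ Set.Icc (φ ((0 : ℝ) • e)) (φ (D • e)) from
      ⟨by rw [zero_smul, h0]; linarith, hDh⟩)
  refine ⟨g, ?_, hg.2, hgh⟩
  by_contra! hlt
  have := hφ.le_near_zero h0 hlow he hg.1 hlt.le
  simp only at hgh
  linarith

theorem improve_slab_scalars {ε Λ ρ : ℝ} (hε : 0 < ε) (hε' : ε ≤ 1 / 10000) (hρ : 7 ≤ ρ)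
    (hS : 1000000000 ≤ ε ^ 3 * Λ) :
    0 < Λ ∧ 10 ^ 13 ≤ ε ^ 2 * Λ ∧ 10 ^ 17 ≤ ε * Λ ∧ 10 ^ 18 / 2 ≤ ε * Λ * ρ ∧
      2 ≤ 10 * ε * (ε * Λ * ρ) := by
  have hΛ : 0 < Λ := by
    by_contra! hc
    have : ε ^ 3 * Λ ≤ 0 := mul_nonpos_of_nonneg_of_nonpos (by positivity) hc
    linarith
  have h2 : 10 ^ 13 ≤ ε ^ 2 * Λ := by
    have : ε * (ε ^ 2 * Λ) ≤ 1 / 10000 * (ε ^ 2 * Λ) := by gcongr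
    norm_num
    linarith
  have h3 : 10 ^ 17 ≤ ε * Λ := by
    have : ε * (ε * Λ) ≤ 1 / 10000 * (ε * Λ) := by gcongr
    norm_num at h2 ⊢
    linarith
  refine ⟨hΛ, h2, h3, ?_, ?_⟩
  · have : ε * Λ * 7 ≤ ε * Λ * ρ := by gcongr
    norm_num at h3 ⊢
    linarith
  · have : ε ^ 2 * Λ * 7 ≤ ε ^ 2 * Λ * ρ := by gcongr
    norm_num at h2 ⊢
    linarith

theorem improve_slab_rate {ε Λ D R s : ℝ} (hε : 0 < ε) (hΛ : 0 < Λ) (hD : 0 < D)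
    (hD15 : D ≤ 141 / 10) (hS : 1000000000 ≤ ε ^ 3 * Λ) (hε1 : 10 ^ 17 ≤ ε * Λ)
    (hRe : R = ε ^ 2 * Λ / 84) (hs0 : 0 < s) (hsR : s * R ^ 2 = 2 * (30 * D * ε)) :
    8 * (30 * D * ε) * s ≤ (1 / 1000) ^ 2 ∧ 16 * Λ ≤ 1 / (6 * s) := by
  have hR0 : 0 < R := by rw [hRe]; positivity
  have hR2 : 0 < R ^ 2 := by positivity
  have hc0 : 0 < 30 * D * ε := by positivity
  constructor
  · have hcR : 30 * D * ε ≤ 1 / 100000 * R := by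
      rw [hRe]
      have h1 : ε * 10 ^ 17 ≤ ε * (ε * Λ) := mul_le_mul_of_nonneg_left hε1 hε.le
      have q : ε * D ≤ ε * (141 / 10) := mul_le_mul_of_nonneg_left hD15 hε.le
      norm_num at h1
      linarith
    refine le_of_mul_le_mul_right (a := R ^ 2) ?_ hR2
    have h2 := pow_le_pow_left₀ hc0.le hcR 2
    have h3 : 8 * (30 * D * ε) * s * R ^ 2 = 16 * (30 * D * ε) ^ 2 := by
      rw [mul_assoc _ s, hsR]; ring
    rw [h3]
    generalize (30 * D * ε) ^ 2 = A at *
    rw [mul_pow] at h2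
    linarith
  · rw [le_div_iff₀ (by positivity)]
    refine le_of_mul_le_mul_right (a := R ^ 2) ?_ hR2
    have q1 : 16 * Λ * (6 * s) * R ^ 2 = (ε * Λ) * (D * 5760) := by
      have : 16 * Λ * (6 * s) * R ^ 2 = 96 * Λ * (s * R ^ 2) := by ring
      rw [this, hsR]; ring
    have q5 : 1 * R ^ 2 = (ε * Λ) * (ε ^ 3 * Λ / 7056) := by rw [hRe]; ring
    rw [q1, q5]
    exact mul_le_mul_of_nonneg_left (by linarith) (by positivity)

set_option maxHeartbeats 800000 in
/-- Fast growth on both sides of a slab improves to faster growth outside a slightly larger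
slab. -/
theorem Tr.improve_slab (hφ : Tr φ) (h0 : φ 0 = 0) (hlow : ∀ z, -(2 * ‖z‖) ≤ φ z) {e f : E3}
    (he : ‖e‖ = 1) (hf : ‖f‖ = 1) (hef : inner ℝ e f ≤ -(199 / 200)) {ε Λ ρ : ℝ} (hε : 0 < ε)
    (hε' : ε ≤ 1 / 10000) (hρ : 7 ≤ ρ) (hρ' : ρ ≤ 14) (hS : 1000000000 ≤ ε ^ 3 * Λ)
    (hse : Slab φ e Λ ρ) (hsf : Slab φ f Λ ρ) :
    inner ℝ e f ≤ -(999 / 1000) ∧ ∃ e', ‖e'‖ = 1 ∧ ‖e' - e‖ ≤ 1 / 1000 ∧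
      Slab φ e' (16 * Λ) (ρ + 900 * ε) := by
  obtain ⟨hΛ, hε2, hε1, hh, hhε⟩ := improve_slab_scalars hε hε' hρ hS
  obtain ⟨hE, hE'⟩ := hse.lower hΛ (by linarith) hε
  obtain ⟨hF, hF'⟩ := hsf.lower hΛ (by linarith) hε
  obtain ⟨h, hhd⟩ : ∃ h, ε * Λ * ρ = h := ⟨_, rfl⟩
  obtain ⟨D, hDd⟩ : ∃ D, (1 + ε) * ρ = D := ⟨_, rfl⟩
  obtain ⟨r, hrd⟩ : ∃ r, ε * Λ / 21 = r := ⟨_, rfl⟩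
  rw [hhd, hDd] at hE hE' hF hF'
  rw [hhd] at hh hhε
  have hερ : ε * ρ ≤ 1 / 10000 * ρ := by gcongr
  have hερ0 : 0 < ε * ρ := by positivity
  have hD7 : 7 ≤ D := by linarith
  have hD1 : D ≤ 10001 / 10000 * ρ := by linarith
  have hD15 : D ≤ 141 / 10 := by linarith
  have hr15 : 10 ^ 15 ≤ r := by rw [← hrd]; norm_num at hε1 ⊢; linarith
  have hr0 : 0 < r := lt_of_lt_of_le (by norm_num) hr15
  have hBr : 12 * D * r + 24 * D ^ 2 < h := by
    have q1 : 12 * D * r ≤ 12 * (10001 / 10000 * ρ) * r := by gcongr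
    have q2 : D ^ 2 ≤ (141 / 10) ^ 2 := by gcongr
    have q3 : r * ρ = h / 21 := by rw [← hrd, ← hhd]; ring
    norm_num at hh q2
    linarith
  have hh1 : 1 ≤ h := by norm_num at hh; linarith
  obtain ⟨b, hb⟩ := exists_OB e he
  have hbe : ∀ i, i ≠ 0 → inner ℝ (b i) e = 0 := by
    intro i hi
    rw [← hb, OB_inner, if_neg hi]
  have hsum := sum_sq_b b f
  rw [Fin.sum_univ_three, hf, hb] at hsum
  have hef2 : (199 / 200) ^ 2 ≤ inner ℝ e f ^ 2 := by nlinarith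
  have hab : ∀ v : E3, inner ℝ v f ^ 2 ≤ (1 / 10) ^ 2 → |inner ℝ f v| ≤ 1 / 10 := by
    intro v hv
    rw [real_inner_comm]
    exact abs_le_of_sq_le_sq hv (by norm_num)
  obtain ⟨l1, ⟨z1, z1a, z1b, z1h⟩, z2, z2a, z2b, z2h⟩ := hφ.two_points h0 hlow he hf (b.norm_eq_one 1)
    (hbe 1 (by decide)) hef (by linarith) hr0 hBr hE hE' hF hF'
    (hab _ (by nlinarith [sq_nonneg (inner ℝ (b 2) f)]))
  obtain ⟨l2, ⟨z3, z3a, z3b, z3h⟩, z4, z4a, z4b, z4h⟩ := hφ.two_points h0 hlow he hf (b.norm_eq_one 2)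
    (hbe 2 (by decide)) hef (by linarith) hr0 hBr hE hE' hF hF'
    (hab _ (by nlinarith [sq_nonneg (inner ℝ (b 1) f)]))
  have hsmall : ∀ v : E3, r * |inner ℝ f v| ≤ 2 * D → inner ℝ v f ^ 2 ≤ 1 / 10000 := by
    intro v hv
    have q : |inner ℝ f v| ≤ 1 / 100 := by
      by_contra! hc
      have : (10 ^ 15 : ℝ) * (1 / 100) ≤ r * |inner ℝ f v| := by gcongr
      norm_num at this
      linarith
    rw [real_inner_comm, ← sq_abs]
    have := pow_le_pow_left₀ (abs_nonneg _) q 2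
    norm_num at this ⊢
    linarith
  have s1 := hsmall _ l1
  have s2 := hsmall _ l2
  refine ⟨by
    by_contra! hc
    have : inner ℝ e f ^ 2 < (999 / 1000) ^ 2 := by nlinarith
    norm_num at this
    linarith, ?_⟩
  have hDh : h ≤ φ (D • e) := by
    refine hE _ ?_
    rw [inner_smul_right, real_inner_self_eq_norm_sq, he]; norm_num
  obtain ⟨g, hg20, hgD, hgh⟩ := hφ.exists_level h0 hlow he (by linarith) hh1 hDh
  have hεD : ε * D ≤ 1 / 10000 * (141 / 10) := by gcongr
  have hεg : ε * g ≤ ε * D := by gcongr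
  have hεg' : ε * g ≤ 1 / 10000 * g := by gcongr
  have hεD0 : 0 < ε * D := by positivity
  have hεg0 : 0 < ε * g := by positivity
  obtain ⟨α, hα⟩ : ∃ α, (1 - ε) * g - 4 * D * ε = α := ⟨_, rfl⟩
  have hα0 : 0 < α := by rw [← hα]; linarith
  have hαg : α ≤ g := by rw [← hα]; linarith
  have hα2 : (1 - ε) * g + D * ε ≤ 2 * α := by rw [← hα]; linarith
  have seg : ∀ (y : E3) (z : ℝ), -(4 * D) ≤ z → z ≤ D → φ (r • y + z • e) ≤ h →
      ∀ τ, 0 ≤ τ → τ ≤ ε * r / 2 → φ (α • e + τ • y) ≤ h :=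
    fun y z ha hb hz τ hτ hτ' => hφ.segment_le h0 (by linarith) hgh.le hz hε.le (by linarith)
      (by positivity) hα0 hαg ha hb hα.ge hα2 hτ hτ'
  have seg2 : ∀ (y : E3) (z z' : ℝ), -(4 * D) ≤ z → z ≤ D → φ (r • y + z • e) ≤ h →
      -(4 * D) ≤ z' → z' ≤ D → φ (r • (-y) + z' • e) ≤ h →
      ∀ τ, |τ| ≤ 2 * (ε * r / 4) → φ (α • b 0 + τ • y) ≤ h := by
    intro y z z' k1 k2 k3 k4 k5 k6 τ hτ
    rw [hb]
    rcases le_total 0 τ with ht | ht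
    · rw [abs_of_nonneg ht] at hτ
      exact seg y z k1 k2 k3 τ ht (by linarith)
    · rw [abs_of_nonpos ht] at hτ
      have := seg (-y) z' k4 k5 k6 (-τ) (by linarith) (by linarith)
      rwa [smul_neg, neg_smul, neg_neg] at this
  obtain ⟨R, hR⟩ : ∃ R, ε * r / 4 = R := ⟨_, rfl⟩
  rw [hR] at seg2
  have hR0 : 0 < R := by rw [← hR]; positivity
  have hRe : R = ε ^ 2 * Λ / 84 := by rw [← hR, ← hrd]; ring
  have hc0 : 0 < 30 * D * ε := by positivity
  obtain ⟨s, hs⟩ : ∃ s, 2 * (30 * D * ε) / R ^ 2 = s := ⟨_, rfl⟩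
  have hs0 : 0 < s := by rw [← hs]; positivity
  have hsR : s * R ^ 2 = 2 * (30 * D * ε) := by rw [← hs]; exact div_mul_cancel₀ _ (by positivity)
  have haxis : h + 2 ≤ φ ((α + 30 * D * ε / 2) • b 0) := by
    rw [hb]
    have ht : g + 10 * (ε * D) ≤ α + 30 * D * ε / 2 := by rw [← hα]; linarith
    obtain ⟨t, htd⟩ : ∃ t, α + 30 * D * ε / 2 = t := ⟨_, rfl⟩
    rw [htd] at ht ⊢
    have hg0 : 0 < g := by linarith
    have ht0 : 0 < t := by linarith
    have k := hφ.smul_le h0 (x := t • e) (a := g / t) (by positivity)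
      ((div_le_one ht0).2 (by linarith))
    rw [smul_smul, div_mul_cancel₀ _ ht0.ne', hgh, div_mul_eq_mul_div, le_div_iff₀ ht0] at k
    have k2 : h * (g + 10 * (ε * D)) ≤ h * t := by gcongr
    have k3 : g * (h * ε) ≤ D * (h * ε) := by gcongr
    have k4 : g * 2 ≤ g * (10 * ε * h) := by gcongr
    refine le_of_mul_le_mul_left (a := g) ?_ hg0
    linarith
  obtain ⟨e', n1, n2, n3⟩ := hφ.barrier b (h := h) (c := 30 * D * ε) (α := α) (s := s)
    (by linarith) hc0 hα0.le hs0 (fun x hx hx2 => by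
      refine hφ.disc_le b (seg2 (b 1) z1 z2 z1a z1b z1h z2a z2b z2h)
        (seg2 (b 2) z3 z4 z3a z3b z3h z4a z4b z4h) hR0.le hx ?_
      refine le_of_mul_le_mul_left (a := s) ?_ hs0
      rw [hsR]; exact hx2) haxis
  have rate := improve_slab_rate hε hΛ (by linarith) hD15 hS hε1 hRe hs0 hsR
  refine ⟨e', n1, ?_, ?_⟩
  · rw [hb] at n2
    exact abs_le_of_sq_le_sq' (n2.trans rate.1) (by norm_num) |>.2
  · intro z hz
    have hρ2 : α + 2 * (30 * D * ε) ≤ ρ + 900 * ε := by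
      have q1 : ε * D ≤ ε * (141 / 10) := by gcongr
      have q2 : ε * ρ ≤ ε * 14 := by gcongr
      linarith
    refine (n3 z (by linarith)).trans' ?_
    have m1 : 0 ≤ inner ℝ e' z - (ρ + 900 * ε) := by linarith
    gcongr
    exact rate.2

end

section

/-! ### The lower bound -/

open Matrix

variable {φ u w : E3 → ℝ}

theorem Slab.mono {e : E3} {Λ Λ' ρ ρ' : ℝ} (hS : Slab φ e Λ ρ) (hΛ : 0 ≤ Λ) (hΛ' : Λ' ≤ Λ)
    (hρ : ρ ≤ ρ') : Slab φ e Λ' ρ' := by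
  intro z hz
  have h1 := hS z (by linarith)
  have h2 : Λ' * (inner ℝ e z - ρ') ≤ Λ * (inner ℝ e z - ρ') :=
    mul_le_mul_of_nonneg_right hΛ' (by linarith)
  have h3 : Λ * (inner ℝ e z - ρ') ≤ Λ * (inner ℝ e z - ρ) :=
    mul_le_mul_of_nonneg_left (by linarith) hΛ
  linarith

/-- The translator grows at rate `Λ` outside a slab of width about `2ρ`. -/
def TwoSlabs (φ : E3 → ℝ) (Λ ρ : ℝ) : Prop := ∃ e f : E3, ‖e‖ = 1 ∧ ‖f‖ = 1 ∧
  inner ℝ e f ≤ -(199 / 200) ∧ Slab φ e Λ ρ ∧ Slab φ f Λ ρ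

theorem Tr.improve_twoSlabs (hφ : Tr φ) (h0 : φ 0 = 0) (hlow : ∀ z, -(2 * ‖z‖) ≤ φ z) {ε Λ ρ : ℝ}
    (hε : 0 < ε) (hε' : ε ≤ 1 / 10000) (hρ : 7 ≤ ρ) (hρ' : ρ ≤ 14)
    (hS : 1000000000 ≤ ε ^ 3 * Λ) (h : TwoSlabs φ Λ ρ) :
    TwoSlabs φ (16 * Λ) (ρ + 900 * ε) := by
  obtain ⟨e, f, he, hf, hef, hse, hsf⟩ := h
  obtain ⟨i, e', he', hee, hse'⟩ := hφ.improve_slab h0 hlow he hf hef hε hε' hρ hρ' hS hse hsf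
  obtain ⟨-, f', hf', hff, hsf'⟩ := hφ.improve_slab h0 hlow hf he (by rwa [real_inner_comm])
    hε hε' hρ hρ' hS hsf hse
  refine ⟨e', f', he', hf', ?_, hse', hsf'⟩
  have h1 : inner ℝ e' f' = inner ℝ e f + inner ℝ (e' - e) f + inner ℝ e' (f' - f) := by
    rw [inner_sub_left, inner_sub_right]; ring
  have h2 := real_inner_le_norm (e' - e) f
  have h3 := real_inner_le_norm e' (f' - f)
  rw [hf, mul_one] at h2
  rw [he', one_mul] at h3
  rw [h1]
  linarith

/-- Iterated improvement keeps the width bounded while the rate of growth diverges. -/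
theorem Tr.slab_iterate (hφ : Tr φ) (h0 : φ 0 = 0) (hlow : ∀ z, -(2 * ‖z‖) ≤ φ z)
    (h : TwoSlabs φ (10 ^ 21) 7) (n : ℕ) :
    TwoSlabs φ (16 ^ n * 10 ^ 21) (7 * (2 - (1 / 2) ^ n)) := by
  induction n with
  | zero => norm_num at h ⊢; exact h
  | succ n ih =>
    have q0 : (0 : ℝ) < (1 / 2) ^ n := by positivity
    have q1 : ((1 / 2) ^ n : ℝ) ≤ 1 := pow_le_one₀ (by norm_num) (by norm_num)
    have q2 : (1 : ℝ) ≤ ((1 / 2) ^ n) ^ 3 * 16 ^ n := by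
      rw [← pow_mul, mul_comm n 3, pow_mul, ← mul_pow]
      exact one_le_pow₀ (by norm_num)
    have hq : ((1 / 2) ^ (n + 1) : ℝ) = (1 / 2) ^ n / 2 := by rw [pow_succ]; ring
    rw [hq]
    generalize ((1 / 2) ^ n : ℝ) = q at *
    have := hφ.improve_twoSlabs h0 hlow (ε := q / 10000) (by positivity) (by linarith) (by linarith)
      (by linarith) (by
        have : (q / 10000) ^ 3 * (16 ^ n * 10 ^ 21) = 1000000000 * (q ^ 3 * 16 ^ n) := by ring
        rw [this]; linarith) ih
    obtain ⟨e, f, he, hf, hef, hse, hsf⟩ := this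
    refine ⟨e, f, he, hf, hef, hse.mono (by positivity) ?_ (by linarith),
      hsf.mono (by positivity) ?_ (by linarith)⟩ <;>
    · rw [pow_succ]; linarith

theorem Tr.not_twoSlabs (hφ : Tr φ) (h0 : φ 0 = 0) (hlow : ∀ z, -(2 * ‖z‖) ≤ φ z) :
    ¬ TwoSlabs φ (10 ^ 21) 7 := by
  intro h
  obtain ⟨M, hM⟩ := (isCompact_closedBall (0 : E3) 15).bddAbove_image hφ.sm.continuous.continuousOn
  obtain ⟨n, hn⟩ := pow_unbounded_of_one_lt M (show (1 : ℝ) < 16 by norm_num)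
  obtain ⟨e, f, he, hf, hef, hse, hsf⟩ := hφ.slab_iterate h0 hlow h n
  have hi : inner ℝ e ((15 : ℝ) • e) = 15 := by
    rw [inner_smul_right, real_inner_self_eq_norm_sq, he]; norm_num
  have q0 : (0 : ℝ) < (1 / 2) ^ n := by positivity
  have h1 := hse ((15 : ℝ) • e) (by rw [hi]; linarith)
  rw [hi] at h1
  have h2 : φ ((15 : ℝ) • e) ≤ M := hM ⟨_, by
    rw [mem_closedBall_zero_iff, norm_smul, he]; norm_num, rfl⟩
  have h3 : (16 : ℝ) ^ n * 1 ≤ 16 ^ n * (10 ^ 21 * (15 - 7 * (2 - (1 / 2) ^ n))) := by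
    gcongr
    norm_num
    linarith
  linarith

/-- No point of moderate slope is nearly cylindrical. -/
theorem exists_pinch : ∃ ε : ℝ, 0 < ε ∧ ∀ φ, Tr φ → ∀ x, 1 / 4 ≤ om b0 φ x →
    YY b0 φ x ≤ ε → ε < vv b0 φ x := by
  obtain ⟨ε, hε, H⟩ := exists_slabs (Λ := 10 ^ 21) (by norm_num)
  refine ⟨ε, hε, fun φ hφ x hom hY => ?_⟩
  by_contra! hv
  obtain ⟨e, f, he, hf, hef, hse, hsf⟩ := H φ hφ x hom hY hv
  refine (hφ.translate x (φ x)).not_twoSlabs (by simp) (fun z => hφ.neg_le hom z)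
    ⟨e, f, he, hf, hef, hse, hsf⟩

/-- No point is nearly cylindrical. -/
theorem exists_gap : ∃ ε : ℝ, 0 < ε ∧ ∀ φ, Tr φ → ∀ x, YY b0 φ x ≤ ε → ε < vv b0 φ x := by
  obtain ⟨ε, hε, H⟩ := exists_pinch
  obtain ⟨τ, hτ⟩ : ∃ τ, min (1 / 40) (ε / 3) = τ := ⟨_, rfl⟩
  have hτ0 : 0 < τ := by rw [← hτ]; positivity
  have hτ1 : τ ≤ 1 / 40 := hτ ▸ min_le_left _ _
  have hτ2 : τ ≤ ε / 3 := hτ ▸ min_le_right _ _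
  refine ⟨τ ^ 2 / 2, by positivity, fun φ hφ x hY => ?_⟩
  have hsm : τ ^ 2 / 2 ≤ τ / 80 := by nlinarith
  by_contra! hv
  rcases le_total (1 / 4) (om b0 φ x) with ho | ho
  · have := H φ hφ x ho (by linarith)
    linarith
  · have hv2 : 1 / τ * vv b0 φ x ≤ τ / 2 := by
      rw [one_div_mul_eq_div, div_le_iff₀ hτ0]; linarith
    obtain ⟨y, hy1, hy2⟩ := hφ.exists_moderate (μ := 1 / τ) hτ0 hτ1
      (by rw [mul_one_div_cancel hτ0.ne']) ho (by linarith)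
    have hp := hφ.point y
    have h1 : 1 ≤ 1 / τ := by rw [le_div_iff₀ hτ0]; linarith
    have h2 : 1 * vv b0 φ y ≤ 1 / τ * vv b0 φ y := mul_le_mul_of_nonneg_right h1 hp.1
    have h3 := hp.2.2.1
    have := H φ hφ y hy1.ge (by linarith)
    linarith

/-- The uniform lower bound for the linearised operator. -/
theorem exists_LL_pos : ∃ ε : ℝ, 0 < ε ∧ ∀ φ, Tr φ → ∀ x,
    ε ≤ LL b0 φ (fun y => φ y - lw φ y) x := by
  obtain ⟨ε, hε, H⟩ := exists_gap
  refine ⟨min (ε ^ 2 / 16) (ε / 2), by positivity, fun φ hφ x => ?_⟩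
  obtain ⟨v0, v1, y0, y1, vy, -, -, hL⟩ := hφ.point x
  have ho := om_pos b0 φ x
  refine le_trans ?_ hL
  rcases le_or_gt (YY b0 φ x) ε with hY | hY
  · have hv := H φ hφ x hY
    rcases le_total (om b0 φ x) (1 / 2) with h | h
    · refine (min_le_left _ _).trans ?_
      have : ε / 4 ≤ YY b0 φ x := by nlinarith
      nlinarith
    · refine (min_le_right _ _).trans ?_
      nlinarith [sq_nonneg (YY b0 φ x)]
  · refine (min_le_left _ _).trans ?_
    nlinarith [mul_nonneg ho.le v0]

theorem log_Hmc (φ : E3 → ℝ) (x : E3) : log (Hmc φ x) = -lw φ x := by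
  have h : 0 ≤ 1 + gv b0 φ x ⬝ᵥ gv b0 φ x := by
    have := W2_pos b0 φ x
    linarith
  rw [Hmc_eq, log_inv, log_sqrt h]
  rw [lw]; ring

end

/-- for a smooth convex entire solution of the translator equation
(i.e. a noncollapsed translator in ℝ⁴), there is ε > 0 with
L_φ(φ + log H_φ) ≥ ε·H_φ everywhere. -/
theorem statement4 (φ : E3 → ℝ) (hφ : ContDiff ℝ (⊤ : ℕ∞) φ)
    (hconv : ConvexOn ℝ Set.univ φ) (hsol : ∀ x, Θop φ x = 0) :
    ∃ ε : ℝ, 0 < ε ∧ ∀ x : E3,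
      Lop φ (fun y => φ y + log (Hmc φ y)) x ≥ ε * Hmc φ x := by
  obtain ⟨ε, hε, H⟩ := exists_LL_pos
  have hT := Tr.of hφ hconv hsol
  refine ⟨ε, hε, fun x => ?_⟩
  have h1 : (fun y => φ y + log (Hmc φ y)) = fun y => φ y - lw φ y := by
    funext y
    rw [log_Hmc, sub_eq_add_neg]
  rw [h1, Lop_eq hT (hφ.sub (sm_lw hφ)), ge_iff_le, mul_comm]
  exact mul_le_mul_of_nonneg_left (H φ hT x) (Hmc_pos φ x).le
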